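/- Let Π_n^B := sup_{x∈B^d} a_κ^B ∫_{B^d} |P_n(W_κ^B;x,y)| W_κ^B(y) dy, which is the operator norm of the orthogonal projection proj_n(W_κ^B) on L^∞(W_κ^B;B^d) (and on L¹(W_κ^B;B^d)). Then there exists c₂ > 0, depending only on d and κ, with Π_n^B ≤ c₂ n^{σ_κ} for all n ≥ 1; moreover there exists c₁ > 0 such that Π_n^B ≥ c₁ n^{σ_κ} for all n ≥ 1 satisfying: n is even, or min_{1≤i≤d} κ_i = min_{1≤i≤d+1} κ_i. -/

import Mathlib

open MeasureTheory Finset Real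

/-- Generalized binomial coefficient `C(x, k) = x (x-1) ⋯ (x-k+1) / k!`. -/
noncomputable def genBinom (x : ℝ) (k : ℕ) : ℝ :=
  (∏ i ∈ Finset.range k, (x - i)) / (Nat.factorial k)

/-- Jacobi polynomial `P_n^{(a,b)}(t)`. -/
noncomputable def jacobiP (n : ℕ) (a b t : ℝ) : ℝ :=
  ∑ m ∈ Finset.range (n + 1),
    genBinom (n + a) (n - m) * genBinom (n + b) m * ((t - 1) / 2) ^ m * ((t + 1) / 2) ^ (n - m)

/-- Pochhammer symbol `(a)_n`. -/
noncomputable def poch (a : ℝ) (n : ℕ) : ℝ := ∏ i ∈ Finset.range n, (a + i)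

/-- Gegenbauer polynomial `C_n^λ(t)`. -/
noncomputable def gegenC (n : ℕ) (l t : ℝ) : ℝ :=
  (poch (2 * l) n / poch (l + 1 / 2) n) * jacobiP n (l - 1 / 2) (l - 1 / 2) t

/-- Cesàro coefficient `A_m^δ = C(m+δ, m)`. -/
noncomputable def cesA (δ : ℝ) (m : ℕ) : ℝ := genBinom (m + δ) m

/-- The cube `[-1,1]^m`. -/
def cube (m : ℕ) : Set (Fin m → ℝ) := Set.univ.pi fun _ => Set.Icc (-1) 1

/-- The weight `∏ (1+t_i)(1-t_i²)^{κ_i-1}` on the cube. -/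
noncomputable def wprod {m : ℕ} (κ : Fin m → ℝ) (t : Fin m → ℝ) : ℝ :=
  ∏ i, (1 + t i) * (1 - t i ^ 2) ^ (κ i - 1)

/-- `λ_κ = |κ| + (d-1)/2`. -/
noncomputable def lamK (d : ℕ) (κ : Fin (d + 1) → ℝ) : ℝ := (∑ i, κ i) + ((d : ℝ) - 1) / 2

/-- The reproducing kernel `P_n(h_κ²; x, y)` on the sphere. -/
noncomputable def hP (d : ℕ) (κ : Fin (d + 1) → ℝ) (n : ℕ)
    (x y : EuclideanSpace ℝ (Fin (d + 1))) : ℝ :=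
  (∫ t in cube (d + 1), wprod κ t)⁻¹ * ((n + lamK d κ) / lamK d κ) *
    ∫ t in cube (d + 1), gegenC n (lamK d κ) (∑ i, x i * y i * t i) * wprod κ t

/-- The Cesàro `(C,δ)` kernel `K_n^δ(h_κ²; x, y)` on the sphere. -/
noncomputable def hK (d : ℕ) (κ : Fin (d + 1) → ℝ) (δ : ℝ) (n : ℕ)
    (x y : EuclideanSpace ℝ (Fin (d + 1))) : ℝ :=
  (cesA δ n)⁻¹ * ∑ k ∈ Finset.range (n + 1), cesA δ (n - k) * hP d κ k x y

/-- `z̄ = (|z_1|, …, |z_{d+1}|)`. -/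
noncomputable def ebar {m : ℕ} (z : EuclideanSpace ℝ (Fin m)) : EuclideanSpace ℝ (Fin m) :=
  (EuclideanSpace.equiv (Fin m) ℝ).symm fun i => |z i|

/-- `h_κ²(y) = ∏ |y_i|^{2κ_i}`. -/
noncomputable def hsq {m : ℕ} (κ : Fin m → ℝ) (y : EuclideanSpace ℝ (Fin m)) : ℝ :=
  ∏ i, |y i| ^ (2 * κ i)

/-- `σ_κ = (d-1)/2 + |κ| - min_i κ_i`. -/
noncomputable def sigmaK (d : ℕ) (κ : Fin (d + 1) → ℝ) : ℝ :=
  ((d : ℝ) - 1) / 2 + (∑ i, κ i) - Finset.univ.inf' (Finset.univ_nonempty) κ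

/-- The surface measure `dω` on the unit sphere `S^d`. -/
noncomputable def sphereMeas (d : ℕ) :
    Measure (Metric.sphere (0 : EuclideanSpace ℝ (Fin (d + 1))) 1) :=
  (volume : Measure (EuclideanSpace ℝ (Fin (d + 1)))).toSphere

/-- Lift `x ∈ B^d` together with last coordinate `s` to a point of `ℝ^{d+1}`. -/
noncomputable def liftB (d : ℕ) (x : EuclideanSpace ℝ (Fin d)) (s : ℝ) :
    EuclideanSpace ℝ (Fin (d + 1)) :=
  (EuclideanSpace.equiv (Fin (d + 1)) ℝ).symm fun i =>
    if h : (i : ℕ) < d then x ⟨i, h⟩ else s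

/-- The weight `W_κ^B(x) = ∏_{i=1}^d |x_i|^{2κ_i} (1-‖x‖²)^{κ_{d+1}-1/2}` on the unit ball. -/
noncomputable def WB (d : ℕ) (κ : Fin (d + 1) → ℝ) (x : EuclideanSpace ℝ (Fin d)) : ℝ :=
  (∏ i : Fin d, |x i| ^ (2 * κ i.castSucc)) * (1 - ‖x‖ ^ 2) ^ (κ (Fin.last d) - 1 / 2)

/-- The Cesàro `(C,δ)` kernel `K_n^δ(W_κ^B; x, y)` on the unit ball. -/
noncomputable def ballK (d : ℕ) (κ : Fin (d + 1) → ℝ) (δ : ℝ) (n : ℕ)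
    (x y : EuclideanSpace ℝ (Fin d)) : ℝ :=
  (hK d κ δ n (liftB d x (Real.sqrt (1 - ‖x‖ ^ 2))) (liftB d y (Real.sqrt (1 - ‖y‖ ^ 2))) +
    hK d κ δ n (liftB d x (Real.sqrt (1 - ‖x‖ ^ 2))) (liftB d y (-Real.sqrt (1 - ‖y‖ ^ 2)))) / 2

/-- The projection kernel `P_n(W_κ^B; x, y)` on the unit ball. -/
noncomputable def ballP (d : ℕ) (κ : Fin (d + 1) → ℝ) (n : ℕ)
    (x y : EuclideanSpace ℝ (Fin d)) : ℝ :=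
  (hP d κ n (liftB d x (Real.sqrt (1 - ‖x‖ ^ 2))) (liftB d y (Real.sqrt (1 - ‖y‖ ^ 2))) +
    hP d κ n (liftB d x (Real.sqrt (1 - ‖x‖ ^ 2))) (liftB d y (-Real.sqrt (1 - ‖y‖ ^ 2)))) / 2

/-- The operator norm `Π_n^B = sup_{x∈B^d} a_κ^B ∫_{B^d} |P_n(W_κ^B;x,y)| W_κ^B(y) dy`. -/
noncomputable def projNormB (d : ℕ) (κ : Fin (d + 1) → ℝ) (n : ℕ) : ℝ :=
  ⨆ x : Metric.closedBall (0 : EuclideanSpace ℝ (Fin d)) 1,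
    (∫ y in Metric.closedBall (0 : EuclideanSpace ℝ (Fin d)) 1, WB d κ y)⁻¹ *
      ∫ y in Metric.closedBall (0 : EuclideanSpace ℝ (Fin d)) 1, |ballP d κ n x y| * WB d κ y

lemma poch_zero (a : ℝ) : poch a 0 = 1 := by simp [poch]

lemma poch_succ (a : ℝ) (n : ℕ) : poch a (n + 1) = poch a n * (a + n) := by
  simp [poch, Finset.prod_range_succ]

lemma poch_succ' (a : ℝ) (n : ℕ) : poch a (n + 1) = a * poch (a + 1) n := by
  simp only [poch, Finset.prod_range_succ']
  rw [mul_comm]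
  simp only [Nat.cast_zero, add_zero, Nat.cast_add, Nat.cast_one]
  congr 1
  exact Finset.prod_congr rfl fun i _ => by ring

lemma poch_add (a : ℝ) (m n : ℕ) : poch a (m + n) = poch a m * poch (a + m) n := by
  induction n with
  | zero => simp [poch_zero]
  | succ k ih => rw [← add_assoc, poch_succ, ih, poch_succ]; push_cast; ring

lemma poch_pos {a : ℝ} (ha : 0 < a) (n : ℕ) : 0 < poch a n :=
  Finset.prod_pos fun i _ => by positivity

lemma poch_ne_zero {a : ℝ} (ha : 0 < a) (n : ℕ) : poch a n ≠ 0 := (poch_pos ha n).ne'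

lemma poch_two_mul (a : ℝ) (n : ℕ) :
    poch (2 * a) (2 * n) = 4 ^ n * poch a n * poch (a + 1 / 2) n := by
  induction n with
  | zero => simp [poch_zero]
  | succ k ih =>
    rw [show 2 * (k + 1) = 2 * k + 1 + 1 by ring, poch_succ, poch_succ, ih, poch_succ, poch_succ]
    push_cast; ring

lemma genBinom_eq_choose (x : ℝ) (k : ℕ) : genBinom x k = Ring.choose x k := by
  have h := Ring.descPochhammer_eq_factorial_smul_choose x k
  have h2 : (descPochhammer ℤ k).smeval x = ∏ i ∈ Finset.range k, (x - i) := by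
    induction k with
    | zero => simp
    | succ _ ih =>
      have := ih (Ring.descPochhammer_eq_factorial_smul_choose x _)
      rw [descPochhammer_succ_right, Polynomial.smeval_mul, this, Finset.prod_range_succ,
        Polynomial.smeval_sub, Polynomial.smeval_X, Polynomial.smeval_natCast]
      simp
  rw [h2] at h
  rw [genBinom, h, nsmul_eq_mul]
  field_simp

lemma genBinom_add_eq_poch (a : ℝ) (n : ℕ) :
    genBinom (a + n) n = poch (a + 1) n / n.factorial := by
  rw [genBinom, poch, ← Finset.prod_range_reflect]
  congr 1
  refine Finset.prod_congr rfl fun i hi => ?_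
  have hi := Finset.mem_range.1 hi
  have : ((n - 1 - i : ℕ) : ℝ) = n - 1 - i := by
    rw [Nat.cast_sub (by omega), Nat.cast_sub (by omega)]; simp
  rw [this]; ring

lemma genBinom_succ (x : ℝ) (k : ℕ) : genBinom x (k + 1) * (k + 1) = genBinom x k * (x - k) := by
  simp only [genBinom, Finset.prod_range_succ, Nat.factorial_succ]
  push_cast
  have : (k.factorial : ℝ) ≠ 0 := by positivity
  have : (k : ℝ) + 1 ≠ 0 := by positivity
  field_simp

/-- `(a)_m / m!` grows like `(m+1)^(a-1)`. -/
lemma poch_div_factorial_bounds {a : ℝ} (ha : 0 < a) :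
    ∃ c C : ℝ, 0 < c ∧ 0 < C ∧ ∀ m : ℕ,
      c * ((m : ℝ) + 1) ^ (a - 1) ≤ poch a m / m.factorial ∧
      poch a m / m.factorial ≤ C * ((m : ℝ) + 1) ^ (a - 1) := by
  set f : ℕ → ℝ := fun m => poch a m / m.factorial / ((m : ℝ) + 1) ^ (a - 1) with hf
  have hpos : ∀ m, 0 < f m := fun m => by
    have := poch_pos ha m
    simp only [hf]; positivity
  have hG := Real.GammaSeq_tendsto_Gamma a
  have hG0 : 0 < Real.Gamma a := Real.Gamma_pos_of_pos ha
  have hlim : Filter.Tendsto f Filter.atTop (nhds (Real.Gamma a)⁻¹) := by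
    have h1 := hG.inv₀ hG0.ne'
    have h2 : Filter.Tendsto (fun m : ℕ => ((m : ℝ) / (m + 1)) ^ (a - 1) * ((m : ℝ) / (m + a)))
        Filter.atTop (nhds 1) := by
      have h3 := (tendsto_natCast_div_add_atTop (1 : ℝ)).rpow_const (p := a - 1)
        (Or.inl one_ne_zero)
      simpa using h3.mul (tendsto_natCast_div_add_atTop a)
    have h5 := h1.mul h2
    rw [mul_one] at h5
    refine h5.congr' ?_
    filter_upwards [Filter.eventually_ge_atTop 1] with m hm
    have hm0 : (0 : ℝ) < m := by exact_mod_cast hm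
    have hp := poch_pos ha m
    have hp1 : ∏ j ∈ range (m + 1), (a + (j : ℝ)) = poch a m * (a + m) := poch_succ a m
    have ham : 0 < a + m := by positivity
    simp only [hf, Real.GammaSeq]
    rw [hp1, Real.div_rpow hm0.le (by positivity), Real.rpow_sub_one hm0.ne']
    have e1 : (0 : ℝ) < (m : ℝ) ^ a := by positivity
    have e2 : (0 : ℝ) < ((m : ℝ) + 1) ^ (a - 1) := by positivity
    rw [add_comm (m : ℝ) a]
    field_simp
  have hlim' : Filter.Tendsto (fun m => (f m)⁻¹) Filter.atTop (nhds (Real.Gamma a)) := by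
    simpa using hlim.inv₀ (inv_ne_zero hG0.ne')
  obtain ⟨C, hC⟩ := hlim.bddAbove_range
  obtain ⟨D, hD⟩ := hlim'.bddAbove_range
  have hC' : ∀ m, f m ≤ C := fun m => hC ⟨m, rfl⟩
  have hD' : ∀ m, (f m)⁻¹ ≤ D := fun m => hD ⟨m, rfl⟩
  have hDpos : 0 < D := (inv_pos.2 (hpos 0)).trans_le (hD' 0)
  refine ⟨D⁻¹, C, inv_pos.2 hDpos, (hpos 0).trans_le (hC' 0), fun m => ?_⟩
  have e2 : (0 : ℝ) < ((m : ℝ) + 1) ^ (a - 1) := by positivity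
  refine ⟨?_, (div_le_iff₀ e2).1 (hC' m)⟩
  rw [← le_div_iff₀ e2]
  exact inv_le_of_inv_le₀ (hpos m) (hD' m)

section Gegenbauer
open Polynomial

/-- The polynomial `((X-1)/2)^m ((X+1)/2)^k`. -/
noncomputable def jacTerm (m k : ℕ) : ℝ[X] :=
  (C (1 / 2) * (X - 1)) ^ m * (C (1 / 2) * (X + 1)) ^ k

lemma jacTerm_ode (m k : ℕ) (l : ℝ) :
    (C (1 / 2) * (X - 1)) * (C (1 / 2) * (X + 1)) *
      ((1 - X ^ 2) * derivative (derivative (jacTerm m k)) -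
        C (2 * l + 1) * X * derivative (jacTerm m k) +
        C (((m + k : ℕ) : ℝ) * ((m + k : ℕ) + 2 * l)) * jacTerm m k) =
    C (k * (k + (l - 1 / 2))) * jacTerm (m + 1) k - C (m * (m + (l - 1 / 2))) * jacTerm m (k + 1) := by
  set h : ℝ[X] := C (1 / 2) with hh
  have h2 : 2 * h = 1 := by
    rw [hh, ← C_ofNat, ← C_mul]; norm_num
  set A : ℝ[X] := h * (X - 1) with hA
  set B : ℝ[X] := h * (X + 1) with hB
  have hX : X = A + B := by simp only [hA, hB]; linear_combination (-X) * h2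
  have hBA : B = A + 1 := by simp only [hA, hB]; linear_combination h2
  have dA : derivative A = h := by simp [hA, hh]
  have dB : derivative B = h := by simp [hB, hh]
  have pA : ∀ m : ℕ, 2 * (A * derivative (A ^ m)) = (m : ℝ[X]) * A ^ m := by
    intro m
    rcases m with _ | m
    · simp
    · rw [derivative_pow_succ, dA, pow_succ]
      simp only [map_add, map_natCast, map_one]
      push_cast
      linear_combination (((m : ℝ[X]) + 1) * A ^ m * A) * h2
  have pB : ∀ m : ℕ, 2 * (B * derivative (B ^ m)) = (m : ℝ[X]) * B ^ m := by
    intro m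
    rcases m with _ | m
    · simp
    · rw [derivative_pow_succ, dB, pow_succ]
      simp only [map_add, map_natCast, map_one]
      push_cast
      linear_combination (((m : ℝ[X]) + 1) * B ^ m * B) * h2
  have hT : jacTerm m k = A ^ m * B ^ k := rfl
  have hT1 : jacTerm (m + 1) k = A * jacTerm m k := by rw [hT, jacTerm]; ring
  have hT2 : jacTerm m (k + 1) = B * jacTerm m k := by rw [hT, jacTerm]; ring
  rw [hT1, hT2]
  set T := jacTerm m k with hTdef
  have h1 : 2 * (A * B * derivative T) = ((m : ℝ[X]) * B + (k : ℝ[X]) * A) * T := by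
    rw [hT, derivative_mul]
    linear_combination (B * B ^ k) * pA m + (A * A ^ m) * pB k
  have h3 := congrArg derivative h1
  simp only [derivative_mul, derivative_add, dA, dB, derivative_natCast, derivative_ofNat] at h3
  have h4 : 4 * (A * B * derivative (derivative T)) + 2 * ((A + B) * derivative T) =
      ((m : ℝ[X]) + k) * T + 2 * ((m * B + k * A) * derivative T) := by
    linear_combination 2 * h3 + (((m : ℝ[X]) + k) * T - 2 * (A + B) * derivative T) * h2
  set α : ℝ[X] := C (l - 1 / 2) with hα
  have e1 : (C (2 * l + 1) : ℝ[X]) = 2 * α + 2 := by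
    rw [hα, ← C_ofNat, ← C_mul, ← C_add]; congr 1; ring
  have e2 : (C (((m + k : ℕ) : ℝ) * ((m + k : ℕ) + 2 * l)) : ℝ[X]) =
      ((m : ℝ[X]) + k) * (m + k + 2 * α + 1) := by
    rw [hα, ← C_ofNat, ← C_eq_natCast, ← C_eq_natCast, ← C_1]
    simp only [← C_mul, ← C_add]
    congr 1; push_cast; ring
  have e3 : ∀ j : ℕ, (C ((j : ℝ) * (j + (l - 1 / 2))) : ℝ[X]) = (j : ℝ[X]) * (j + α) := by
    intro j
    rw [hα, ← C_eq_natCast, ← C_add, ← C_mul]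
  rw [e1, e2, e3, e3, hX]
  rw [hBA] at h1 h4 ⊢
  clear_value α A T
  have h5 : (1 : ℝ[X]) - (A + (A + 1)) ^ 2 = - 4 * (A * (A + 1)) := by ring
  rw [h5]
  linear_combination (-(A * (A + 1))) * h4 +
    ((-α) * (A + (A+1)) - (m * (A + 1) + k * A)) * h1

/-- The Jacobi polynomial `P_n^{(l-1/2,l-1/2)}` as an element of `ℝ[X]`. -/
noncomputable def jacPoly (n : ℕ) (l : ℝ) : ℝ[X] :=
  ∑ m ∈ range (n + 1),
    C (genBinom (n + (l - 1 / 2)) (n - m) * genBinom (n + (l - 1 / 2)) m) * jacTerm m (n - m)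

lemma eval_jacPoly (n : ℕ) (l t : ℝ) :
    (jacPoly n l).eval t = jacobiP n (l - 1 / 2) (l - 1 / 2) t := by
  simp only [jacPoly, jacTerm, jacobiP, eval_finsetSum, eval_mul, eval_C, eval_pow, eval_sub,
    eval_add, eval_X, eval_one]
  refine sum_congr rfl fun m _ => ?_
  rw [show (t - 1) / 2 = 1 / 2 * (t - 1) by ring, show (t + 1) / 2 = 1 / 2 * (t + 1) by ring]
  ring

lemma jacPoly_ode (n : ℕ) (l : ℝ) :
    (1 - X ^ 2) * derivative (derivative (jacPoly n l)) -
        C (2 * l + 1) * X * derivative (jacPoly n l) +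
        C ((n : ℝ) * (n + 2 * l)) * jacPoly n l = 0 := by
  set c : ℕ → ℝ := fun m =>
    genBinom (n + (l - 1 / 2)) (n - m) * genBinom (n + (l - 1 / 2)) m with hc
  have hrec : ∀ m < n, c m * (((n - m : ℕ) : ℝ) * ((n - m : ℕ) + (l - 1 / 2))) =
      c (m + 1) * (((m + 1 : ℕ) : ℝ) * ((m + 1 : ℕ) + (l - 1 / 2))) := by
    intro m hm
    obtain ⟨k, rfl⟩ := Nat.exists_eq_add_of_lt hm
    simp only [hc]
    have e1 : m + k + 1 - m = k + 1 := by omega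
    have e2 : m + k + 1 - (m + 1) = k := by omega
    rw [e1, e2]
    have g1 := genBinom_succ (((m + k + 1 : ℕ) : ℝ) + (l - 1 / 2)) k
    have g2 := genBinom_succ (((m + k + 1 : ℕ) : ℝ) + (l - 1 / 2)) m
    push_cast at g1 g2 ⊢
    generalize genBinom ((m : ℝ) + k + 1 + (l - 1 / 2)) (k + 1) = a1 at *
    generalize genBinom ((m : ℝ) + k + 1 + (l - 1 / 2)) (m + 1) = a2 at *
    generalize genBinom ((m : ℝ) + k + 1 + (l - 1 / 2)) k = b1 at *
    generalize genBinom ((m : ℝ) + k + 1 + (l - 1 / 2)) m = b2 at *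
    linear_combination (b2 * (k + 1 + (l - 1 / 2))) * g1 - (b1 * (m + 1 + (l - 1 / 2))) * g2
  have hne : (C (1 / 2) * (X - 1)) * (C (1 / 2) * (X + 1)) ≠ (0 : ℝ[X]) := by
    have h1 : (X - 1 : ℝ[X]) ≠ 0 := by simpa using X_sub_C_ne_zero (1 : ℝ)
    have h2 : (X + 1 : ℝ[X]) ≠ 0 := by simpa using X_add_C_ne_zero (1 : ℝ)
    have h3 : (C (1 / 2) : ℝ[X]) ≠ 0 := C_ne_zero.2 (by norm_num)
    exact mul_ne_zero (mul_ne_zero h3 h1) (mul_ne_zero h3 h2)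
  refine (mul_eq_zero.1 ?_).resolve_left hne
  set f : ℕ → ℝ[X] := fun m =>
    C (c m * ((m : ℝ) * (m + (l - 1 / 2)))) * jacTerm m (n + 1 - m) with hf
  have hsum : (C (1 / 2) * (X - 1)) * (C (1 / 2) * (X + 1)) *
      ((1 - X ^ 2) * derivative (derivative (jacPoly n l)) -
        C (2 * l + 1) * X * derivative (jacPoly n l) +
        C ((n : ℝ) * (n + 2 * l)) * jacPoly n l) =
      ∑ m ∈ range (n + 1), C (c m) *
        (C (((n - m : ℕ) : ℝ) * ((n - m : ℕ) + (l - 1 / 2))) * jacTerm (m + 1) (n - m) -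
          C ((m : ℝ) * (m + (l - 1 / 2))) * jacTerm m (n - m + 1)) := by
    simp only [jacPoly, derivative_sum, derivative_C_mul]
    rw [mul_sum, mul_sum, mul_sum, ← sum_sub_distrib, ← sum_add_distrib, mul_sum]
    refine sum_congr rfl fun m hm => ?_
    have hm' : m + (n - m) = n := by have := mem_range.1 hm; omega
    rw [← jacTerm_ode, hm']
    simp only [hc]
    ring
  rw [hsum, sum_range_succ]
  have h1 : ∀ m ∈ range n, C (c m) *
        (C (((n - m : ℕ) : ℝ) * ((n - m : ℕ) + (l - 1 / 2))) * jacTerm (m + 1) (n - m) -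
          C ((m : ℝ) * (m + (l - 1 / 2))) * jacTerm m (n - m + 1)) = f (m + 1) - f m := by
    intro m hm
    have hm' := mem_range.1 hm
    have e1 : n + 1 - (m + 1) = n - m := by omega
    have e2 : n + 1 - m = n - m + 1 := by omega
    simp only [hf]
    rw [e1, e2, ← hrec m hm']
    simp only [C_mul]
    ring
  rw [sum_congr rfl h1, sum_range_sub]
  simp [hf, C_mul]
  ring

lemma coeff_of_gegenbauer_ode {P : ℝ[X]} {n : ℕ} {l : ℝ}
    (h : (1 - X ^ 2) * derivative (derivative P) - C (2 * l + 1) * X * derivative P +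
        C ((n : ℝ) * (n + 2 * l)) * P = 0) (k : ℕ) :
    ((n : ℝ) - k) * (n + k + 2 * l) * P.coeff k = -((k + 2) * (k + 1) * P.coeff (k + 2)) := by
  have h1 := congrArg (fun Q => coeff Q k) h
  simp only [sub_mul, one_mul, coeff_add, coeff_sub, coeff_C_mul, coeff_derivative, mul_assoc,
    coeff_zero] at h1
  rcases k with _ | _ | k
  · simp [coeff_derivative] at h1 ⊢
    linarith
  · simp [coeff_X_pow_mul', coeff_derivative, coeff_X_mul] at h1 ⊢
    linarith
  · simp [coeff_X_pow_mul', coeff_derivative, coeff_X_mul] at h1 ⊢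
    linarith

/-- The Gegenbauer polynomial in power form, as an element of `ℝ[X]`. -/
noncomputable def gegenPoly (n : ℕ) (l : ℝ) : ℝ[X] :=
  ∑ p ∈ range (n / 2 + 1),
    C ((-1) ^ p * poch l (n - p) / (p.factorial * (n - 2 * p).factorial) * 2 ^ (n - 2 * p)) *
      X ^ (n - 2 * p)

lemma jacTerm_natDegree_le (m k : ℕ) : (jacTerm m k).natDegree ≤ m + k := by
  have h1 : (C (1 / 2) * (X - 1) : ℝ[X]).natDegree ≤ 1 := by compute_degree
  have h2 : (C (1 / 2) * (X + 1) : ℝ[X]).natDegree ≤ 1 := by compute_degree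
  refine natDegree_mul_le_of_le ?_ ?_
  · simpa using natDegree_pow_le_of_le m h1
  · simpa using natDegree_pow_le_of_le k h2

lemma jacTerm_coeff_top (m k : ℕ) : (jacTerm m k).coeff (m + k) = (1 / 2) ^ (m + k) := by
  have h1 : (C (1 / 2) * (X - 1) : ℝ[X]).natDegree ≤ 1 := by compute_degree
  have h2 : (C (1 / 2) * (X + 1) : ℝ[X]).natDegree ≤ 1 := by compute_degree
  have a1 := coeff_pow_of_natDegree_le (m := m) h1
  have a2 := coeff_pow_of_natDegree_le (m := k) h2
  have c1 : (C (1 / 2) * (X - 1) : ℝ[X]).coeff 1 = 1 / 2 := by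
    simp [coeff_X, coeff_one]
  have c2 : (C (1 / 2) * (X + 1) : ℝ[X]).coeff 1 = 1 / 2 := by
    simp [coeff_X, coeff_one]
  rw [mul_one, c1] at a1
  rw [mul_one, c2] at a2
  rw [jacTerm, coeff_mul_add_eq_of_natDegree_le, a1, a2, pow_add]
  · simpa using natDegree_pow_le_of_le m h1
  · simpa using natDegree_pow_le_of_le k h2

lemma jacPoly_coeff_of_lt {n k : ℕ} (l : ℝ) (h : n < k) : (jacPoly n l).coeff k = 0 := by
  rw [jacPoly, finsetSum_coeff]
  refine sum_eq_zero fun m hm => ?_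
  rw [coeff_C_mul, coeff_eq_zero_of_natDegree_lt, mul_zero]
  have := jacTerm_natDegree_le m (n - m)
  have := mem_range.1 hm
  omega

lemma jacPoly_coeff_top (n : ℕ) (l : ℝ) :
    (jacPoly n l).coeff n = poch (2 * l + n) n / n.factorial / 2 ^ n := by
  have h1 : (jacPoly n l).coeff n = (∑ m ∈ range (n + 1),
      Ring.choose (n + (l - 1 / 2)) m * Ring.choose (n + (l - 1 / 2)) (n - m)) * (1 / 2) ^ n := by
    rw [jacPoly, finsetSum_coeff, sum_mul]
    refine sum_congr rfl fun m hm => ?_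
    have hm' : m + (n - m) = n := by have := mem_range.1 hm; omega
    have := jacTerm_coeff_top m (n - m)
    rw [hm'] at this
    rw [coeff_C_mul, this, genBinom_eq_choose, genBinom_eq_choose]
    ring
  have h2 := Ring.add_choose_eq n (Commute.all ((n : ℝ) + (l - 1 / 2)) (n + (l - 1 / 2)))
  rw [Nat.sum_antidiagonal_eq_sum_range_succ
    (fun i j => Ring.choose ((n : ℝ) + (l - 1 / 2)) i * Ring.choose ((n : ℝ) + (l - 1 / 2)) j)] at h2
  rw [h1, ← h2, ← genBinom_eq_choose,
    show (n : ℝ) + (l - 1 / 2) + (n + (l - 1 / 2)) = (2 * l + n - 1) + n by ring,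
    genBinom_add_eq_poch]
  rw [sub_add_cancel, one_div, inv_pow, div_eq_mul_inv _ ((2 : ℝ) ^ n)]

lemma gegenPoly_coeff_of_lt {n k : ℕ} (l : ℝ) (h : n < k) : (gegenPoly n l).coeff k = 0 := by
  rw [gegenPoly, finsetSum_coeff]
  refine sum_eq_zero fun p _ => ?_
  rw [coeff_C_mul, coeff_X_pow, if_neg (by omega), mul_zero]

lemma gegenPoly_coeff_even {n p : ℕ} (l : ℝ) (h : 2 * p ≤ n) :
    (gegenPoly n l).coeff (n - 2 * p) =
      (-1) ^ p * poch l (n - p) / (p.factorial * (n - 2 * p).factorial) * 2 ^ (n - 2 * p) := by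
  rw [gegenPoly, finsetSum_coeff, sum_eq_single p]
  · rw [coeff_C_mul, coeff_X_pow, if_pos rfl, mul_one]
  · intro q hq hqp
    have := mem_range.1 hq
    rw [coeff_C_mul, coeff_X_pow, if_neg (by omega), mul_zero]
  · intro hp
    exact absurd (mem_range.2 (by omega)) hp

lemma gegenPoly_coeff_odd {n p : ℕ} (l : ℝ) (h : 2 * p + 1 ≤ n) :
    (gegenPoly n l).coeff (n - (2 * p + 1)) = 0 := by
  rw [gegenPoly, finsetSum_coeff]
  refine sum_eq_zero fun q hq => ?_
  have := mem_range.1 hq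
  rw [coeff_C_mul, coeff_X_pow, if_neg (by omega), mul_zero]

lemma jacPoly_eq {l : ℝ} (hl : 0 < l) (n : ℕ) :
    C (poch (2 * l) n / poch (l + 1 / 2) n) * jacPoly n l = gegenPoly n l := by
  set P := C (poch (2 * l) n / poch (l + 1 / 2) n) * jacPoly n l with hP
  have hrec : ∀ k, ((n : ℝ) - k) * (n + k + 2 * l) * P.coeff k =
      -((k + 2) * (k + 1) * P.coeff (k + 2)) := by
    intro k
    have := coeff_of_gegenbauer_ode (jacPoly_ode n l) k
    rw [hP, coeff_C_mul, coeff_C_mul]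
    linear_combination (poch (2 * l) n / poch (l + 1 / 2) n) * this
  have hgt : ∀ k, n < k → P.coeff k = 0 := fun k hk => by
    rw [hP, coeff_C_mul, jacPoly_coeff_of_lt l hk, mul_zero]
  have htop : P.coeff n = 2 ^ n * poch l n / n.factorial := by
    rw [hP, coeff_C_mul, jacPoly_coeff_top]
    have h1 := poch_add (2 * l) n n
    rw [← two_mul, poch_two_mul] at h1
    have h2 := poch_ne_zero (show 0 < l + 1 / 2 by positivity) n
    have h4 : (4 : ℝ) ^ n = 2 ^ n * 2 ^ n := by rw [← mul_pow]; norm_num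
    rw [h4] at h1
    generalize poch (l + 1 / 2) n = q at *
    field_simp
    linear_combination -h1
  have hodd : ∀ p, 2 * p + 1 ≤ n → P.coeff (n - (2 * p + 1)) = 0 := by
    intro p
    induction p with
    | zero =>
      intro h
      have := hrec (n - 1)
      rw [hgt (n - 1 + 2) (by omega), Nat.cast_sub (by omega)] at this
      push_cast at this
      have h5 : (1 : ℝ) ≤ n := by exact_mod_cast h
      have h6 : (0 : ℝ) < n + (n - 1) + 2 * l := by linarith
      simpa [h6.ne'] using this
    | succ p ih =>
      intro h
      have := hrec (n - (2 * (p + 1) + 1))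
      rw [show n - (2 * (p + 1) + 1) + 2 = n - (2 * p + 1) by omega, ih (by omega),
        Nat.cast_sub (by omega)] at this
      have h6 : (0 : ℝ) < n + (n - (2 * (p + 1) + 1 : ℕ)) + 2 * l := by
        have : ((2 * (p + 1) + 1 : ℕ) : ℝ) ≤ n := by exact_mod_cast h
        linarith
      have h7 : (0 : ℝ) < n - (n - (2 * (p + 1) + 1 : ℕ)) := by
        rw [sub_sub_cancel]; positivity
      rw [mul_zero, neg_zero] at this
      exact (mul_eq_zero.1 this).resolve_left (mul_pos h7 h6).ne'
  have heven : ∀ p, 2 * p ≤ n → P.coeff (n - 2 * p) =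
      (-1) ^ p * poch l (n - p) / (p.factorial * (n - 2 * p).factorial) * 2 ^ (n - 2 * p) := by
    intro p
    induction p with
    | zero => intro _; simp [htop]; ring
    | succ p ih =>
      intro h
      obtain ⟨k, rfl⟩ := Nat.exists_eq_add_of_le h
      have := hrec k
      have ih := ih (by omega)
      rw [show 2 * (p + 1) + k - 2 * p = k + 2 by omega,
        show 2 * (p + 1) + k - p = (p + 1 + k) + 1 by omega] at ih
      rw [ih, poch_succ, Nat.factorial_succ, Nat.factorial_succ] at this
      rw [show 2 * (p + 1) + k - 2 * (p + 1) = k by omega,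
        show 2 * (p + 1) + k - (p + 1) = p + 1 + k by omega, Nat.factorial_succ p]
      have f1 : (p.factorial : ℝ) ≠ 0 := by positivity
      have f2 : (k.factorial : ℝ) ≠ 0 := by positivity
      have f3 : (p + 1 : ℝ) ≠ 0 := by positivity
      have f4 : (p + 1 + k + l : ℝ) ≠ 0 := by positivity
      have f5 : (k + 1 : ℝ) ≠ 0 := by positivity
      have f6 : (k + 2 : ℝ) ≠ 0 := by positivity
      push_cast at this ⊢
      have f7 : (4 * (p + 1) * (p + 1 + k + l) : ℝ) ≠ 0 := by positivity
      refine mul_left_cancel₀ f7 ?_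
      have e : (4 * (p + 1) * (p + 1 + k + l) : ℝ) * P.coeff k =
        (2 * ((p:ℝ) + 1) + k - k) * (2 * (p + 1) + k + k + 2 * l) * P.coeff k := by ring
      rw [e, this]
      have g1 : (k : ℝ) + 1 + 1 ≠ 0 := by positivity
      field_simp
      ring
  ext k
  rcases lt_or_ge n k with hk | hk
  · rw [hgt k hk, gegenPoly_coeff_of_lt l hk]
  · obtain ⟨j, hj⟩ : ∃ j, n - k = j := ⟨_, rfl⟩
    rcases Nat.even_or_odd' j with ⟨p, hp | hp⟩
    · have : k = n - 2 * p := by omega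
      rw [this, heven p (by omega), gegenPoly_coeff_even l (by omega)]
    · have : k = n - (2 * p + 1) := by omega
      rw [this, hodd p (by omega), gegenPoly_coeff_odd l (by omega)]

lemma eval_gegenPoly {l : ℝ} (hl : 0 < l) (n : ℕ) (t : ℝ) :
    (gegenPoly n l).eval t = gegenC n l t := by
  rw [← jacPoly_eq hl, eval_mul, eval_C, eval_jacPoly, gegenC]

lemma gegenPoly_ode {l : ℝ} (hl : 0 < l) (n : ℕ) :
    (1 - X ^ 2) * derivative (derivative (gegenPoly n l)) -
        C (2 * l + 1) * X * derivative (gegenPoly n l) +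
        C ((n : ℝ) * (n + 2 * l)) * gegenPoly n l = 0 := by
  rw [← jacPoly_eq hl, derivative_C_mul, derivative_C_mul]
  linear_combination C (poch (2 * l) n / poch (l + 1 / 2) n) * jacPoly_ode n l

end Gegenbauer

lemma gegenC_eq_sum {l : ℝ} (hl : 0 < l) (n : ℕ) (t : ℝ) :
    gegenC n l t = ∑ p ∈ range (n / 2 + 1),
      (-1) ^ p * poch l (n - p) / (p.factorial * (n - 2 * p).factorial) * 2 ^ (n - 2 * p) *
        t ^ (n - 2 * p) := by
  rw [← eval_gegenPoly hl, gegenPoly, Polynomial.eval_finsetSum]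
  simp only [Polynomial.eval_mul, Polynomial.eval_C, Polynomial.eval_pow, Polynomial.eval_X]

lemma gegenC_neg {l : ℝ} (hl : 0 < l) (n : ℕ) (t : ℝ) :
    gegenC n l (-t) = (-1) ^ n * gegenC n l t := by
  rw [gegenC_eq_sum hl, gegenC_eq_sum hl, mul_sum]
  refine sum_congr rfl fun p hp => ?_
  have h : n = (n - 2 * p) + 2 * p := by have := mem_range.1 hp; omega
  have h2 : (-1 : ℝ) ^ n = (-1) ^ (n - 2 * p) := by
    conv_lhs => rw [h, pow_add, pow_mul]
    simp
  rw [h2, neg_pow t]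
  ring

lemma derivative_gegenPoly (n : ℕ) (l : ℝ) :
    Polynomial.derivative (gegenPoly (n + 1) l) = Polynomial.C (2 * l) * gegenPoly n (l + 1) := by
  ext k
  rw [Polynomial.coeff_derivative, Polynomial.coeff_C_mul]
  rcases lt_or_ge n k with hk | hk
  · rw [gegenPoly_coeff_of_lt _ hk, gegenPoly_coeff_of_lt _ (by omega)]; ring
  · obtain ⟨j, hj⟩ : ∃ j, n - k = j := ⟨_, rfl⟩
    rcases Nat.even_or_odd' j with ⟨p, hp | hp⟩
    · have e1 : k + 1 = n + 1 - 2 * p := by omega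
      obtain rfl : n = k + 2 * p := by omega
      rw [e1, gegenPoly_coeff_even l (by omega)]
      have := gegenPoly_coeff_even (n := k + 2 * p) (p := p) (l + 1) (by omega)
      rw [show k + 2 * p - 2 * p = k by omega] at this
      rw [this, ← e1, show k + 2 * p + 1 - p = (k + p) + 1 by omega,
        show k + 2 * p - p = k + p by omega, poch_succ', Nat.factorial_succ]
      have f1 : (p.factorial : ℝ) ≠ 0 := by positivity
      have f2 : (k.factorial : ℝ) ≠ 0 := by positivity
      have f3 : (k + 1 : ℝ) ≠ 0 := by positivity
      push_cast
      rw [pow_succ (2 : ℝ) k]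
      field_simp
    · have e1 : k + 1 = n + 1 - (2 * p + 1) := by omega
      have e2 : k = n - (2 * p + 1) := by omega
      rw [e1, gegenPoly_coeff_odd l (by omega), e2, gegenPoly_coeff_odd (l + 1) (by omega)]
      ring

lemma hasDerivAt_gegenC {l : ℝ} (hl : 0 < l) (n : ℕ) (t : ℝ) :
    HasDerivAt (gegenC (n + 1) l) (2 * l * gegenC n (l + 1) t) t := by
  have h := (gegenPoly (n + 1) l).hasDerivAt t
  rw [derivative_gegenPoly, Polynomial.eval_mul, Polynomial.eval_C,
    eval_gegenPoly (by linarith)] at h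
  exact h.congr_of_eventuallyEq (Filter.Eventually.of_forall fun x => (eval_gegenPoly hl _ x).symm)

lemma continuous_gegenC {l : ℝ} (hl : 0 < l) (n : ℕ) : Continuous (gegenC n l) := by
  have : gegenC n l = fun t => (gegenPoly n l).eval t := funext fun t => (eval_gegenPoly hl n t).symm
  rw [this]
  exact (gegenPoly n l).continuous

/-- The derivative of the Gegenbauer polynomial. -/
noncomputable def gegenD (n : ℕ) (l t : ℝ) : ℝ := (Polynomial.derivative (gegenPoly n l)).eval t

/-- The second derivative of the Gegenbauer polynomial. -/
noncomputable def gegenDD (n : ℕ) (l t : ℝ) : ℝ :=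
  (Polynomial.derivative (Polynomial.derivative (gegenPoly n l))).eval t

lemma hasDerivAt_gegenC_gegenD {l : ℝ} (hl : 0 < l) (n : ℕ) (t : ℝ) :
    HasDerivAt (gegenC n l) (gegenD n l t) t :=
  ((gegenPoly n l).hasDerivAt t).congr_of_eventuallyEq
    (Filter.Eventually.of_forall fun x => (eval_gegenPoly hl _ x).symm)

lemma hasDerivAt_gegenD (n : ℕ) (l t : ℝ) : HasDerivAt (gegenD n l) (gegenDD n l t) t :=
  (Polynomial.derivative (gegenPoly n l)).hasDerivAt t

lemma gegenC_ode {l : ℝ} (hl : 0 < l) (n : ℕ) (t : ℝ) :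
    (1 - t ^ 2) * gegenDD n l t = (2 * l + 1) * t * gegenD n l t - n * (n + 2 * l) * gegenC n l t := by
  have h := congrArg (Polynomial.eval t) (gegenPoly_ode hl n)
  simp only [Polynomial.eval_add, Polynomial.eval_sub, Polynomial.eval_mul, Polynomial.eval_one,
    Polynomial.eval_pow, Polynomial.eval_X, Polynomial.eval_C, Polynomial.eval_zero,
    eval_gegenPoly hl] at h
  simp only [gegenD, gegenDD]
  linear_combination h

lemma gegenD_succ (n : ℕ) {l : ℝ} (hl : 0 < l) (t : ℝ) :
    gegenD (n + 1) l t = 2 * l * gegenC n (l + 1) t := by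
  rw [gegenD, derivative_gegenPoly, Polynomial.eval_mul, Polynomial.eval_C,
    eval_gegenPoly (by linarith)]

lemma gegenC_one (n : ℕ) {l : ℝ} (hl : 0 < l) : gegenC n l 1 = poch (2 * l) n / n.factorial := by
  rw [gegenC, jacobiP, sum_range_succ', sum_eq_zero]
  · rw [add_comm (n : ℝ), Nat.sub_zero, genBinom_add_eq_poch]
    have : poch (l - 1 / 2 + 1) n ≠ 0 := poch_ne_zero (by linarith) n
    rw [show l + 1 / 2 = l - 1 / 2 + 1 by ring]
    generalize poch (l - 1 / 2 + 1) n = q at *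
    simp [genBinom]
    field_simp
  · intro k _
    simp

lemma gegenC_two_mul_zero (m : ℕ) {l : ℝ} (hl : 0 < l) :
    gegenC (2 * m) l 0 = (-1) ^ m * (poch l m / m.factorial) := by
  rw [gegenC_eq_sum hl, sum_eq_single m]
  · rw [show 2 * m - m = m by omega]; simp; ring
  · intro p hp hpm
    have := mem_range.1 hp
    rw [zero_pow (by omega), mul_zero]
  · intro h
    exact absurd (mem_range.2 (by omega)) h

lemma gegenC_odd_zero (m : ℕ) {l : ℝ} (hl : 0 < l) : gegenC (2 * m + 1) l 0 = 0 := by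
  have := gegenC_neg hl (2 * m + 1) 0
  rw [neg_zero, Odd.neg_one_pow ⟨m, rfl⟩] at this
  linarith

lemma gegenD_neg {l : ℝ} (hl : 0 < l) (n : ℕ) (t : ℝ) :
    |gegenD n l (-t)| = |gegenD n l t| := by
  rcases n with _ | n
  · simp [gegenD, gegenPoly]
  · rw [gegenD_succ n hl, gegenD_succ n hl, gegenC_neg (by linarith), abs_mul (2 * l),
      abs_mul ((-1) ^ n), abs_pow,
      abs_neg, abs_one, one_pow, one_mul, ← abs_mul]

lemma abs_gegenC_neg {l : ℝ} (hl : 0 < l) (n : ℕ) (t : ℝ) :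
    |gegenC n l (-t)| = |gegenC n l t| := by
  rw [gegenC_neg hl, abs_mul, abs_pow, abs_neg, abs_one, one_pow, one_mul]

/-- Comparison of powers of `m + 1` and `n` when `n` is about twice `m`. -/
lemma half_rpow_le (a : ℝ) : ∃ C : ℝ, 0 < C ∧ ∀ m n : ℕ, 1 ≤ n → n ≤ 2 * m + 1 → m + 1 ≤ 2 * n →
    ((m : ℝ) + 1) ^ a ≤ C * (n : ℝ) ^ a := by
  refine ⟨2 ^ |a|, by positivity, fun m n hn h1 h2 => ?_⟩
  have hn' : (0 : ℝ) < n := by exact_mod_cast hn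
  have h1' : (n : ℝ) ≤ 2 * m + 1 := by exact_mod_cast h1
  have h2' : (m : ℝ) + 1 ≤ 2 * n := by exact_mod_cast h2
  have hm : (0 : ℝ) < m + 1 := by positivity
  rcases le_total 0 a with ha | ha
  · rw [abs_of_nonneg ha, ← mul_rpow (by norm_num) hn'.le]
    exact rpow_le_rpow hm.le h2' ha
  · rw [abs_of_nonpos ha, rpow_neg (by norm_num), ← inv_rpow (by norm_num),
      ← mul_rpow (by norm_num) hn'.le]
    exact rpow_le_rpow_of_nonpos (by positivity) (by linarith) ha

lemma gegenC_one_le {l : ℝ} (hl : 0 < l) :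
    ∃ C : ℝ, 0 < C ∧ ∀ n : ℕ, 1 ≤ n → gegenC n l 1 ≤ C * (n : ℝ) ^ (2 * l - 1) := by
  obtain ⟨c, C, hc, hC, h⟩ := poch_div_factorial_bounds (show 0 < 2 * l by positivity)
  obtain ⟨C', hC', h'⟩ := half_rpow_le (2 * l - 1)
  refine ⟨C * C', by positivity, fun n hn => ?_⟩
  rw [gegenC_one n hl]
  refine (h n).2.trans ?_
  rw [mul_assoc]
  exact mul_le_mul_of_nonneg_left (h' n n hn (by omega) (by omega)) hC.le

lemma gegenC_at_zero_le {l : ℝ} (hl : 0 < l) :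
    ∃ C : ℝ, 0 < C ∧ ∀ n : ℕ, 1 ≤ n → |gegenC n l 0| ≤ C * (n : ℝ) ^ (l - 1) := by
  obtain ⟨c, C, hc, hC, h⟩ := poch_div_factorial_bounds hl
  obtain ⟨C', hC', h'⟩ := half_rpow_le (l - 1)
  refine ⟨C * C', by positivity, fun n hn => ?_⟩
  obtain ⟨m, rfl | rfl⟩ := Nat.even_or_odd' n
  · rw [gegenC_two_mul_zero m hl, abs_mul, abs_pow, abs_neg, abs_one, one_pow, one_mul,
      abs_of_nonneg (div_nonneg (poch_pos hl m).le (by positivity)), mul_assoc]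
    refine (h m).2.trans ?_
    exact mul_le_mul_of_nonneg_left (h' m _ hn (by omega) (by omega)) hC.le
  · rw [gegenC_odd_zero m hl, abs_zero]; positivity

lemma gegenD_at_zero_le {l : ℝ} (hl : 0 < l) :
    ∃ C : ℝ, 0 < C ∧ ∀ n : ℕ, 1 ≤ n → |gegenD n l 0| ≤ C * (n : ℝ) ^ l := by
  obtain ⟨c, C, hc, hC, h⟩ := poch_div_factorial_bounds (show 0 < l + 1 by linarith)
  obtain ⟨C', hC', h'⟩ := half_rpow_le l
  refine ⟨2 * l * (C * C'), by positivity, fun n hn => ?_⟩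
  obtain ⟨n, rfl⟩ := Nat.exists_eq_add_of_le' hn
  rw [gegenD_succ n hl, abs_mul, abs_of_pos (show 0 < 2 * l by positivity), mul_assoc (2 * l)]
  refine mul_le_mul_of_nonneg_left ?_ (by positivity)
  obtain ⟨m, rfl | rfl⟩ := Nat.even_or_odd' n
  · rw [gegenC_two_mul_zero m (by linarith), abs_mul, abs_pow, abs_neg, abs_one, one_pow, one_mul,
      abs_of_nonneg (div_nonneg (poch_pos (by linarith) m).le (by positivity)), mul_assoc]
    have := (h m).2
    rw [add_sub_cancel_right] at this
    refine this.trans ?_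
    exact mul_le_mul_of_nonneg_left (h' m _ hn (by omega) (by omega)) hC.le
  · rw [gegenC_odd_zero m (by linarith), abs_zero]; positivity

lemma energy_comparison {a b : ℝ} (hab : a ≤ b) {u v Q q w w' : ℝ → ℝ}
    (hu : ∀ x ∈ Set.Icc a b, HasDerivAt u (v x) x)
    (hv : ∀ x ∈ Set.Icc a b, HasDerivAt v (-(Q x * u x)) x)
    (hQ : ∀ x ∈ Set.Icc a b, HasDerivAt Q (q x) x)
    (hw : ∀ x ∈ Set.Icc a b, HasDerivAt w (w' x) x)
    (hw' : ∀ x ∈ Set.Icc a b, 0 ≤ w' x)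
    (hq : ∀ x ∈ Set.Icc a b, |q x| ≤ Q x * w' x) :
    v b ^ 2 + Q b * u b ^ 2 ≤ exp (w b - w a) * (v a ^ 2 + Q a * u a ^ 2) ∧
    v a ^ 2 + Q a * u a ^ 2 ≤ exp (w b - w a) * (v b ^ 2 + Q b * u b ^ 2) := by
  have hF : ∀ x ∈ Set.Icc a b,
      HasDerivAt (fun x => v x ^ 2 + Q x * u x ^ 2) (q x * u x ^ 2) x := by
    intro x hx
    have := ((hv x hx).pow 2).add ((hQ x hx).mul ((hu x hx).pow 2))
    refine this.congr_deriv ?_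
    simp
    ring
  have h1 : ∀ x ∈ Set.Icc a b, HasDerivAt (fun x => (v x ^ 2 + Q x * u x ^ 2) * exp (-w x))
      ((q x * u x ^ 2 - w' x * (v x ^ 2 + Q x * u x ^ 2)) * exp (-w x)) x := by
    intro x hx
    refine ((hF x hx).mul (hw x hx).neg.exp).congr_deriv ?_
    simp only [Pi.neg_apply]
    ring
  have h2 : ∀ x ∈ Set.Icc a b, HasDerivAt (fun x => (v x ^ 2 + Q x * u x ^ 2) * exp (w x))
      ((q x * u x ^ 2 + w' x * (v x ^ 2 + Q x * u x ^ 2)) * exp (w x)) x := by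
    intro x hx
    refine ((hF x hx).mul (hw x hx).exp).congr_deriv ?_
    ring
  have ha : a ∈ Set.Icc a b := ⟨le_rfl, hab⟩
  have hb : b ∈ Set.Icc a b := ⟨hab, le_rfl⟩
  have hi : interior (Set.Icc a b) ⊆ Set.Icc a b := interior_subset
  have key : ∀ x ∈ Set.Icc a b, |q x * u x ^ 2| ≤ w' x * (v x ^ 2 + Q x * u x ^ 2) := by
    intro x hx
    rw [abs_mul, abs_of_nonneg (sq_nonneg (u x))]
    have := mul_le_mul_of_nonneg_right (hq x hx) (sq_nonneg (u x))
    nlinarith [mul_nonneg (hw' x hx) (sq_nonneg (v x))]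
  have m1 : AntitoneOn (fun x => (v x ^ 2 + Q x * u x ^ 2) * exp (-w x)) (Set.Icc a b) := by
    refine antitoneOn_of_deriv_nonpos (convex_Icc a b)
      (fun x hx => (h1 x hx).continuousAt.continuousWithinAt)
      (fun x hx => (h1 x (hi hx)).differentiableAt.differentiableWithinAt) fun x hx => ?_
    rw [(h1 x (hi hx)).deriv]
    have := (abs_le.1 (key x (hi hx))).2
    exact mul_nonpos_of_nonpos_of_nonneg (by linarith) (exp_pos _).le
  have m2 : MonotoneOn (fun x => (v x ^ 2 + Q x * u x ^ 2) * exp (w x)) (Set.Icc a b) := by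
    refine monotoneOn_of_deriv_nonneg (convex_Icc a b)
      (fun x hx => (h2 x hx).continuousAt.continuousWithinAt)
      (fun x hx => (h2 x (hi hx)).differentiableAt.differentiableWithinAt) fun x hx => ?_
    rw [(h2 x (hi hx)).deriv]
    have := (abs_le.1 (key x (hi hx))).1
    exact mul_nonneg (by linarith) (exp_pos _).le
  have i1 := m1 ha hb hab
  have i2 := m2 ha hb hab
  simp only at i1 i2
  constructor
  · have := mul_le_mul_of_nonneg_right i1 (exp_pos (w b)).le
    rw [mul_assoc, mul_assoc, ← exp_add, ← exp_add, neg_add_cancel, exp_zero, mul_one] at this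
    rw [mul_comm (exp _), sub_eq_neg_add]; exact this
  · have := mul_le_mul_of_nonneg_right i2 (exp_pos (-w a)).le
    rw [mul_assoc, mul_assoc, ← exp_add, ← exp_add, add_neg_cancel, exp_zero, mul_one] at this
    rw [mul_comm (exp _), sub_eq_add_neg]; exact this

lemma gegen_sonin {l : ℝ} (hl : 0 < l) {n : ℕ} (hn : 1 ≤ n) {s : ℝ} (h0 : 0 ≤ s) (h1 : s ≤ 1) :
    gegenC n l s ^ 2 + (1 - s ^ 2) * gegenD n l s ^ 2 / (n * (n + 2 * l)) ≤ gegenC n l 1 ^ 2 := by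
  have hN : (0 : ℝ) < n * (n + 2 * l) := by
    have : (0 : ℝ) < n := by exact_mod_cast hn
    positivity
  set f : ℝ → ℝ := fun s =>
    gegenC n l s ^ 2 + (1 - s ^ 2) * gegenD n l s ^ 2 / (n * (n + 2 * l)) with hf
  have hd : ∀ x, HasDerivAt f (4 * l * x * gegenD n l x ^ 2 / (n * (n + 2 * l))) x := by
    intro x
    have a1 := (hasDerivAt_gegenC_gegenD hl n x).pow 2
    have a2 := (((hasDerivAt_id x).pow 2).const_sub 1).mul ((hasDerivAt_gegenD n l x).pow 2)
    refine (a1.add (a2.div_const (n * (n + 2 * l)))).congr_deriv ?_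
    have := gegenC_ode hl n x
    simp
    field_simp
    linear_combination (2 * gegenD n l x) * this
  have hm : MonotoneOn f (Set.Icc 0 1) := by
    refine monotoneOn_of_deriv_nonneg (convex_Icc 0 1)
      (fun x _ => (hd x).continuousAt.continuousWithinAt)
      (fun x _ => (hd x).differentiableAt.differentiableWithinAt) fun x hx => ?_
    rw [(hd x).deriv]
    have : 0 ≤ x := (interior_subset hx).1
    positivity
  have := hm ⟨h0, h1⟩ ⟨zero_le_one, le_rfl⟩ h1
  simpa [hf] using this

lemma gegen_energy {l : ℝ} (hl : 0 < l) {n : ℕ} {φ : ℝ} (h0 : 0 ≤ φ) (h1 : φ < π / 2)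
    (hc : 2 * |l * (l - 1)| + 1 ≤ cos φ ^ 2 * (n + l) ^ 2) :
    (cos φ ^ (l + 1) * gegenD n l (sin φ) - l * sin φ * cos φ ^ (l - 1) * gegenC n l (sin φ)) ^ 2 +
      (n + l) ^ 2 / 2 * (cos φ ^ l * gegenC n l (sin φ)) ^ 2 ≤
    exp 1 * (gegenD n l 0 ^ 2 + ((n + l) ^ 2 + |l * (l - 1)|) * gegenC n l 0 ^ 2) := by
  set L := |l * (l - 1)| with hL
  set M : ℝ := n + l with hM
  have hM0 : 0 < M := by positivity
  have hL0 : 0 ≤ L := abs_nonneg _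
  have hcos : ∀ x ∈ Set.Icc 0 φ, 0 < cos x := fun x hx =>
    cos_pos_of_mem_Ioo ⟨by linarith [hx.1, pi_pos], by linarith [hx.2]⟩
  have hsin : ∀ x ∈ Set.Icc 0 φ, 0 ≤ sin x := fun x hx =>
    sin_nonneg_of_nonneg_of_le_pi hx.1 (by linarith [hx.2, pi_pos])
  have hcc : ∀ x ∈ Set.Icc 0 φ, 2 * L + 1 ≤ cos x ^ 2 * M ^ 2 := fun x hx => by
    refine hc.trans ?_
    have h2 : cos φ ≤ cos x := cos_le_cos_of_nonneg_of_le_pi hx.1 (by linarith [pi_pos]) hx.2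
    have h3 := hcos φ ⟨h0, le_rfl⟩
    gcongr
  have hinv : ∀ x ∈ Set.Icc 0 φ, HasDerivAt (fun x => (cos x ^ 2)⁻¹) (2 * sin x / cos x ^ 3) x := by
    intro x hx
    have := hcos x hx
    refine (((hasDerivAt_cos x).pow 2).inv (pow_pos this 2).ne').congr_deriv ?_
    simp
    field_simp
  have hq0 : ∀ x ∈ Set.Icc 0 φ, M ^ 2 / 2 ≤ M ^ 2 - l * (l - 1) * (cos x ^ 2)⁻¹ := by
    intro x hx
    have h2 : 0 < cos x ^ 2 := pow_pos (hcos x hx) 2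
    have h3 : L * (cos x ^ 2)⁻¹ ≤ M ^ 2 / 2 := by
      rw [← div_eq_mul_inv, div_le_iff₀ h2]
      linarith [hcc x hx]
    have h4 : l * (l - 1) * (cos x ^ 2)⁻¹ ≤ L * (cos x ^ 2)⁻¹ :=
      mul_le_mul_of_nonneg_right (le_abs_self _) (inv_nonneg.2 h2.le)
    linarith
  have key := (energy_comparison h0
    (u := fun x => cos x ^ l * gegenC n l (sin x))
    (v := fun x => cos x ^ (l + 1) * gegenD n l (sin x) -
      l * sin x * cos x ^ (l - 1) * gegenC n l (sin x))
    (Q := fun x => M ^ 2 - l * (l - 1) * (cos x ^ 2)⁻¹)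
    (q := fun x => -(l * (l - 1) * (2 * sin x / cos x ^ 3)))
    (w := fun x => 2 * L / M ^ 2 * (cos x ^ 2)⁻¹)
    (w' := fun x => 2 * L / M ^ 2 * (2 * sin x / cos x ^ 3)) ?_ ?_ ?_ ?_ ?_ ?_).1
  · have hφ : φ ∈ Set.Icc 0 φ := ⟨h0, le_rfl⟩
    have e1 : exp (2 * L / M ^ 2 * (cos φ ^ 2)⁻¹ - 2 * L / M ^ 2 * (cos 0 ^ 2)⁻¹) ≤ exp 1 := by
      rw [exp_le_exp]
      have h2 : 0 < cos φ ^ 2 := pow_pos (hcos φ hφ) 2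
      have : 2 * L / M ^ 2 * (cos φ ^ 2)⁻¹ ≤ 1 := by
        rw [← div_eq_mul_inv, div_div, div_le_one (by positivity)]
        linarith [hcc φ hφ]
      have h5 : 0 ≤ 2 * L / M ^ 2 * (cos 0 ^ 2)⁻¹ := by positivity
      linarith
    have e2 : (cos 0 ^ (l + 1) * gegenD n l (sin 0) -
          l * sin 0 * cos 0 ^ (l - 1) * gegenC n l (sin 0)) ^ 2 +
        (M ^ 2 - l * (l - 1) * (cos 0 ^ 2)⁻¹) * (cos 0 ^ l * gegenC n l (sin 0)) ^ 2 ≤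
        gegenD n l 0 ^ 2 + (M ^ 2 + L) * gegenC n l 0 ^ 2 := by
      simp only [cos_zero, sin_zero, one_rpow, one_mul, mul_zero, zero_mul, sub_zero, one_pow,
        inv_one, mul_one]
      have : M ^ 2 - l * (l - 1) ≤ M ^ 2 + L := by
        have := neg_abs_le (l * (l - 1)); linarith
      gcongr
    have e3 : 0 ≤ gegenD n l 0 ^ 2 + (M ^ 2 + L) * gegenC n l 0 ^ 2 := by positivity
    refine le_trans ?_ (key.trans ((mul_le_mul_of_nonneg_left e2 (exp_pos _).le).trans
      (mul_le_mul_of_nonneg_right e1 e3)))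
    have := hq0 φ hφ
    gcongr
  · intro x hx
    have hc := hcos x hx
    have d1 := (hasDerivAt_cos x).rpow_const (p := l) (Or.inl hc.ne')
    have d2 := (hasDerivAt_gegenC_gegenD hl n (sin x)).comp x (hasDerivAt_sin x)
    refine (d1.mul d2).congr_deriv ?_
    simp only [Function.comp]
    rw [rpow_add_one hc.ne']
    ring
  · intro x hx
    have hc := hcos x hx
    have d0 := (hasDerivAt_cos x).rpow_const (p := l + 1) (Or.inl hc.ne')
    have d1 := (hasDerivAt_cos x).rpow_const (p := l - 1) (Or.inl hc.ne')
    have d2 := (hasDerivAt_gegenC_gegenD hl n (sin x)).comp x (hasDerivAt_sin x)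
    have d3 := (hasDerivAt_gegenD n l (sin x)).comp x (hasDerivAt_sin x)
    refine ((d0.mul d3).sub ((((hasDerivAt_sin x).const_mul l).mul d1).mul d2)).congr_deriv ?_
    simp only [Function.comp, add_sub_cancel_right, Pi.mul_apply]
    have hode := gegenC_ode hl n (sin x)
    have hsc : 1 - sin x ^ 2 = cos x ^ 2 := by rw [← cos_sq']
    rw [hsc] at hode
    have p1 : cos x ^ l = cos x ^ (l - 1 - 1) * cos x * cos x := by
      rw [← rpow_add_one hc.ne', ← rpow_add_one hc.ne']; congr 1; ring
    have p2 : cos x ^ (l - 1) = cos x ^ (l - 1 - 1) * cos x := by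
      rw [← rpow_add_one hc.ne']; congr 1; ring
    rw [rpow_add_one hc.ne', p1, p2, hM]
    have hs : sin x ^ 2 = 1 - cos x ^ 2 := by rw [← hsc]; ring
    generalize cos x ^ (l - 1 - 1) = p at *
    generalize cos x = c at *
    generalize sin x = s at *
    field_simp
    linear_combination (p * c ^ 2) * hode + (p * l * (l - 1) * gegenC n l s) * hs
  · intro x hx
    refine (((hinv x hx).const_mul (l * (l - 1))).const_sub (M ^ 2)).congr_deriv ?_
    ring
  · intro x hx
    exact (hinv x hx).const_mul _
  · intro x hx
    have := hcos x hx
    have := hsin x hx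
    positivity
  · intro x hx
    have h2 := hcos x hx
    have h3 := hsin x hx
    have h4 : 0 ≤ 2 * sin x / cos x ^ 3 := by positivity
    rw [abs_neg, abs_mul, abs_of_nonneg h4, ← hL]
    have h5 : 0 ≤ 2 * L / M ^ 2 * (2 * sin x / cos x ^ 3) := by positivity
    refine le_trans (le_of_eq ?_) (mul_le_mul_of_nonneg_right (hq0 x hx) h5)
    field_simp

lemma sq_rpow_neg_half {c : ℝ} (hc : 0 < c) (l : ℝ) : (c ^ 2) ^ (-(l / 2)) = (c ^ l)⁻¹ := by
  rw [← rpow_natCast, ← rpow_mul hc.le, ← rpow_neg hc.le]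
  congr 1
  push_cast
  ring

set_option maxHeartbeats 1000000 in
lemma gegen_bound_of_large {l : ℝ} (hl : 0 < l) :
    ∃ B : ℝ, 0 < B ∧ ∀ n : ℕ, 1 ≤ n → ∀ c s : ℝ, 0 ≤ s → 0 < c → c ^ 2 + s ^ 2 = 1 →
      2 * |l * (l - 1)| + 1 ≤ c ^ 2 * (n + l) ^ 2 →
      c ^ l * |gegenC n l s| ≤ B * (n : ℝ) ^ (l - 1) ∧
      c ^ l * (c * |gegenD n l s|) ≤ B * (n : ℝ) ^ l := by
  obtain ⟨C0, hC0, h0⟩ := gegenC_at_zero_le hl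
  obtain ⟨C1, hC1, h1⟩ := gegenD_at_zero_le hl
  set L := |l * (l - 1)| with hL
  have hL0 : 0 ≤ L := abs_nonneg _
  set A := √(exp 1 * (C1 ^ 2 + ((1 + l) ^ 2 + L) * C0 ^ 2)) with hA
  have hA2 : A ^ 2 = exp 1 * (C1 ^ 2 + ((1 + l) ^ 2 + L) * C0 ^ 2) := sq_sqrt (by positivity)
  have hA0 : 0 < A := sqrt_pos.2 (by positivity)
  refine ⟨2 * A * (1 + l * (1 + l)), by positivity, fun n hn c s hs hc hcs hcn => ?_⟩
  have hn1 : (1 : ℝ) ≤ n := by exact_mod_cast hn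
  have hn0 : (0 : ℝ) < n := by linarith
  have hs1 : s < 1 := by nlinarith
  have hφ0 : 0 ≤ arcsin s := arcsin_nonneg.2 hs
  have hφ1 : arcsin s < π / 2 := arcsin_lt_pi_div_two.2 hs1
  have hsin : sin (arcsin s) = s := sin_arcsin (by linarith) hs1.le
  have hcos : cos (arcsin s) = c := by
    rw [cos_arcsin, ← hcs, add_sub_cancel_right, sqrt_sq hc.le]
  have he := gegen_energy hl (n := n) hφ0 hφ1 (by rwa [hcos])
  rw [hsin, hcos, ← hL] at he
  have b0 : gegenC n l 0 ^ 2 ≤ (C0 * (n : ℝ) ^ (l - 1)) ^ 2 := sq_le_sq'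
    (by have := abs_le.1 (h0 n hn); linarith) (abs_le.1 (h0 n hn)).2
  have b1 : gegenD n l 0 ^ 2 ≤ (C1 * (n : ℝ) ^ l) ^ 2 := sq_le_sq'
    (by have := abs_le.1 (h1 n hn); linarith) (abs_le.1 (h1 n hn)).2
  set P := (n : ℝ) ^ (l - 1) with hP
  have hP0 : 0 < P := rpow_pos_of_pos hn0 _
  have hPn : (n : ℝ) ^ l = P * n := by rw [hP, ← rpow_add_one hn0.ne', sub_add_cancel]
  rw [hPn] at b1 ⊢
  have hM : (n : ℝ) + l ≤ (1 + l) * n := by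
    have := mul_le_mul_of_nonneg_left hn1 hl.le; linarith
  have hM0 : 0 < (n : ℝ) + l := by linarith
  have hML : ((n : ℝ) + l) ^ 2 + L ≤ ((1 + l) ^ 2 + L) * n ^ 2 := by
    have a1 : ((n : ℝ) + l) ^ 2 ≤ ((1 + l) * n) ^ 2 := by gcongr
    have a2 : L ≤ L * n ^ 2 := le_mul_of_one_le_right hL0 (one_le_pow₀ hn1)
    linarith
  have he2 : exp 1 * (gegenD n l 0 ^ 2 + ((n + l) ^ 2 + L) * gegenC n l 0 ^ 2) ≤
      (A * (P * n)) ^ 2 := by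
    rw [mul_pow, hA2, mul_assoc]
    refine mul_le_mul_of_nonneg_left ?_ (exp_pos _).le
    have : ((n + l) ^ 2 + L) * gegenC n l 0 ^ 2 ≤ (((1 + l) ^ 2 + L) * n ^ 2) * (C0 * P) ^ 2 := by
      gcongr
    linarith
  set v := c ^ (l + 1) * gegenD n l s - l * s * c ^ (l - 1) * gegenC n l s with hv
  set u := c ^ l * gegenC n l s with hu
  have hv1 : |v| ≤ A * (P * n) := abs_le_of_sq_le_sq (by linarith [sq_nonneg ((n + l) * u)]) (by positivity)
  have hu1 : |(n + l) * u| ≤ 2 * (A * (P * n)) :=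
    abs_le_of_sq_le_sq (by linarith [sq_nonneg v, sq_nonneg (A * (P * n))]) (by positivity)
  have hu2 : |u| ≤ 2 * A * P := by
    rw [abs_mul, abs_of_pos hM0] at hu1
    have : n * |u| ≤ n * (2 * A * P) := by linarith [mul_nonneg hl.le (abs_nonneg u)]
    exact le_of_mul_le_mul_left this hn0
  have hcl : 0 < c ^ l := rpow_pos_of_pos hc l
  have hu3 : c ^ l * |gegenC n l s| = |u| := by rw [hu, abs_mul, abs_of_pos hcl]
  constructor
  · rw [hu3]
    refine hu2.trans ?_
    have a1 : 0 ≤ 2 * A * P * (l * (1 + l)) := by positivity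
    linarith
  · have hcM : 1 ≤ c * (n + l) := by
      have : (1 : ℝ) ^ 2 ≤ (c * (n + l)) ^ 2 := by rw [mul_pow]; linarith
      exact le_of_sq_le_sq this (by positivity)
    have hdec : c ^ l * (c * gegenD n l s) = v + l * s * (u / c) := by
      rw [hv, hu, rpow_add_one hc.ne', rpow_sub_one hc.ne']; ring
    have h5 : c ^ l * (c * |gegenD n l s|) = |v + l * s * (u / c)| := by
      rw [← hdec, abs_mul, abs_mul, abs_of_pos hcl, abs_of_pos hc]
    have h6 : |u / c| ≤ (2 * A * P) * ((1 + l) * n) := by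
      rw [abs_div, abs_of_pos hc, div_le_iff₀ hc]
      have : 1 ≤ (1 + l) * n * c := by
        have := mul_le_mul_of_nonneg_left hM hc.le; linarith
      calc |u| ≤ 2 * A * P := hu2
        _ ≤ (2 * A * P) * ((1 + l) * n * c) := le_mul_of_one_le_right (by positivity) this
        _ = _ := by ring
    rw [h5]
    refine (abs_add_le _ _).trans ?_
    rw [abs_mul, abs_mul, abs_of_pos hl, abs_of_nonneg hs]
    have h7 : l * s * |u / c| ≤ l * 1 * ((2 * A * P) * ((1 + l) * n)) := by gcongr
    have : 0 ≤ A * P * n := by positivity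
    linarith

set_option maxHeartbeats 1000000 in
lemma gegen_pointwise_bound {l : ℝ} (hl : 0 < l) :
    ∃ B : ℝ, 0 < B ∧ ∀ n : ℕ, 1 ≤ n → ∀ s ∈ Set.Icc (-1 : ℝ) 1,
      |gegenC n l s| ≤ B * (n : ℝ) ^ (l - 1) * (1 - s ^ 2 + ((n : ℝ) ^ 2)⁻¹) ^ (-(l / 2)) ∧
      √(1 - s ^ 2) * |gegenD n l s| ≤
        B * (n : ℝ) ^ l * (1 - s ^ 2 + ((n : ℝ) ^ 2)⁻¹) ^ (-(l / 2)) := by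
  obtain ⟨B1, hB1, h1⟩ := gegen_bound_of_large hl
  obtain ⟨C1, hC1, h2⟩ := gegenC_one_le hl
  set K := 2 * |l * (l - 1)| + 1 with hK
  have hK0 : 0 < K := by positivity
  set G := 1 + (1 + l) ^ 2 with hG
  have hG0 : 0 < G := by positivity
  set B2 := C1 * (1 + 2 * l) * (K + 1) ^ (l / 2) with hB2
  have hB20 : 0 < B2 := by positivity
  refine ⟨B1 * G ^ (l / 2) + B2, by positivity, fun n hn s hs => ?_⟩
  wlog hs0 : 0 ≤ s generalizing s with H
  · have := H (-s) ⟨by linarith [hs.2], by linarith [hs.1]⟩ (by linarith)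
    rwa [abs_gegenC_neg hl, gegenD_neg hl, neg_sq] at this
  have hn1 : (1 : ℝ) ≤ n := by exact_mod_cast hn
  have hn0 : (0 : ℝ) < n := by linarith
  have hs2 : s ^ 2 ≤ 1 := by nlinarith [hs.2]
  set X := 1 - s ^ 2 + ((n : ℝ) ^ 2)⁻¹ with hX
  have hX0 : 0 < X := by
    have : 0 < ((n : ℝ) ^ 2)⁻¹ := by positivity
    linarith
  set c := √(1 - s ^ 2) with hc
  have hc0 : 0 ≤ c := sqrt_nonneg _
  have hcs : c ^ 2 = 1 - s ^ 2 := sq_sqrt (by linarith)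
  have hXl : 0 < X ^ (-(l / 2)) := rpow_pos_of_pos hX0 _
  have hM : (n : ℝ) + l ≤ (1 + l) * n := by
    have := mul_le_mul_of_nonneg_left hn1 hl.le; linarith
  rcases le_or_gt K (c ^ 2 * (n + l) ^ 2) with hbig | hsmall
  · have hcpos : 0 < c := by
      rcases hc0.eq_or_lt with h | h
      · rw [← h] at hbig; simp at hbig; linarith
      · exact h
    obtain ⟨e1, e2⟩ := h1 n hn c s hs0 hcpos (by linarith) hbig
    have hXc : X ≤ G * c ^ 2 := by
      have a1 : 1 ≤ c ^ 2 * (n + l) ^ 2 := by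
        have : 0 ≤ |l * (l - 1)| := abs_nonneg _
        linarith
      have a2 : c ^ 2 * (n + l) ^ 2 ≤ c ^ 2 * ((1 + l) * n) ^ 2 := by gcongr
      have a3 : ((n : ℝ) ^ 2)⁻¹ ≤ (1 + l) ^ 2 * c ^ 2 := by
        rw [inv_le_iff_one_le_mul₀ (by positivity)]
        linarith
      rw [hX, ← hcs, hG]; linarith
    have hcl : 0 < c ^ l := rpow_pos_of_pos hcpos l
    have hXc2 : (c ^ l)⁻¹ ≤ G ^ (l / 2) * X ^ (-(l / 2)) := by
      rw [← sq_rpow_neg_half hcpos]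
      have := rpow_le_rpow_of_nonpos hX0 hXc (show -(l / 2) ≤ 0 by linarith)
      rw [mul_rpow hG0.le (sq_nonneg c), rpow_neg hG0.le] at this
      rw [← div_le_iff₀' (by positivity), div_eq_inv_mul]
      exact this
    constructor
    · calc |gegenC n l s| = c ^ l * |gegenC n l s| * (c ^ l)⁻¹ := by field_simp
        _ ≤ B1 * (n : ℝ) ^ (l - 1) * (G ^ (l / 2) * X ^ (-(l / 2))) := by gcongr
        _ = B1 * G ^ (l / 2) * (n : ℝ) ^ (l - 1) * X ^ (-(l / 2)) := by ring
        _ ≤ _ := by gcongr; linarith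
    · calc c * |gegenD n l s| = c ^ l * (c * |gegenD n l s|) * (c ^ l)⁻¹ := by field_simp
        _ ≤ B1 * (n : ℝ) ^ l * (G ^ (l / 2) * X ^ (-(l / 2))) := by gcongr
        _ = B1 * G ^ (l / 2) * (n : ℝ) ^ l * X ^ (-(l / 2)) := by ring
        _ ≤ _ := by gcongr; linarith
  · have hXn : X ≤ (K + 1) * ((n : ℝ) ^ 2)⁻¹ := by
      have : c ^ 2 ≤ K * ((n : ℝ) ^ 2)⁻¹ := by
        rw [← div_eq_mul_inv, le_div_iff₀ (by positivity)]
        refine le_trans ?_ hsmall.le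
        gcongr; linarith
      rw [hX, ← hcs]; linarith
    have hnl : (n : ℝ) ^ l ≤ (K + 1) ^ (l / 2) * X ^ (-(l / 2)) := by
      have := rpow_le_rpow_of_nonpos hX0 hXn (show -(l / 2) ≤ 0 by linarith)
      rw [mul_rpow (by positivity) (by positivity), inv_rpow (by positivity),
        sq_rpow_neg_half hn0, inv_inv, rpow_neg (by positivity)] at this
      rw [← div_le_iff₀' (by positivity), div_eq_inv_mul]
      exact this
    have hson := gegen_sonin hl hn hs0 hs.2
    have hN0 : (0 : ℝ) < n * (n + 2 * l) := by positivity
    have hC0 : 0 ≤ gegenC n l 1 := by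
      rw [gegenC_one n hl]
      exact div_nonneg (poch_pos (by linarith) n).le (by positivity)
    have t0 : 0 ≤ (1 - s ^ 2) * gegenD n l s ^ 2 / (n * (n + 2 * l)) :=
      div_nonneg (mul_nonneg (by linarith) (sq_nonneg _)) hN0.le
    have t1 : |gegenC n l s| ≤ gegenC n l 1 := abs_le_of_sq_le_sq (by linarith) hC0
    have t2 : c * |gegenD n l s| ≤ (1 + 2 * l) * n * gegenC n l 1 := by
      refine le_of_sq_le_sq ?_ (by positivity)
      rw [mul_pow, sq_abs, hcs]
      have h6 : (1 - s ^ 2) * gegenD n l s ^ 2 ≤ gegenC n l 1 ^ 2 * (n * (n + 2 * l)) := by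
        rw [← div_le_iff₀ hN0]; linarith [sq_nonneg (gegenC n l s)]
      have h7 : (n : ℝ) * (n + 2 * l) ≤ ((1 + 2 * l) * n) ^ 2 := by
        have a0 := mul_le_mul_of_nonneg_left hn1 hl.le
        have a1 : (n : ℝ) ≤ (1 + 2 * l) * n := by linarith
        have a2 : (n : ℝ) + 2 * l ≤ (1 + 2 * l) * n := by linarith
        rw [sq]; gcongr
      have h8 := mul_le_mul_of_nonneg_left h7 (sq_nonneg (gegenC n l 1))
      linarith
    have t3 := h2 n hn
    have hsplit : (n : ℝ) ^ (2 * l - 1) = (n : ℝ) ^ (l - 1) * (n : ℝ) ^ l := by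
      rw [← rpow_add hn0]; congr 1; ring
    have hP0 : 0 < (n : ℝ) ^ (l - 1) := rpow_pos_of_pos hn0 _
    have hPn : (n : ℝ) ^ l = (n : ℝ) ^ (l - 1) * n := by
      rw [← rpow_add_one hn0.ne', sub_add_cancel]
    have t4 : gegenC n l 1 ≤
        C1 * ((n : ℝ) ^ (l - 1) * ((K + 1) ^ (l / 2) * X ^ (-(l / 2)))) := by
      refine t3.trans ?_
      rw [hsplit]; gcongr
    have hBG : 0 ≤ B1 * G ^ (l / 2) := by positivity
    constructor
    · calc |gegenC n l s| ≤ C1 * ((n : ℝ) ^ (l - 1) * ((K + 1) ^ (l / 2) * X ^ (-(l / 2)))) :=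
            t1.trans t4
        _ ≤ (1 + 2 * l) * (C1 * ((n : ℝ) ^ (l - 1) * ((K + 1) ^ (l / 2) * X ^ (-(l / 2))))) :=
            le_mul_of_one_le_left (by positivity) (by linarith)
        _ = B2 * (n : ℝ) ^ (l - 1) * X ^ (-(l / 2)) := by rw [hB2]; ring
        _ ≤ _ := by gcongr; linarith
    · calc c * |gegenD n l s| ≤ (1 + 2 * l) * n *
              (C1 * ((n : ℝ) ^ (l - 1) * ((K + 1) ^ (l / 2) * X ^ (-(l / 2))))) := by
            refine t2.trans ?_; gcongr
        _ = B2 * (n : ℝ) ^ l * X ^ (-(l / 2)) := by rw [hB2, hPn]; ring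
        _ ≤ _ := by gcongr; linarith

lemma rpow_le_of_comparable {x y M : ℝ} (hx : 0 ≤ x) (hy : 0 ≤ y) (hM : 1 ≤ M) (h1 : y ≤ M * x)
    (h2 : x ≤ M * y) (q : ℝ) : y ^ q ≤ M ^ |q| * x ^ q := by
  have hM0 : 0 < M := by linarith
  rcases hx.eq_or_lt with rfl | hx
  · have : y = 0 := by linarith
    rw [this]
    exact le_mul_of_one_le_left (rpow_nonneg le_rfl _) (one_le_rpow hM (abs_nonneg q))
  rcases le_total 0 q with hq | hq
  · rw [abs_of_nonneg hq, ← mul_rpow hM0.le hx.le]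
    exact rpow_le_rpow hy h1 hq
  · rw [abs_of_nonpos hq, rpow_neg hM0.le, ← inv_rpow hM0.le, ← mul_rpow (by positivity) hx.le]
    refine rpow_le_rpow_of_nonpos (by positivity) ?_ hq
    rw [inv_mul_le_iff₀ hM0]
    exact h2

lemma intervalIntegrable_one_sub_rpow {q : ℝ} (hq : 0 < q) :
    IntervalIntegrable (fun t : ℝ => (1 - t) ^ (q - 1)) volume 0 1 := by
  have h := (intervalIntegral.intervalIntegrable_rpow' (a := 0) (b := 1)
    (show -1 < q - 1 by linarith)).comp_sub_left 1
  simpa using h.symm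

lemma intervalIntegrable_jacobi_half {q : ℝ} (hq : 0 < q) :
    IntervalIntegrable (fun t : ℝ => (1 - t ^ 2) ^ (q - 1)) volume 0 1 := by
  have h : IntervalIntegrable (fun t : ℝ => (1 - t) ^ (q - 1) * (1 + t) ^ (q - 1)) volume 0 1 := by
    refine (intervalIntegrable_one_sub_rpow hq).mul_continuousOn ?_
    refine ContinuousOn.rpow_const (by fun_prop) fun t ht => Or.inl ?_
    rw [Set.uIcc_of_le zero_le_one] at ht
    linarith [ht.1]
  refine h.congr fun t ht => ?_
  rw [Set.uIoc_of_le zero_le_one] at ht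
  rw [← mul_rpow (by linarith [ht.2]) (by linarith [ht.1])]
  congr 1
  ring

lemma intervalIntegrable_jacobi {q : ℝ} (hq : 0 < q) :
    IntervalIntegrable (fun t : ℝ => (1 - t ^ 2) ^ (q - 1)) volume (-1) 1 := by
  have h1 := intervalIntegrable_jacobi_half hq
  refine IntervalIntegrable.trans (b := 0) ?_ h1
  have h2 := (IntervalIntegrable.iff_comp_neg (f := fun t : ℝ => (1 - t ^ 2) ^ (q - 1))).1 h1
  simpa using h2.symm

lemma integrableOn_jacobi {q : ℝ} (hq : 0 < q) :
    IntegrableOn (fun t : ℝ => (1 - t ^ 2) ^ (q - 1)) (Set.Icc (-1) 1) := by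
  rw [integrableOn_Icc_iff_integrableOn_Ioc]
  exact (intervalIntegrable_iff_integrableOn_Ioc_of_le (by norm_num)).1 (intervalIntegrable_jacobi hq)

lemma integral_of_even {f : ℝ → ℝ} (hf : ∀ t, f (-t) = f t)
    (hi : IntervalIntegrable f volume 0 1) : ∫ t in (-1 : ℝ)..1, f t = 2 * ∫ t in (0 : ℝ)..1, f t := by
  have h2 := ((IntervalIntegrable.iff_comp_neg (f := f)).1 hi).symm
  simp only [hf, neg_zero] at h2
  rw [← intervalIntegral.integral_add_adjacent_intervals h2 hi]
  have := intervalIntegral.integral_comp_neg (a := 0) (b := 1) f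
  simp only [hf, neg_zero] at this
  rw [← this]
  ring

lemma integral_rpow_mul_shift_le {k l h : ℝ} (hk : 0 < k) (hl : 2 * k < l) (hh0 : 0 < h)
    (hh1 : h ≤ 1) :
    ∫ x in (0 : ℝ)..1, x ^ (k - 1) * (x + h) ^ (-(l / 2)) ≤
      (1 / k + 1 / (l / 2 - k)) * h ^ (k - l / 2) := by
  have hi : ∀ a b : ℝ, 0 ≤ a → 0 ≤ b →
      IntervalIntegrable (fun x => x ^ (k - 1) * (x + h) ^ (-(l / 2))) volume a b := by
    intro a b ha hb
    refine (intervalIntegral.intervalIntegrable_rpow' (by linarith)).mul_continuousOn ?_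
    refine ContinuousOn.rpow_const (by fun_prop) fun t ht => Or.inl ?_
    have : 0 ≤ t := le_trans (le_min ha hb) ht.1
    positivity
  rw [← intervalIntegral.integral_add_adjacent_intervals (hi 0 h le_rfl hh0.le)
    (hi h 1 hh0.le zero_le_one), add_mul]
  refine add_le_add ?_ ?_
  · have h1 : ∫ x in (0 : ℝ)..h, x ^ (k - 1) * (x + h) ^ (-(l / 2)) ≤
        ∫ x in (0 : ℝ)..h, x ^ (k - 1) * h ^ (-(l / 2)) := by
      refine intervalIntegral.integral_mono_on hh0.le (hi 0 h le_rfl hh0.le)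
        ((intervalIntegral.intervalIntegrable_rpow' (by linarith)).mul_const _) fun x hx => ?_
      have := hx.1
      refine mul_le_mul_of_nonneg_left ?_ (rpow_nonneg hx.1 _)
      exact rpow_le_rpow_of_nonpos hh0 (by linarith) (by linarith)
    refine h1.trans (le_of_eq ?_)
    rw [intervalIntegral.integral_mul_const, integral_rpow (Or.inl (by linarith)), sub_add_cancel,
      zero_rpow hk.ne', sub_zero, div_mul_eq_mul_div, ← rpow_add hh0, one_div_mul_eq_div]
    rfl
  · have h1 : ∫ x in h..1, x ^ (k - 1) * (x + h) ^ (-(l / 2)) ≤ ∫ x in h..1, x ^ (k - 1 - l / 2) := by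
      refine intervalIntegral.integral_mono_on hh1 (hi h 1 hh0.le zero_le_one) ?_ fun x hx => ?_
      · refine intervalIntegral.intervalIntegrable_rpow (Or.inr fun h0 => ?_)
        rw [Set.uIcc_of_le hh1] at h0
        linarith [h0.1]
      have hx0 : 0 < x := lt_of_lt_of_le hh0 hx.1
      rw [sub_eq_add_neg (k - 1), rpow_add hx0]
      refine mul_le_mul_of_nonneg_left ?_ (rpow_nonneg hx0.le _)
      exact rpow_le_rpow_of_nonpos hx0 (by linarith) (by linarith)
    refine h1.trans ?_
    have hne : k - l / 2 ≠ 0 := by linarith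
    rw [integral_rpow]
    · rw [show k - 1 - l / 2 + 1 = k - l / 2 by ring, one_rpow,
        show (1 - h ^ (k - l / 2)) / (k - l / 2) = (h ^ (k - l / 2) - 1) / (l / 2 - k) by
          rw [← neg_div_neg_eq]; congr 1 <;> ring, one_div_mul_eq_div]
      have : 0 < l / 2 - k := by linarith
      gcongr
      linarith
    · right
      refine ⟨by linarith, fun h0 => ?_⟩
      rw [Set.uIcc_of_le hh1] at h0
      linarith [h0.1]

/-- Moment bound for the one-dimensional Jacobi weight against a shifted power. -/
lemma jacobi_shift_integral_le {k l q : ℝ} (hk : 0 < k) (hkq : k ≤ q) (hl : 2 * k < l) :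
    ∃ C : ℝ, 0 < C ∧ ∀ h : ℝ, 0 < h → h ≤ 1 →
      ∫ t in (-1 : ℝ)..1, (1 - t ^ 2 + h) ^ (-(l / 2)) * (1 - t ^ 2) ^ (q - 1) ≤
        C * h ^ (k - l / 2) := by
  have hl' : 0 < l / 2 - k := by linarith
  refine ⟨2 * (2 ^ |k - 1| * (1 / k + 1 / (l / 2 - k))), by positivity, fun h h0 h1 => ?_⟩
  have hc : ContinuousOn (fun t : ℝ => (1 - t ^ 2 + h) ^ (-(l / 2))) (Set.uIcc 0 1) := by
    refine ContinuousOn.rpow_const (by fun_prop) fun t ht => Or.inl ?_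
    rw [Set.uIcc_of_le zero_le_one] at ht
    nlinarith [ht.1, ht.2]
  have hi : IntervalIntegrable
      (fun t : ℝ => (1 - t ^ 2 + h) ^ (-(l / 2)) * (1 - t ^ 2) ^ (q - 1)) volume 0 1 :=
    (intervalIntegrable_jacobi_half (by linarith)).continuousOn_mul hc
  rw [integral_of_even (by simp) hi, mul_assoc, mul_assoc]
  refine mul_le_mul_of_nonneg_left ?_ (by norm_num)
  have hj : IntervalIntegrable
      (fun t : ℝ => 2 ^ |k - 1| * ((1 - t) ^ (k - 1) * (1 - t + h) ^ (-(l / 2)))) volume 0 1 := by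
    refine ((intervalIntegrable_one_sub_rpow hk).mul_continuousOn ?_).const_mul _
    refine ContinuousOn.rpow_const (by fun_prop) fun t ht => Or.inl ?_
    rw [Set.uIcc_of_le zero_le_one] at ht
    linarith [ht.2]
  have hle := intervalIntegral.integral_mono_on_of_le_Ioo zero_le_one hi hj fun t ht => by
    have ht0 : 0 < 1 - t := by linarith [ht.2]
    have ht1 : 1 - t ≤ 1 - t ^ 2 := by nlinarith [ht.1, ht.2]
    have ht2 : 1 - t ^ 2 ≤ 2 * (1 - t) := by nlinarith [ht.1, ht.2]
    have a1 : (1 - t ^ 2) ^ (q - 1) ≤ (1 - t ^ 2) ^ (k - 1) :=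
      rpow_le_rpow_of_exponent_ge (by linarith) (by nlinarith [ht.1]) (by linarith)
    have a2 : (1 - t ^ 2) ^ (k - 1) ≤ 2 ^ |k - 1| * (1 - t) ^ (k - 1) :=
      rpow_le_of_comparable ht0.le (by linarith) (by norm_num) ht2 (by linarith) _
    have a3 : (1 - t ^ 2 + h) ^ (-(l / 2)) ≤ (1 - t + h) ^ (-(l / 2)) :=
      rpow_le_rpow_of_nonpos (by linarith) (by linarith) (by linarith)
    have a4 : 0 ≤ (1 - t ^ 2) ^ (q - 1) := rpow_nonneg (by linarith) _
    calc (1 - t ^ 2 + h) ^ (-(l / 2)) * (1 - t ^ 2) ^ (q - 1)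
        ≤ (1 - t + h) ^ (-(l / 2)) * (2 ^ |k - 1| * (1 - t) ^ (k - 1)) :=
          mul_le_mul a3 (a1.trans a2) a4 (rpow_nonneg (by linarith) _)
      _ = _ := by ring
  refine hle.trans ?_
  rw [intervalIntegral.integral_const_mul]
  refine mul_le_mul_of_nonneg_left ?_ (by positivity)
  have := intervalIntegral.integral_comp_sub_left (a := 0) (b := 1)
    (fun x : ℝ => x ^ (k - 1) * (x + h) ^ (-(l / 2))) 1
  rw [sub_self, sub_zero] at this
  rw [this]
  exact integral_rpow_mul_shift_le hk hl h0 h1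

lemma volume_restrict_cube (m : ℕ) : (volume : Measure (Fin m → ℝ)).restrict (cube m) =
    Measure.pi fun _ => (volume : Measure ℝ).restrict (Set.Icc (-1) 1) := by
  rw [cube, volume_pi, Measure.restrict_pi_pi]

lemma integrableOn_cube_prod {m : ℕ} {f : Fin m → ℝ → ℝ}
    (hf : ∀ i, IntegrableOn (f i) (Set.Icc (-1) 1)) :
    IntegrableOn (fun t : Fin m → ℝ => ∏ i, f i (t i)) (cube m) := by
  rw [IntegrableOn, volume_restrict_cube]
  exact Integrable.fintype_prod hf

lemma integral_cube_prod {m : ℕ} (f : Fin m → ℝ → ℝ) :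
    ∫ t in cube m, ∏ i, f i (t i) = ∏ i, ∫ s in Set.Icc (-1) 1, f i s := by
  rw [volume_restrict_cube]
  exact integral_fintype_prod_eq_prod f

lemma measurableSet_cube (m : ℕ) : MeasurableSet (cube m) :=
  MeasurableSet.univ_pi fun _ => measurableSet_Icc

lemma isCompact_cube (m : ℕ) : IsCompact (cube m) :=
  isCompact_univ_pi fun _ => isCompact_Icc

lemma abs_le_one_of_mem_cube {m : ℕ} {t : Fin m → ℝ} (ht : t ∈ cube m) (i : Fin m) : |t i| ≤ 1 :=
  abs_le.2 (ht i trivial)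

/-- The even part of the weight on the cube. -/
noncomputable def jacW {m : ℕ} (κ : Fin m → ℝ) (t : Fin m → ℝ) : ℝ :=
  ∏ i, (1 - t i ^ 2) ^ (κ i - 1)

lemma jacW_nonneg {m : ℕ} (κ : Fin m → ℝ) {t : Fin m → ℝ} (ht : t ∈ cube m) : 0 ≤ jacW κ t :=
  prod_nonneg fun i _ => rpow_nonneg (by
    have := (sq_le_one_iff_abs_le_one _).2 (abs_le_one_of_mem_cube ht i)
    linarith) _

lemma integrableOn_jacW {m : ℕ} {κ : Fin m → ℝ} (hκ : ∀ i, 0 < κ i) :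
    IntegrableOn (jacW κ) (cube m) :=
  integrableOn_cube_prod (f := fun i s => (1 - s ^ 2) ^ (κ i - 1)) fun i => integrableOn_jacobi (hκ i)

lemma integrableOn_mul_jacW {m : ℕ} {κ : Fin m → ℝ} (hκ : ∀ i, 0 < κ i) {f : (Fin m → ℝ) → ℝ}
    (hf : Continuous f) : IntegrableOn (fun t => f t * jacW κ t) (cube m) :=
  (integrableOn_jacW hκ).continuousOn_mul hf.continuousOn (isCompact_cube m)

lemma abs_sum_mul_le {m : ℕ} {v t : Fin m → ℝ} (hv : ∀ i, 0 ≤ v i) (hs : ∑ i, v i = 1)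
    (ht : t ∈ cube m) (j : Fin m) : |∑ i, v i * t i| ≤ 1 - v j * (1 - |t j|) := by
  refine (abs_sum_le_sum_abs _ _).trans ?_
  rw [← add_sum_erase _ v (mem_univ j)] at hs
  rw [← add_sum_erase _ _ (mem_univ j), abs_mul, abs_of_nonneg (hv j)]
  have : ∑ i ∈ univ.erase j, |v i * t i| ≤ ∑ i ∈ univ.erase j, v i := by
    refine sum_le_sum fun i _ => ?_
    rw [abs_mul, abs_of_nonneg (hv i)]
    exact mul_le_of_le_one_right (hv i) (abs_le_one_of_mem_cube ht i)
  linarith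

lemma exists_ge_inv_card {m : ℕ} {v : Fin (m + 1) → ℝ} (hs : ∑ i, v i = 1) :
    ∃ j, 1 / ((m : ℝ) + 1) ≤ v j := by
  by_contra! h
  have := sum_lt_sum_of_nonempty (s := univ) univ_nonempty fun i _ => h i
  rw [hs] at this
  simp at this
  field_simp at this
  linarith

lemma abs_prod_le_one_of_mem_cube {m : ℕ} {t : Fin m → ℝ} (ht : t ∈ cube m) (S : Finset (Fin m)) :
    |∏ i ∈ S, t i| ≤ 1 := by
  rw [abs_prod]
  exact prod_le_one (fun i _ => abs_nonneg _) fun i _ => abs_le_one_of_mem_cube ht i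

lemma diagonal_bound_of_lt {m : ℕ} {κ : Fin (m + 1) → ℝ} {k l : ℝ} (hk : 0 < k)
    (hκ : ∀ i, k ≤ κ i) (hl : 2 * k < l) :
    ∃ C : ℝ, 0 < C ∧ ∀ n : ℕ, 1 ≤ n → ∀ v : Fin (m + 1) → ℝ, (∀ i, 0 ≤ v i) → ∑ i, v i = 1 →
      ∀ S : Finset (Fin (m + 1)),
        |∫ t in cube (m + 1), gegenC n l (∑ i, v i * t i) * (∏ i ∈ S, t i) * jacW κ t| ≤
          C * (n : ℝ) ^ (2 * l - 1 - 2 * k) := by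
  have hl0 : 0 < l := by linarith
  obtain ⟨B, hB, hBn⟩ := gegen_pointwise_bound hl0
  have hκ0 : ∀ i, 0 < κ i := fun i => hk.trans_le (hκ i)
  choose D hD hDh using fun i => jacobi_shift_integral_le hk (hκ i) hl
  set a : ℝ := 1 / ((m : ℝ) + 1) with ha
  have ha0 : 0 < a := by positivity
  have ha1 : a ≤ 1 := by rw [ha, div_le_one (by positivity)]; linarith [m.cast_nonneg (α := ℝ)]
  set E : Fin (m + 1) → ℝ := fun i => ∫ s in Set.Icc (-1 : ℝ) 1, (1 - s ^ 2) ^ (κ i - 1) with hE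
  have hE0 : ∀ i, 0 ≤ E i := fun i => setIntegral_nonneg measurableSet_Icc fun s hs =>
    rpow_nonneg (by nlinarith [hs.1, hs.2]) _
  have hEp : 0 ≤ ∏ i, (1 + E i) := prod_nonneg fun i _ => by linarith [hE0 i]
  have hDp : 0 < ∑ i, D i := sum_pos (fun i _ => hD i) univ_nonempty
  refine ⟨B * (a / 2) ^ (-(l / 2)) * (∑ i, D i) * (∏ i, (1 + E i)) + 1, by positivity,
    fun n hn v hv hs S => ?_⟩
  obtain ⟨j, hj⟩ := exists_ge_inv_card hs
  have hn0 : (0 : ℝ) < n := by exact_mod_cast hn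
  have hn1 : (1 : ℝ) ≤ n := by exact_mod_cast hn
  set h : ℝ := ((n : ℝ) ^ 2)⁻¹ with hh
  have hh0 : 0 < h := by positivity
  have hh1 : h ≤ 1 := inv_le_one_of_one_le₀ (by nlinarith)
  set A : ℝ := B * (n : ℝ) ^ (l - 1) * (a / 2) ^ (-(l / 2)) with hA
  have hA0 : 0 ≤ A := by positivity
  set F : Fin (m + 1) → ℝ → ℝ := fun i s =>
    (if i = j then (1 - s ^ 2 + h) ^ (-(l / 2)) else 1) * (1 - s ^ 2) ^ (κ i - 1) with hF
  have hFi : ∀ i, IntegrableOn (F i) (Set.Icc (-1) 1) := by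
    intro i
    refine (integrableOn_jacobi (hκ0 i)).continuousOn_mul ?_ isCompact_Icc
    by_cases hij : i = j
    · simp only [hij, if_true]
      refine ContinuousOn.rpow_const (by fun_prop) fun t ht => Or.inl ?_
      nlinarith [ht.1, ht.2]
    · simp only [hij, if_false]
      exact continuousOn_const
  have hpt : ∀ t ∈ cube (m + 1), ‖gegenC n l (∑ i, v i * t i) * (∏ i ∈ S, t i) * jacW κ t‖ ≤
      A * ∏ i, F i (t i) := by
    intro t ht
    have hb := abs_sum_mul_le hv hs ht j
    have htj := abs_le_one_of_mem_cube ht j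
    have htj0 := abs_nonneg (t j)
    have hvj : a * (1 - |t j|) ≤ v j * (1 - |t j|) :=
      mul_le_mul_of_nonneg_right hj (by linarith)
    set s := ∑ i, v i * t i with hsdef
    have hs0 := abs_nonneg s
    have hs1 : |s| ≤ 1 := by
      have : 0 ≤ a * (1 - |t j|) := mul_nonneg ha0.le (by linarith)
      linarith
    have hX : a / 2 * (1 - t j ^ 2 + h) ≤ 1 - s ^ 2 + h := by
      rw [← sq_abs s, ← sq_abs (t j)]
      have h1 : a * (1 - |t j|) ≤ 1 - |s| ^ 2 := by nlinarith
      have h2 : a / 2 * (1 - |t j| ^ 2) ≤ a * (1 - |t j|) := by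
        have h3 : 1 - |t j| ^ 2 ≤ 2 * (1 - |t j|) := by nlinarith
        nlinarith
      nlinarith
    have hY : 0 < 1 - t j ^ 2 + h := by
      rw [← sq_abs]; nlinarith
    have hgb := (hBn n hn s ⟨(abs_le.1 hs1).1, (abs_le.1 hs1).2⟩).1
    have hP : ∏ i, F i (t i) = (1 - t j ^ 2 + h) ^ (-(l / 2)) * jacW κ t := by
      simp only [hF, prod_mul_distrib, jacW]
      congr 1
      rw [prod_eq_single j]
      · simp
      · intro i _ hij; simp [hij]
      · simp
    rw [hP, norm_mul, norm_mul, Real.norm_eq_abs, Real.norm_eq_abs, Real.norm_eq_abs,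
      abs_of_nonneg (jacW_nonneg κ ht), ← mul_assoc]
    refine mul_le_mul_of_nonneg_right ?_ (jacW_nonneg κ ht)
    calc |gegenC n l s| * |∏ i ∈ S, t i| ≤ |gegenC n l s| :=
          mul_le_of_le_one_right (abs_nonneg _) (abs_prod_le_one_of_mem_cube ht S)
      _ ≤ _ := hgb
      _ ≤ B * (n : ℝ) ^ (l - 1) * (a / 2 * (1 - t j ^ 2 + h)) ^ (-(l / 2)) := by
          refine mul_le_mul_of_nonneg_left ?_ (by positivity)
          exact rpow_le_rpow_of_nonpos (by positivity) hX (by linarith)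
      _ = A * (1 - t j ^ 2 + h) ^ (-(l / 2)) := by
          rw [mul_rpow (by positivity) hY.le, hA]; ring
  have hint := norm_integral_le_of_norm_le ((integrableOn_cube_prod hFi).const_mul A)
    (f := fun t => gegenC n l (∑ i, v i * t i) * (∏ i ∈ S, t i) * jacW κ t)
    ((ae_restrict_iff' (measurableSet_cube _)).2 (Filter.Eventually.of_forall hpt))
  rw [Real.norm_eq_abs, integral_const_mul, integral_cube_prod] at hint
  refine hint.trans ?_
  have hFj : ∫ s in Set.Icc (-1) 1, F j s ≤ (∑ i, D i) * h ^ (k - l / 2) := by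
    have h1 := hDh j h hh0 hh1
    rw [intervalIntegral.integral_of_le (by norm_num), ← integral_Icc_eq_integral_Ioc] at h1
    simp only [hF, if_true]
    refine h1.trans (mul_le_mul_of_nonneg_right ?_ (by positivity))
    exact single_le_sum (fun i _ => (hD i).le) (mem_univ j)
  have hFo : ∏ i ∈ univ.erase j, ∫ s in Set.Icc (-1) 1, F i s ≤ ∏ i, (1 + E i) := by
    have h1 : ∏ i ∈ univ.erase j, ∫ s in Set.Icc (-1) 1, F i s ≤ ∏ i ∈ univ.erase j, (1 + E i) := by
      refine prod_le_prod (fun i hi => ?_) fun i hi => ?_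
      · simp only [hF, ne_of_mem_erase hi, if_false, one_mul]; exact hE0 i
      · simp only [hF, ne_of_mem_erase hi, if_false, one_mul, hE]; linarith
    refine h1.trans ?_
    rw [← mul_prod_erase univ _ (mem_univ j)]
    exact le_mul_of_one_le_left (prod_nonneg fun i _ => by linarith [hE0 i]) (by linarith [hE0 j])
  have hFo0 : 0 ≤ ∏ i ∈ univ.erase j, ∫ s in Set.Icc (-1) 1, F i s := by
    refine prod_nonneg fun i hi => ?_
    simp only [hF, ne_of_mem_erase hi, if_false, one_mul]; exact hE0 i
  rw [← mul_prod_erase univ _ (mem_univ j)]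
  have hpow : (n : ℝ) ^ (l - 1) * h ^ (k - l / 2) = (n : ℝ) ^ (2 * l - 1 - 2 * k) := by
    rw [hh, ← rpow_natCast, ← rpow_neg hn0.le, ← rpow_mul hn0.le, ← rpow_add hn0]
    congr 1
    push_cast
    ring
  calc A * ((∫ s in Set.Icc (-1) 1, F j s) * ∏ i ∈ univ.erase j, ∫ s in Set.Icc (-1) 1, F i s)
      ≤ A * (((∑ i, D i) * h ^ (k - l / 2)) * ∏ i, (1 + E i)) := by
        refine mul_le_mul_of_nonneg_left ?_ hA0
        exact mul_le_mul hFj hFo hFo0 (by positivity)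
    _ = B * (a / 2) ^ (-(l / 2)) * (∑ i, D i) * (∏ i, (1 + E i)) *
          ((n : ℝ) ^ (l - 1) * h ^ (k - l / 2)) := by rw [hA]; ring
    _ ≤ _ := by
        rw [hpow]
        refine mul_le_mul_of_nonneg_right (by linarith) (by positivity)

/-- The antiderivative of the Gegenbauer polynomial provided by its differential equation. -/
noncomputable def gegenA (n : ℕ) (l s : ℝ) : ℝ :=
  -(((1 - s ^ 2) * gegenD n l s - (2 * l - 1) * s * gegenC n l s) / (((n : ℝ) + 1) * (n + 2 * l - 1)))

lemma hasDerivAt_gegenA {l : ℝ} (hl : 0 < l) {n : ℕ} (hn : 1 ≤ n) (s : ℝ) :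
    HasDerivAt (gegenA n l) (gegenC n l s) s := by
  have hn1 : (1 : ℝ) ≤ n := by exact_mod_cast hn
  have hD : ((n : ℝ) + 1) * (n + 2 * l - 1) ≠ 0 := by
    apply ne_of_gt; apply mul_pos <;> linarith
  have h1 := (((((hasDerivAt_id s).pow 2).const_sub 1).mul (hasDerivAt_gegenD n l s)).sub
    ((((hasDerivAt_id s).const_mul (2 * l - 1))).mul (hasDerivAt_gegenC_gegenD hl n s))).div_const
      (((n : ℝ) + 1) * (n + 2 * l - 1)) |>.neg
  refine (h1.congr_deriv ?_).congr_of_eventuallyEq (Filter.Eventually.of_forall fun x => ?_)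
  · have := gegenC_ode hl n s
    simp only [id, Pi.pow_apply]
    rw [neg_eq_iff_eq_neg, div_eq_iff hD]
    push_cast
    linear_combination this
  · simp [gegenA]

lemma abs_gegenA_le {l : ℝ} (hl : 0 < l) : ∃ C : ℝ, 0 < C ∧ ∀ n : ℕ, 1 ≤ n →
    ∀ s ∈ Set.Icc (-1 : ℝ) 1, |gegenA n l s| ≤
      C * (n : ℝ) ^ (l - 2) * (1 - s ^ 2 + ((n : ℝ) ^ 2)⁻¹) ^ ((1 - l) / 2) := by
  obtain ⟨B, hB, hBn⟩ := gegen_pointwise_bound hl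
  set c : ℝ := min 1 (2 * l) with hc
  have hc0 : 0 < c := by rw [hc]; positivity
  refine ⟨(B + |2 * l - 1| * B) / c, by positivity, fun n hn s hs => ?_⟩
  obtain ⟨h1, h2⟩ := hBn n hn s hs
  have hn1 : (1 : ℝ) ≤ n := by exact_mod_cast hn
  have hn0 : (0 : ℝ) < n := by linarith
  have hs2 : 0 ≤ 1 - s ^ 2 := by nlinarith [hs.1, hs.2]
  set X := 1 - s ^ 2 + ((n : ℝ) ^ 2)⁻¹ with hX
  have hinv : 0 < ((n : ℝ) ^ 2)⁻¹ := by positivity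
  have hX0 : 0 < X := by linarith
  have hD : c * (n : ℝ) ^ 2 ≤ ((n : ℝ) + 1) * (n + 2 * l - 1) := by
    have h3 : c * n ≤ n + 2 * l - 1 := by
      rcases le_total 1 (2 * l) with h | h
      · rw [hc, min_eq_left h]; linarith
      · rw [hc, min_eq_right h]; nlinarith
    have h4 : 0 < c * n := by positivity
    nlinarith
  have hD0 : 0 < c * (n : ℝ) ^ 2 := by positivity
  have hsq : √(1 - s ^ 2) ≤ X ^ ((1 : ℝ) / 2) := by
    rw [← sqrt_eq_rpow]; exact sqrt_le_sqrt (by linarith)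
  have hnX : 1 ≤ n * X ^ ((1 : ℝ) / 2) := by
    have : √(((n : ℝ) ^ 2)⁻¹) ≤ X ^ ((1 : ℝ) / 2) := by
      rw [← sqrt_eq_rpow]; exact sqrt_le_sqrt (by linarith)
    rw [sqrt_inv, sqrt_sq hn0.le] at this
    calc (1 : ℝ) = n * (n : ℝ)⁻¹ := by field_simp
      _ ≤ _ := by gcongr
  have hp : X ^ ((1 : ℝ) / 2) * X ^ (-(l / 2)) = X ^ ((1 - l) / 2) := by
    rw [← rpow_add hX0]; congr 1; ring
  have hnl : (n : ℝ) ^ l = n ^ 2 * (n : ℝ) ^ (l - 2) := by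
    rw [← rpow_natCast, ← rpow_add hn0]; congr 1; push_cast; ring
  have hnl1 : (n : ℝ) ^ (l - 1) * n = (n : ℝ) ^ l := by
    rw [← rpow_add_one hn0.ne']; congr 1; ring
  have e1 : |(1 - s ^ 2) * gegenD n l s| ≤ B * (n : ℝ) ^ l * X ^ ((1 - l) / 2) := by
    rw [abs_mul, abs_of_nonneg hs2, ← mul_self_sqrt hs2, mul_assoc]
    calc √(1 - s ^ 2) * (√(1 - s ^ 2) * |gegenD n l s|)
        ≤ X ^ ((1 : ℝ) / 2) * (B * (n : ℝ) ^ l * X ^ (-(l / 2))) :=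
          mul_le_mul hsq h2 (by positivity) (by positivity)
      _ = B * (n : ℝ) ^ l * (X ^ ((1 : ℝ) / 2) * X ^ (-(l / 2))) := by ring
      _ = _ := by rw [hp]
  have e2 : |(2 * l - 1) * s * gegenC n l s| ≤
      |2 * l - 1| * B * (n : ℝ) ^ l * X ^ ((1 - l) / 2) := by
    rw [abs_mul, abs_mul]
    calc |2 * l - 1| * |s| * |gegenC n l s|
        ≤ |2 * l - 1| * 1 * (B * (n : ℝ) ^ (l - 1) * X ^ (-(l / 2))) := by
          gcongr
          exact abs_le.2 hs
      _ ≤ |2 * l - 1| * 1 * (B * (n : ℝ) ^ (l - 1) * X ^ (-(l / 2))) *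
            (n * X ^ ((1 : ℝ) / 2)) := le_mul_of_one_le_right (by positivity) hnX
      _ = |2 * l - 1| * B * ((n : ℝ) ^ (l - 1) * n) * (X ^ ((1 : ℝ) / 2) * X ^ (-(l / 2))) := by ring
      _ = _ := by rw [hp, hnl1]
  rw [gegenA, abs_neg, abs_div, abs_of_pos (hD0.trans_le hD), div_le_iff₀ (hD0.trans_le hD)]
  refine (abs_sub _ _).trans ?_
  calc _ ≤ B * (n : ℝ) ^ l * X ^ ((1 - l) / 2) + |2 * l - 1| * B * (n : ℝ) ^ l * X ^ ((1 - l) / 2) :=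
        add_le_add e1 e2
    _ = (B + |2 * l - 1| * B) / c * (n : ℝ) ^ (l - 2) * X ^ ((1 - l) / 2) * (c * n ^ 2) := by
        rw [hnl]; field_simp
    _ ≤ _ := by gcongr

set_option maxHeartbeats 1000000 in
lemma gegen_half_integral_bound {k : ℝ} (hk : 0 < k) : ∃ C : ℝ, 0 < C ∧ ∀ n : ℕ, 1 ≤ n →
    ∀ a b : ℝ, 1 / 2 ≤ a → |b| ≤ 1 - a → ∀ g g' : ℝ → ℝ, Continuous g' →
    (∀ t, HasDerivAt g (g' t) t) → (∀ t ∈ Set.Icc (0 : ℝ) 1, |g t| ≤ 1 ∧ |g' t| ≤ 1) →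
    |∫ t in (0 : ℝ)..1, gegenC n (2 * k) (b + a * t) * (g t * (1 - t ^ 2) ^ (k - 1))| ≤
      C * (n : ℝ) ^ (2 * k - 1) := by
  have hl : 0 < 2 * k := by linarith
  obtain ⟨B, hB, hBn⟩ := gegen_pointwise_bound hl
  obtain ⟨E, hE, hEn⟩ := abs_gegenA_le hl
  set p : ℝ := 1 / 2 - k with hp
  set Cn : ℝ := B * 4 ^ k * 2 ^ |k - 1| / k with hCn
  set c2 : ℝ := (1 + 2 * |k - 1|) * 2 ^ |k - 2| with hc2
  set c1 : ℝ := 2 ^ |k - 1| with hc1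
  set EA : ℝ := E * 6 ^ |p| with hEA
  refine ⟨Cn + (2 * EA * c1 * 2 + 2 * EA * c1 * 2) + 2 * EA * c2 * 4, by positivity,
    fun n hn a b ha hb g g' hg'c hg hgb => ?_⟩
  have hn1 : (1 : ℝ) ≤ n := by exact_mod_cast hn
  have hn0 : (0 : ℝ) < n := by linarith
  have hb' := abs_le.1 hb
  have ha1 : a ≤ 1 := by linarith [abs_nonneg b]
  have ha0 : 0 < a := by linarith
  set ν : ℝ := ((n : ℝ) ^ 2)⁻¹ with hν
  have hν0 : 0 < ν := by positivity
  have hν1 : ν ≤ 1 := inv_le_one_of_one_le₀ (by nlinarith)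
  set τ : ℝ := (1 - a - b + ν) / 2 with hτ
  have hτ0 : 0 < τ := by linarith
  have hτ1 : τ ≤ 1 := by linarith
  have hτν : ν / 2 ≤ τ := by linarith
  have hgc : Continuous g := continuous_iff_continuousAt.2 fun t => (hg t).continuousAt
  -- comparison of the weight variables
  have hX : ∀ t ∈ Set.Icc (0 : ℝ) 1, b + a * t ∈ Set.Icc (-1 : ℝ) 1 ∧
      (2 * τ + (1 - t)) / 4 ≤ 1 - (b + a * t) ^ 2 + ν ∧
      1 - (b + a * t) ^ 2 + ν ≤ 2 * (2 * τ + (1 - t)) := by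
    intro t ht
    have h0 : 0 ≤ a * t := mul_nonneg ha0.le ht.1
    have h1 : (1 - t) / 2 ≤ a * (1 - t) := by nlinarith [ht.2]
    have h1' : a * (1 - t) ≤ 1 - t := by nlinarith [ht.2]
    have h2 : 1 - (b + a * t) = 1 - a - b + a * (1 - t) := by ring
    have h3 : 1 / 2 ≤ 1 + (b + a * t) := by linarith
    have h5 : 0 ≤ 1 - (b + a * t) := by rw [h2]; linarith [ht.2]
    have h6 : 1 - (b + a * t) ^ 2 = (1 - (b + a * t)) * (1 + (b + a * t)) := by ring
    refine ⟨⟨by linarith, by linarith⟩, ?_, ?_⟩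
    · rw [h6]
      have := mul_le_mul_of_nonneg_left h3 h5
      linarith [ht.2]
    · rw [h6]
      have := mul_le_mul_of_nonneg_left (show 1 + (b + a * t) ≤ 2 by linarith) h5
      linarith [ht.2]
  have hw : ∀ t ∈ Set.Icc (0 : ℝ) 1, (1 - t ^ 2) ^ (k - 1) ≤ c1 * (1 - t) ^ (k - 1) := by
    intro t ht
    exact rpow_le_of_comparable (by linarith [ht.2]) (by nlinarith [ht.1, ht.2]) (by norm_num)
      (by nlinarith [ht.1, ht.2]) (by nlinarith [ht.1, ht.2]) _
  set f : ℝ → ℝ := fun t => gegenC n (2 * k) (b + a * t) with hf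
  have hfc : Continuous f := (continuous_gegenC hl n).comp (by fun_prop)
  have hi1 : IntervalIntegrable (fun t => f t * (g t * (1 - t ^ 2) ^ (k - 1))) volume 0 1 :=
    ((intervalIntegrable_jacobi_half hk).continuousOn_mul hgc.continuousOn).continuousOn_mul
      hfc.continuousOn
  have hT : (1 - τ) ∈ Set.uIcc (0 : ℝ) 1 := by
    rw [Set.uIcc_of_le zero_le_one]; constructor <;> linarith
  have hiA := hi1.mono_set (Set.uIcc_subset_uIcc_left hT)
  have hiB := hi1.mono_set (Set.uIcc_subset_uIcc_right hT)
  rw [← intervalIntegral.integral_add_adjacent_intervals hiA hiB]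
  -- near the endpoint
  have near : |∫ t in (1 - τ)..1, f t * (g t * (1 - t ^ 2) ^ (k - 1))| ≤
      Cn * (n : ℝ) ^ (2 * k - 1) := by
    have hj : IntervalIntegrable (fun t : ℝ => B * (n : ℝ) ^ (2 * k - 1) * (τ / 4) ^ (-k) *
        (c1 * (1 - t) ^ (k - 1))) volume (1 - τ) 1 :=
      (((intervalIntegrable_one_sub_rpow hk).mono_set (Set.uIcc_subset_uIcc_right hT)).const_mul
        _).const_mul _
    have h1 := intervalIntegral.norm_integral_le_of_norm_le (a := 1 - τ) (b := 1) (μ := volume)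
      (f := fun t => f t * (g t * (1 - t ^ 2) ^ (k - 1))) (by linarith)
      (Filter.Eventually.of_forall fun t ht => ?_) hj
    · rw [Real.norm_eq_abs] at h1
      refine h1.trans (le_of_eq ?_)
      rw [intervalIntegral.integral_const_mul, intervalIntegral.integral_const_mul,
        intervalIntegral.integral_comp_sub_left (fun x : ℝ => x ^ (k - 1)) 1, sub_self,
        sub_sub_cancel, integral_rpow (Or.inl (by linarith)), sub_add_cancel,
        zero_rpow hk.ne', sub_zero, div_rpow hτ0.le (by norm_num), rpow_neg hτ0.le,
        rpow_neg (by norm_num), hCn]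
      have : τ ^ k ≠ 0 := (rpow_pos_of_pos hτ0 _).ne'
      have h4k : (4 : ℝ) ^ k ≠ 0 := (rpow_pos_of_pos (by norm_num) _).ne'
      field_simp
    · have ht' : t ∈ Set.Icc (0 : ℝ) 1 := ⟨by linarith [ht.1], ht.2⟩
      obtain ⟨x1, x2, x3⟩ := hX t ht'
      have h2 := (hBn n hn _ x1).1
      rw [norm_mul, norm_mul, Real.norm_eq_abs, Real.norm_eq_abs, Real.norm_eq_abs,
        abs_of_nonneg (rpow_nonneg (show 0 ≤ 1 - t ^ 2 by nlinarith [ht'.1, ht'.2]) _)]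
      refine mul_le_mul ?_ ?_ (by have := rpow_nonneg (show 0 ≤ 1 - t ^ 2 by nlinarith [ht'.1, ht'.2]) (k - 1); positivity) (by positivity)
      · refine h2.trans (mul_le_mul_of_nonneg_left ?_ (by positivity))
        rw [mul_div_cancel_left₀ _ (by norm_num : (2 : ℝ) ≠ 0)]
        exact rpow_le_rpow_of_nonpos (by positivity) (by linarith [ht.2]) (by linarith)
      · refine le_trans ?_ (hw t ht')
        exact mul_le_of_le_one_left (rpow_nonneg (by nlinarith [ht'.1, ht'.2]) _) (hgb t ht').1
  -- away from the endpoint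
  have hAb : ∀ t ∈ Set.Icc (0 : ℝ) (1 - τ), |gegenA n (2 * k) (b + a * t) / a| ≤
      2 * EA * (n : ℝ) ^ (2 * k - 2) * (1 - t) ^ p := by
    intro t ht
    have ht' : t ∈ Set.Icc (0 : ℝ) 1 := ⟨ht.1, by linarith [ht.2]⟩
    obtain ⟨x1, x2, x3⟩ := hX t ht'
    have h2 := hEn n hn _ x1
    have h3 : (1 - (b + a * t) ^ 2 + ν) ^ p ≤ 6 ^ |p| * (1 - t) ^ p :=
      rpow_le_of_comparable (by linarith [ht.2]) (by linarith [ht.2]) (by norm_num)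
        (by linarith [ht.2]) (by linarith [ht.2]) _
    rw [show (1 - 2 * k) / 2 = p by rw [hp]; ring] at h2
    rw [abs_div, abs_of_pos ha0, div_le_iff₀ ha0]
    have h4 : 0 ≤ EA * (n : ℝ) ^ (2 * k - 2) * (1 - t) ^ p := by
      have := rpow_nonneg (show 0 ≤ 1 - t by linarith [ht'.2]) p
      positivity
    calc _ ≤ _ := h2
      _ ≤ E * (n : ℝ) ^ (2 * k - 2) * (6 ^ |p| * (1 - t) ^ p) :=
        mul_le_mul_of_nonneg_left h3 (by positivity)
      _ = EA * (n : ℝ) ^ (2 * k - 2) * (1 - t) ^ p := by rw [hEA]; ring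
      _ ≤ _ := by nlinarith
  have hnn : (n : ℝ) ^ (2 * k - 2) * n = (n : ℝ) ^ (2 * k - 1) := by
    rw [← rpow_add_one hn0.ne']; congr 1; ring
  have hτn : τ ^ (-(1 / 2) : ℝ) ≤ 2 * n := by
    have h1 : τ ^ (-(1 / 2) : ℝ) ≤ (ν / 2) ^ (-(1 / 2) : ℝ) :=
      rpow_le_rpow_of_nonpos (by positivity) hτν (by norm_num)
    refine h1.trans ?_
    rw [rpow_neg (by positivity), ← sqrt_eq_rpow, ← sqrt_inv]
    rw [sqrt_le_left (by positivity), hν, inv_div, div_inv_eq_mul]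
    nlinarith
  have far : |∫ t in (0 : ℝ)..(1 - τ), f t * (g t * (1 - t ^ 2) ^ (k - 1))| ≤
      ((2 * EA * c1 * 2 + 2 * EA * c1 * 2) + 2 * EA * c2 * 4) * (n : ℝ) ^ (2 * k - 1) := by
    have hpos : ∀ t ∈ Set.Icc (0 : ℝ) (1 - τ), 0 < 1 - t ^ 2 := fun t ht => by
      nlinarith [ht.1, ht.2]
    set w : ℝ → ℝ := fun t => g t * (1 - t ^ 2) ^ (k - 1) with hwdef
    set w' : ℝ → ℝ := fun t => g' t * (1 - t ^ 2) ^ (k - 1) +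
      g t * ((-(2 * t)) * (k - 1) * (1 - t ^ 2) ^ (k - 1 - 1)) with hw'def
    have hT' : (0 : ℝ) ≤ 1 - τ := by linarith
    have hdw : ∀ t ∈ Set.uIcc (0 : ℝ) (1 - τ), HasDerivAt w (w' t) t := by
      intro t ht
      rw [Set.uIcc_of_le hT'] at ht
      have h1 : HasDerivAt (fun t : ℝ => 1 - t ^ 2) (-(2 * t)) t := by
        simpa using ((hasDerivAt_id t).pow 2).const_sub 1
      exact (hg t).mul (h1.rpow_const (Or.inl (hpos t ht).ne'))
    have hdA : ∀ t ∈ Set.uIcc (0 : ℝ) (1 - τ),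
        HasDerivAt (fun t => gegenA n (2 * k) (b + a * t) / a) (f t) t := by
      intro t _
      have h1 : HasDerivAt (fun t : ℝ => b + a * t) a t := by
        simpa using ((hasDerivAt_id t).const_mul a).const_add b
      have h2 := ((hasDerivAt_gegenA hl hn (b + a * t)).comp t h1).div_const a
      refine h2.congr_deriv ?_
      rw [hf]; field_simp
    have hw'i : IntervalIntegrable w' volume 0 (1 - τ) := by
      apply ContinuousOn.intervalIntegrable
      rw [Set.uIcc_of_le hT', hw'def]
      have : ∀ e : ℝ, ContinuousOn (fun t : ℝ => (1 - t ^ 2) ^ e) (Set.Icc 0 (1 - τ)) := fun e =>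
        ContinuousOn.rpow_const (by fun_prop) fun t ht => Or.inl (hpos t ht).ne'
      have h1 := this (k - 1)
      have h2 := this (k - 1 - 1)
      fun_prop
    have hparts := intervalIntegral.integral_mul_deriv_eq_deriv_mul hdw hdA hw'i
      (hfc.intervalIntegrable 0 (1 - τ))
    have hcomm : ∫ t in (0 : ℝ)..(1 - τ), f t * w t = ∫ t in (0 : ℝ)..(1 - τ), w t * f t := by
      congr 1; ext t; ring
    rw [hcomm, hparts]
    have hwb : ∀ t ∈ Set.Icc (0 : ℝ) (1 - τ), |w t| ≤ c1 * (1 - t) ^ (k - 1) := fun t ht => by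
      have ht' : t ∈ Set.Icc (0 : ℝ) 1 := ⟨ht.1, by linarith [ht.2]⟩
      rw [hwdef]
      simp only
      rw [abs_mul, abs_of_nonneg (rpow_nonneg (hpos t ht).le _)]
      exact (mul_le_of_le_one_left (rpow_nonneg (hpos t ht).le _) (hgb t ht').1).trans (hw t ht')
    have hw'b : ∀ t ∈ Set.Icc (0 : ℝ) (1 - τ), |w' t| ≤ c2 * (1 - t) ^ (k - 2) := fun t ht => by
      have ht' : t ∈ Set.Icc (0 : ℝ) 1 := ⟨ht.1, by linarith [ht.2]⟩
      have hp0 := hpos t ht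
      have q1 : (1 - t ^ 2) ^ (k - 1) ≤ (1 - t ^ 2) ^ (k - 2) :=
        rpow_le_rpow_of_exponent_ge hp0 (by nlinarith) (by linarith)
      have q2 : (1 - t ^ 2) ^ (k - 2) ≤ 2 ^ |k - 2| * (1 - t) ^ (k - 2) :=
        rpow_le_of_comparable (by linarith [ht'.2]) hp0.le (by norm_num)
          (by nlinarith [ht'.1, ht'.2]) (by nlinarith [ht'.1, ht'.2]) _
      have q0 := rpow_nonneg hp0.le (k - 2)
      have q3 := rpow_nonneg hp0.le (k - 1)
      have r1 : |g' t * (1 - t ^ 2) ^ (k - 1)| ≤ (1 - t ^ 2) ^ (k - 2) := by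
        rw [abs_mul, abs_of_nonneg q3]
        exact (mul_le_of_le_one_left q3 (hgb t ht').2).trans q1
      have r2 : |g t * ((-(2 * t)) * (k - 1) * (1 - t ^ 2) ^ (k - 1 - 1))| ≤
          2 * |k - 1| * (1 - t ^ 2) ^ (k - 2) := by
        rw [show k - 1 - 1 = k - 2 by ring, abs_mul, abs_mul, abs_mul, abs_of_nonneg q0, abs_neg,
          abs_of_nonneg (show 0 ≤ 2 * t by linarith [ht.1])]
        have : 2 * t * |k - 1| * (1 - t ^ 2) ^ (k - 2) ≤ 2 * |k - 1| * (1 - t ^ 2) ^ (k - 2) := by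
          gcongr
          linarith [ht'.2]
        refine le_trans (mul_le_of_le_one_left ?_ (hgb t ht').1) this
        have := ht.1
        positivity
      calc |w' t| ≤ _ := abs_add_le _ _
        _ ≤ (1 + 2 * |k - 1|) * (1 - t ^ 2) ^ (k - 2) := by linarith
        _ ≤ (1 + 2 * |k - 1|) * (2 ^ |k - 2| * (1 - t) ^ (k - 2)) := by gcongr
        _ = _ := by rw [hc2]; ring
    have hbd : ∀ t ∈ Set.Icc (0 : ℝ) (1 - τ), |w t * (gegenA n (2 * k) (b + a * t) / a)| ≤
        2 * EA * c1 * 2 * (n : ℝ) ^ (2 * k - 1) := by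
      intro t ht
      have ht0 : 0 < 1 - t := by linarith [ht.2]
      rw [abs_mul]
      calc |w t| * |gegenA n (2 * k) (b + a * t) / a|
          ≤ (c1 * (1 - t) ^ (k - 1)) * (2 * EA * (n : ℝ) ^ (2 * k - 2) * (1 - t) ^ p) :=
            mul_le_mul (hwb t ht) (hAb t ht) (abs_nonneg _) (by positivity)
        _ = 2 * EA * c1 * (n : ℝ) ^ (2 * k - 2) * ((1 - t) ^ (k - 1) * (1 - t) ^ p) := by ring
        _ = 2 * EA * c1 * (n : ℝ) ^ (2 * k - 2) * (1 - t) ^ (-(1 / 2) : ℝ) := by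
            rw [← rpow_add ht0]; congr 2; rw [hp]; ring
        _ ≤ 2 * EA * c1 * (n : ℝ) ^ (2 * k - 2) * (2 * n) := by
            gcongr
            refine le_trans ?_ hτn
            exact rpow_le_rpow_of_nonpos hτ0 (by linarith [ht.2]) (by norm_num)
        _ = _ := by rw [← hnn]; ring
    have hint : |∫ t in (0 : ℝ)..(1 - τ), w' t * (gegenA n (2 * k) (b + a * t) / a)| ≤
        2 * EA * c2 * 4 * (n : ℝ) ^ (2 * k - 1) := by
      have hj : IntervalIntegrable (fun t : ℝ => 2 * EA * c2 * (n : ℝ) ^ (2 * k - 2) *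
          (1 - t) ^ (-(3 / 2) : ℝ)) volume 0 (1 - τ) := by
        apply IntervalIntegrable.const_mul
        apply ContinuousOn.intervalIntegrable
        rw [Set.uIcc_of_le hT']
        exact ContinuousOn.rpow_const (by fun_prop) fun t ht => Or.inl (by
          have := ht.2; intro h0; linarith)
      have h1 := intervalIntegral.norm_integral_le_of_norm_le (a := 0) (b := 1 - τ) (μ := volume)
        (f := fun t => w' t * (gegenA n (2 * k) (b + a * t) / a)) hT'
        (Filter.Eventually.of_forall fun t ht => ?_) hj
      · rw [Real.norm_eq_abs] at h1
        refine h1.trans ?_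
        rw [intervalIntegral.integral_const_mul,
          intervalIntegral.integral_comp_sub_left (fun x : ℝ => x ^ (-(3 / 2) : ℝ)) 1, sub_sub_cancel,
          sub_zero, integral_rpow (Or.inr ⟨by norm_num, by
            rw [Set.uIcc_of_le hτ1]; intro h0; linarith [h0.1]⟩)]
        rw [show (-(3 / 2) : ℝ) + 1 = -(1 / 2) by norm_num, one_rpow]
        calc 2 * EA * c2 * (n : ℝ) ^ (2 * k - 2) * ((1 - τ ^ (-(1 / 2) : ℝ)) / -(1 / 2))
            = 2 * EA * c2 * (n : ℝ) ^ (2 * k - 2) * (2 * (τ ^ (-(1 / 2) : ℝ) - 1)) := by ring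
          _ ≤ 2 * EA * c2 * (n : ℝ) ^ (2 * k - 2) * (2 * (2 * n)) := by gcongr; linarith
          _ = _ := by rw [← hnn]; ring
      · have ht' : t ∈ Set.Icc (0 : ℝ) (1 - τ) := ⟨ht.1.le, ht.2⟩
        have ht0 : 0 < 1 - t := by linarith [ht.2]
        rw [norm_mul, Real.norm_eq_abs, Real.norm_eq_abs]
        calc |w' t| * |gegenA n (2 * k) (b + a * t) / a|
            ≤ (c2 * (1 - t) ^ (k - 2)) * (2 * EA * (n : ℝ) ^ (2 * k - 2) * (1 - t) ^ p) :=
              mul_le_mul (hw'b t ht') (hAb t ht') (abs_nonneg _) (by positivity)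
          _ = 2 * EA * c2 * (n : ℝ) ^ (2 * k - 2) * ((1 - t) ^ (k - 2) * (1 - t) ^ p) := by ring
          _ = _ := by rw [← rpow_add ht0]; congr 2; rw [hp]; ring
    refine (abs_sub _ _).trans ?_
    have a1 := hbd (1 - τ) ⟨hT', le_rfl⟩
    have a2 := hbd 0 ⟨le_rfl, hT'⟩
    have a3 := abs_sub (w (1 - τ) * (gegenA n (2 * k) (b + a * (1 - τ)) / a))
      (w 0 * (gegenA n (2 * k) (b + a * 0) / a))
    linarith
  refine (abs_add_le _ _).trans ?_
  rw [add_assoc, add_mul]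
  linarith

lemma gegen_segment_integral_bound {k : ℝ} (hk : 0 < k) : ∃ C : ℝ, 0 < C ∧ ∀ n : ℕ, 1 ≤ n →
    ∀ a b : ℝ, 1 / 2 ≤ a → |b| ≤ 1 - a → ∀ e : ℕ, e ≤ 1 →
    |∫ t in Set.Icc (-1 : ℝ) 1, gegenC n (2 * k) (b + a * t) * t ^ e * (1 - t ^ 2) ^ (k - 1)| ≤
      C * (n : ℝ) ^ (2 * k - 1) := by
  obtain ⟨C, hC, h⟩ := gegen_half_integral_bound hk
  have hl : 0 < 2 * k := by linarith
  refine ⟨2 * C, by positivity, fun n hn a b ha hb e he => ?_⟩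
  have hgg : ∃ g' : ℝ → ℝ, Continuous g' ∧ (∀ t, HasDerivAt (fun t : ℝ => t ^ e) (g' t) t) ∧
      ∀ t ∈ Set.Icc (0 : ℝ) 1, |t ^ e| ≤ 1 ∧ |g' t| ≤ 1 := by
    interval_cases e
    · exact ⟨fun _ => 0, continuous_const, fun t => by simpa using hasDerivAt_const t (1 : ℝ),
        fun t _ => by simp⟩
    · refine ⟨fun _ => 1, continuous_const, fun t => by simpa using hasDerivAt_id' t, fun t ht => ?_⟩
      simp only [pow_one, abs_one, le_refl, and_true]
      exact abs_le.2 ⟨by linarith [ht.1], ht.2⟩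
  obtain ⟨g', h1, h2, h3⟩ := hgg
  have key := fun b hb => h n hn a b ha hb _ g' h1 h2 h3
  rw [integral_Icc_eq_integral_Ioc, ← intervalIntegral.integral_of_le (by norm_num)]
  have hi : IntervalIntegrable
      (fun t => gegenC n (2 * k) (b + a * t) * t ^ e * (1 - t ^ 2) ^ (k - 1)) volume (-1) 1 :=
    (intervalIntegrable_jacobi hk).continuousOn_mul
      (((continuous_gegenC hl n).comp (by fun_prop : Continuous fun t : ℝ => b + a * t)).mul
        (continuous_pow e)).continuousOn
  have h0 : (0 : ℝ) ∈ Set.uIcc (-1 : ℝ) 1 := by rw [Set.uIcc_of_le (by norm_num)]; norm_num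
  rw [← intervalIntegral.integral_add_adjacent_intervals
    (hi.mono_set (Set.uIcc_subset_uIcc_left h0)) (hi.mono_set (Set.uIcc_subset_uIcc_right h0))]
  refine (abs_add_le _ _).trans ?_
  have e2 : |∫ t in (0 : ℝ)..1, gegenC n (2 * k) (b + a * t) * t ^ e * (1 - t ^ 2) ^ (k - 1)| ≤
      C * (n : ℝ) ^ (2 * k - 1) := by
    simp only [mul_assoc]
    exact key b hb
  have e1 : |∫ t in (-1 : ℝ)..0, gegenC n (2 * k) (b + a * t) * t ^ e * (1 - t ^ 2) ^ (k - 1)| ≤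
      C * (n : ℝ) ^ (2 * k - 1) := by
    have hn := intervalIntegral.integral_comp_neg (a := 0) (b := 1)
      (fun t => gegenC n (2 * k) (b + a * t) * t ^ e * (1 - t ^ 2) ^ (k - 1))
    rw [neg_zero] at hn
    rw [← hn]
    have hk2 := key (-b) (by rwa [abs_neg])
    have : ∫ t in (0 : ℝ)..1, gegenC n (2 * k) (b + a * -t) * (-t) ^ e * (1 - (-t) ^ 2) ^ (k - 1) =
        ((-1) ^ n * (-1) ^ e) * ∫ t in (0 : ℝ)..1,
          gegenC n (2 * k) (-b + a * t) * (t ^ e * (1 - t ^ 2) ^ (k - 1)) := by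
      rw [← intervalIntegral.integral_const_mul]
      congr 1
      ext t
      rw [show b + a * -t = -(-b + a * t) by ring, gegenC_neg hl, neg_pow t e, neg_sq]
      ring
    rw [this, abs_mul, abs_mul, abs_pow, abs_pow, abs_neg, abs_one, one_pow, one_pow, one_mul,
      one_mul]
    exact hk2
  linarith

lemma finTwoArrow_symm_preimage_cube :
    (MeasurableEquiv.finTwoArrow (α := ℝ)).symm ⁻¹' cube 2 =
      Set.Icc (-1 : ℝ) 1 ×ˢ Set.Icc (-1 : ℝ) 1 := by
  ext z
  rw [Set.mem_preimage, cube, Set.mem_univ_pi, Fin.forall_fin_two, Set.mem_prod]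
  rfl

lemma setIntegral_cube_two (f : (Fin 2 → ℝ) → ℝ) :
    ∫ t in cube 2, f t =
      ∫ z in Set.Icc (-1 : ℝ) 1 ×ˢ Set.Icc (-1 : ℝ) 1, f ![z.1, z.2] := by
  have h := (volume_preserving_finTwoArrow ℝ).symm
  have := h.setIntegral_preimage_emb (MeasurableEquiv.measurableEmbedding _) f (cube 2)
  rw [← this, finTwoArrow_symm_preimage_cube]
  rfl

lemma abs_setIntegral_prod_le {s t : Set ℝ} (ht : MeasurableSet t)
    {F : ℝ × ℝ → ℝ} (hF : IntegrableOn F (s ×ˢ t)) {w : ℝ → ℝ} (hw : IntegrableOn w t)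
    {M : ℝ} (h : ∀ y ∈ t, |∫ x in s, F (x, y)| ≤ M * w y) :
    |∫ z in s ×ˢ t, F z| ≤ M * ∫ y in t, w y := by
  rw [Measure.volume_eq_prod, ← Measure.prod_restrict, integral_prod_symm]
  · rw [← Real.norm_eq_abs, ← integral_const_mul]
    exact norm_integral_le_of_norm_le (hw.const_mul M)
      ((ae_restrict_iff' ht).2 (Filter.Eventually.of_forall h))
  · rwa [Measure.prod_restrict, ← Measure.volume_eq_prod]

lemma abs_setIntegral_prod_le' {s t : Set ℝ} (hs : MeasurableSet s)
    {F : ℝ × ℝ → ℝ} (hF : IntegrableOn F (s ×ˢ t)) {w : ℝ → ℝ} (hw : IntegrableOn w s)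
    {M : ℝ} (h : ∀ x ∈ s, |∫ y in t, F (x, y)| ≤ M * w x) :
    |∫ z in s ×ˢ t, F z| ≤ M * ∫ x in s, w x := by
  rw [Measure.volume_eq_prod, ← Measure.prod_restrict, integral_prod]
  · rw [← Real.norm_eq_abs, ← integral_const_mul]
    exact norm_integral_le_of_norm_le (hw.const_mul M)
      ((ae_restrict_iff' hs).2 (Filter.Eventually.of_forall h))
  · rwa [Measure.prod_restrict, ← Measure.volume_eq_prod]

lemma prod_fin_two_pow (S : Finset (Fin 2)) (t : Fin 2 → ℝ) :
    ∏ i ∈ S, t i = t 0 ^ (if 0 ∈ S then 1 else 0) * t 1 ^ (if 1 ∈ S then 1 else 0) := by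
  have : ∏ i ∈ S, t i = ∏ i, t i ^ (if i ∈ S then 1 else 0) := by
    rw [← prod_subset (subset_univ S) (f := fun i => t i ^ (if i ∈ S then 1 else 0))]
    · exact prod_congr rfl fun i hi => by simp [hi]
    · intro i _ hi; simp [hi]
  rw [this, Fin.prod_univ_two]

lemma diagonal_bound_two {k : ℝ} (hk : 0 < k) :
    ∃ C : ℝ, 0 < C ∧ ∀ n : ℕ, 1 ≤ n → ∀ v : Fin 2 → ℝ, (∀ i, 0 ≤ v i) → ∑ i, v i = 1 →
      ∀ S : Finset (Fin 2),
        |∫ t in cube 2, gegenC n (2 * k) (∑ i, v i * t i) * (∏ i ∈ S, t i) * jacW (fun _ => k) t| ≤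
          C * (n : ℝ) ^ (2 * k - 1) := by
  obtain ⟨C, hC, h⟩ := gegen_segment_integral_bound hk
  have hl : 0 < 2 * k := by linarith
  set E : ℝ := ∫ s in Set.Icc (-1 : ℝ) 1, (1 - s ^ 2) ^ (k - 1) with hE
  have hw0 : ∀ s ∈ Set.Icc (-1 : ℝ) 1, 0 ≤ (1 - s ^ 2) ^ (k - 1) := fun s hs =>
    rpow_nonneg (by nlinarith [hs.1, hs.2]) _
  have hE0 : 0 ≤ E := setIntegral_nonneg measurableSet_Icc hw0
  refine ⟨C * (1 + E), by positivity, fun n hn v hv hs S => ?_⟩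
  have hn0 : (0 : ℝ) < n := by exact_mod_cast hn
  have hint : IntegrableOn (fun t : Fin 2 → ℝ =>
      gegenC n (2 * k) (∑ i, v i * t i) * (∏ i ∈ S, t i) * jacW (fun _ => k) t) (cube 2) :=
    integrableOn_mul_jacW (κ := fun _ => k) (fun _ => hk)
      (((continuous_gegenC hl n).comp (by fun_prop)).mul (by fun_prop))
  have hint2 : IntegrableOn (fun z : ℝ × ℝ => gegenC n (2 * k) (v 0 * z.1 + v 1 * z.2) *
      (z.1 ^ (if (0 : Fin 2) ∈ S then 1 else 0) * z.2 ^ (if (1 : Fin 2) ∈ S then 1 else 0)) *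
      ((1 - z.1 ^ 2) ^ (k - 1) * (1 - z.2 ^ 2) ^ (k - 1)))
      (Set.Icc (-1 : ℝ) 1 ×ˢ Set.Icc (-1 : ℝ) 1) := by
    have h := (volume_preserving_finTwoArrow ℝ).symm
    have := (h.integrableOn_comp_preimage (MeasurableEquiv.measurableEmbedding _)).2 hint
    rw [finTwoArrow_symm_preimage_cube] at this
    convert this using 1
    ext z
    simp [MeasurableEquiv.finTwoArrow, prod_fin_two_pow, jacW, Fin.prod_univ_two]
  rw [setIntegral_cube_two]
  simp only [prod_fin_two_pow, jacW, Fin.prod_univ_two, Fin.sum_univ_two, Matrix.cons_val_zero,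
    Matrix.cons_val_one, Matrix.cons_val_fin_one]
  rw [Fin.sum_univ_two] at hs
  set e0 : ℕ := if (0 : Fin 2) ∈ S then 1 else 0 with he0
  set e1 : ℕ := if (1 : Fin 2) ∈ S then 1 else 0 with he1
  have he0' : e0 ≤ 1 := by rw [he0]; split_ifs <;> norm_num
  have he1' : e1 ≤ 1 := by rw [he1]; split_ifs <;> norm_num
  have hfin : C * (n : ℝ) ^ (2 * k - 1) * E ≤ C * (1 + E) * (n : ℝ) ^ (2 * k - 1) := by
    have : 0 ≤ C * (n : ℝ) ^ (2 * k - 1) := by positivity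
    nlinarith
  have habs : ∀ y ∈ Set.Icc (-1 : ℝ) 1, ∀ e : ℕ, |y ^ e * (1 - y ^ 2) ^ (k - 1)| ≤
      (1 - y ^ 2) ^ (k - 1) := fun y hy e => by
    rw [abs_mul, abs_of_nonneg (hw0 y hy), abs_pow]
    exact mul_le_of_le_one_left (hw0 y hy) (pow_le_one₀ (abs_nonneg _) (abs_le.2 hy))
  have hbd : ∀ u w : ℝ, 0 ≤ w → u + w = 1 → 1 / 2 ≤ u → ∀ y ∈ Set.Icc (-1 : ℝ) 1, ∀ e e' : ℕ, e ≤ 1 →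
      |(∫ x in Set.Icc (-1 : ℝ) 1, gegenC n (2 * k) (w * y + u * x) * x ^ e * (1 - x ^ 2) ^ (k - 1)) *
        (y ^ e' * (1 - y ^ 2) ^ (k - 1))| ≤
        C * (n : ℝ) ^ (2 * k - 1) * (1 - y ^ 2) ^ (k - 1) := by
    intro u w hw0' huw hu y hy e e' he
    rw [abs_mul]
    refine mul_le_mul (h n hn u (w * y) hu ?_ e he) (habs y hy e') (abs_nonneg _) (by positivity)
    rw [abs_mul, abs_of_nonneg hw0', ← huw, add_sub_cancel_left]
    exact mul_le_of_le_one_right hw0' (abs_le.2 hy)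
  rcases le_total (1 / 2) (v 0) with h0 | h0
  · refine le_trans (abs_setIntegral_prod_le measurableSet_Icc hint2
      (integrableOn_jacobi hk) (M := C * (n : ℝ) ^ (2 * k - 1)) fun y hy => ?_) hfin
    refine le_trans (le_of_eq ?_) (hbd (v 0) (v 1) (hv 1) hs h0 y hy e0 e1 he0')
    rw [← integral_mul_const]
    congr 2
    ext x
    rw [add_comm (v 1 * y)]
    ring
  · refine le_trans (abs_setIntegral_prod_le' measurableSet_Icc hint2
      (integrableOn_jacobi hk) (M := C * (n : ℝ) ^ (2 * k - 1)) fun y hy => ?_) hfin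
    refine le_trans (le_of_eq ?_) (hbd (v 1) (v 0) (hv 0) (by linarith) (by linarith) y hy e1 e0 he1')
    rw [← integral_mul_const]
    congr 2
    ext x
    ring

/-- The diagonal bound: the zonal integrals attached to a probability vector have size at most
`n ^ (2σ - 1)`. -/
lemma diagonal_bound {d : ℕ} (hd : 1 ≤ d) {κ : Fin (d + 1) → ℝ} (hκ : ∀ i, 0 < κ i) :
    ∃ C : ℝ, 0 < C ∧ ∀ n : ℕ, 1 ≤ n → ∀ v : Fin (d + 1) → ℝ, (∀ i, 0 ≤ v i) → ∑ i, v i = 1 →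
      ∀ S : Finset (Fin (d + 1)),
        |∫ t in cube (d + 1), gegenC n (lamK d κ) (∑ i, v i * t i) * (∏ i ∈ S, t i) * jacW κ t| ≤
          C * (n : ℝ) ^ (2 * sigmaK d κ - 1) := by
  obtain ⟨j, -, hj⟩ := exists_mem_eq_inf' univ_nonempty κ
  have hmin : ∀ i, κ j ≤ κ i := fun i => hj ▸ inf'_le _ (mem_univ i)
  have hσ : 2 * sigmaK d κ - 1 = 2 * lamK d κ - 1 - 2 * κ j := by
    rw [sigmaK, lamK, hj]; ring
  rw [hσ]
  by_cases hlt : 2 * κ j < lamK d κ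
  · exact diagonal_bound_of_lt (hκ j) hmin hlt
  have hsum : ∑ i : Fin (d + 1), κ j ≤ ∑ i, κ i := sum_le_sum fun i _ => hmin i
  rw [sum_const, card_univ, Fintype.card_fin, nsmul_eq_mul] at hsum
  push_cast at hsum
  have hd1 : (1 : ℝ) ≤ d := by exact_mod_cast hd
  have hle : lamK d κ ≤ 2 * κ j := not_lt.1 hlt
  have hd' : d = 1 := by
    by_contra hne
    have : (2 : ℝ) ≤ d := by exact_mod_cast (show 2 ≤ d by omega)
    rw [lamK] at hle
    nlinarith [hκ j]
  subst hd'
  have hk : κ = fun _ => κ j := by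
    ext i
    refine le_antisymm ?_ (hmin i)
    rw [lamK] at hle
    push_cast at hle
    have h2 : ∑ i, κ i ≤ ∑ i : Fin 2, κ j := by
      simp only [sum_const, card_univ, Fintype.card_fin, nsmul_eq_mul]; push_cast; linarith
    have h3 : ∀ i ∈ univ, κ j ≤ κ i := fun i _ => hmin i
    have := (sum_eq_sum_iff_of_le h3).1 (le_antisymm (sum_le_sum h3) h2)
    exact (this i (mem_univ i)).ge
  have hlam : lamK 1 κ = 2 * κ j := by
    rw [lamK, hk]; simp
  rw [hlam, show 2 * (2 * κ j) - 1 - 2 * κ j = 2 * κ j - 1 by ring]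
  rw [hk]
  exact diagonal_bound_two (hκ j)

/-- `1 / (r - p)!`, understood as `0` when `r < p`. -/
noncomputable def invFact (r p : ℕ) : ℝ := if p ≤ r then 1 / ((r - p).factorial : ℝ) else 0

lemma ascPochhammer_eval_eq_poch (a : ℝ) (n : ℕ) : (ascPochhammer ℝ n).eval a = poch a n := by
  induction n with
  | zero => simp [poch]
  | succ n ih => rw [ascPochhammer_succ_eval, ih, poch_succ]

lemma poch_eq_factorial_mul_ringChoose (a : ℝ) (n : ℕ) :
    poch a n = n.factorial * Ring.choose (a + n - 1) n := by
  rw [Ring.choose, ← ascPochhammer_eval_eq_poch, ← Polynomial.ascPochhammer_smeval_eq_eval,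
    ← Ring.factorial_nsmul_multichoose_eq_ascPochhammer, nsmul_eq_mul]
  congr 2
  ring

lemma choose_eq_invFact (r p : ℕ) :
    ((r.choose p : ℕ) : ℝ) = r.factorial / p.factorial * invFact r p := by
  rw [invFact]
  split_ifs with h
  · rw [Nat.cast_choose ℝ h]
    field_simp
  · rw [Nat.choose_eq_zero_of_lt (not_le.1 h)]
    simp

lemma poch_add_div {a : ℝ} (ha : 0 < a) {r s K : ℕ} (hK : s ≤ K) :
    poch a (r + s) / (r.factorial * poch a r * (s.factorial * poch a s)) =
      ∑ p ∈ range (K + 1), invFact r p * invFact s p / (p.factorial * poch a p) := by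
  have hfull : poch (a + r) s = s.factorial *
      ∑ p ∈ range (s + 1), (r.choose p : ℝ) * (poch (a + p) (s - p) / (s - p).factorial) := by
    rw [poch_eq_factorial_mul_ringChoose,
      show a + r + s - 1 = (r : ℝ) + (a + s - 1) by ring, Ring.add_choose_eq _ (Commute.all _ _),
      Finset.Nat.sum_antidiagonal_eq_sum_range_succ
        (fun i j => Ring.choose (r : ℝ) i * Ring.choose (a + s - 1) j)]
    congr 1
    refine sum_congr rfl fun p hp => ?_
    have hps : p ≤ s := by simpa [Nat.lt_succ_iff] using hp
    rw [Ring.choose_natCast, poch_eq_factorial_mul_ringChoose, Nat.cast_sub hps,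
      show a + p + ((s : ℝ) - p) - 1 = a + s - 1 by ring,
      mul_div_cancel_left₀ _ (by positivity)]
  have hsub : range (s + 1) ⊆ range (K + 1) := range_subset_range.2 (by omega)
  rw [← sum_subset hsub fun p _ hp => by
    have : ¬ p ≤ s := by simpa [Nat.lt_succ_iff] using hp
    simp [invFact, this]]
  rw [poch_add, hfull]
  have har := (poch_pos ha r).ne'
  have has := (poch_pos ha s).ne'
  rw [show poch a r * ((s.factorial : ℝ) * ∑ p ∈ range (s + 1),
      (r.choose p : ℝ) * (poch (a + p) (s - p) / (s - p).factorial)) /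
      (r.factorial * poch a r * (s.factorial * poch a s)) =
      (∑ p ∈ range (s + 1), (r.choose p : ℝ) * (poch (a + p) (s - p) / (s - p).factorial)) *
        (1 / (r.factorial * poch a s)) by field_simp, sum_mul]
  refine sum_congr rfl fun p hp => ?_
  have hps : p ≤ s := by simpa [Nat.lt_succ_iff] using hp
  have h2 : poch a s = poch a p * poch (a + p) (s - p) := by
    rw [← poch_add, Nat.add_sub_cancel' hps]
  have hap := (poch_pos ha p).ne'
  have hap' := (poch_pos (show 0 < a + p by positivity) (s - p)).ne'
  rw [choose_eq_invFact, h2, invFact, invFact, if_pos hps]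
  field_simp

lemma multinomial_div {ι : Type*} (s : Finset ι) (r : ι → ℕ) :
    ((Nat.multinomial s r : ℕ) : ℝ) = (∑ i ∈ s, r i).factorial / ∏ i ∈ s, ((r i).factorial : ℝ) := by
  rw [eq_div_iff (prod_ne_zero_iff.2 fun i _ => by positivity), mul_comm]
  exact_mod_cast Nat.multinomial_spec s r

section Zonal
variable {ι : Type*} [Fintype ι] [DecidableEq ι]

lemma mem_piAntidiag_univ {r : ι → ℕ} {k : ℕ} : r ∈ piAntidiag univ k ↔ ∑ i, r i = k := by
  simp [mem_piAntidiag]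

lemma sum_piAntidiag_prod_pow_div (u : ι → ℝ) (k : ℕ) :
    ∑ r ∈ piAntidiag univ k, ∏ i, (u i ^ r i / (r i).factorial) = (∑ i, u i) ^ k / k.factorial := by
  rw [sum_pow_eq_sum_piAntidiag, sum_div]
  refine sum_congr rfl fun r hr => ?_
  rw [multinomial_div, mem_piAntidiag_univ.1 hr, prod_div_distrib]
  field_simp

lemma sum_piAntidiag_shift (u : ι → ℝ) (k : ℕ) (p : ι → ℕ) :
    ∑ r ∈ piAntidiag univ k, ∏ i, (invFact (r i) (p i) * u i ^ (r i - p i)) =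
      invFact k (∑ i, p i) * (∑ i, u i) ^ (k - ∑ i, p i) := by
  by_cases h : ∑ i, p i ≤ k
  · rw [invFact, if_pos h, one_div_mul_eq_div, ← sum_piAntidiag_prod_pow_div]
    symm
    refine sum_of_injOn (fun r => r + p) (fun r _ s _ hrs => add_right_cancel hrs) ?_ ?_ ?_
    · intro r hr
      simp only [mem_coe, mem_piAntidiag_univ, Pi.add_apply, sum_add_distrib] at hr ⊢
      omega
    · intro r hr hr'
      by_contra hne
      have hle : ∀ i, p i ≤ r i := by
        intro i
        by_contra hlt
        exact hne (prod_eq_zero (mem_univ i) (by simp [invFact, hlt]))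
      refine hr' ⟨r - p, ?_, ?_⟩
      · have hadd : ∑ i, (r i - p i) + ∑ i, p i = ∑ i, r i := by
          rw [← sum_add_distrib]
          exact sum_congr rfl fun i _ => Nat.sub_add_cancel (hle i)
        simp only [mem_coe, mem_piAntidiag_univ, Pi.sub_apply] at hr ⊢
        omega
      · funext i
        exact Nat.sub_add_cancel (hle i)
    · intro r _
      refine prod_congr rfl fun i _ => ?_
      simp only [Pi.add_apply, invFact, Nat.le_add_left, if_true, Nat.add_sub_cancel]
      ring
  · rw [invFact, if_neg h, zero_mul]
    refine sum_eq_zero fun r hr => ?_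
    obtain ⟨i, -, hi⟩ : ∃ i ∈ univ, r i < p i := by
      apply exists_lt_of_sum_lt
      rw [mem_piAntidiag_univ.1 hr]
      omega
    exact prod_eq_zero (mem_univ i) (by simp [invFact, not_le.2 hi])

/-- The homogeneous zonal polynomial of degree `k`. -/
noncomputable def zon (θ : ι → ℝ) (k : ℕ) (w : ι → ℝ) : ℝ :=
  ∑ r ∈ piAntidiag univ k, ∏ i, w i ^ r i / ((r i).factorial * poch (θ i) (r i))

lemma sum_piAntidiag_range {k : ℕ} (f : ℕ → (ι → ℕ) → ℝ) :
    ∑ p ∈ Fintype.piFinset fun _ : ι => range (k + 1),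
      (if ∑ i, p i ≤ k then f (∑ i, p i) p else 0) =
      ∑ q ∈ range (k + 1), ∑ p ∈ piAntidiag univ q, f q p := by
  rw [← sum_filter, ← sum_fiberwise_of_maps_to (t := range (k + 1)) (g := fun p : ι → ℕ => ∑ i, p i)
    (fun p hp => by simpa [Nat.lt_succ_iff] using (mem_filter.1 hp).2)]
  refine sum_congr rfl fun q hq => ?_
  have hqk : q ≤ k := by simpa [Nat.lt_succ_iff] using hq
  refine sum_congr ?_ fun p hp => by rw [mem_piAntidiag_univ.1 hp]
  ext p
  simp only [mem_filter, Fintype.mem_piFinset, mem_range, mem_piAntidiag_univ]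
  constructor
  · exact fun h => h.2
  · intro h
    refine ⟨⟨fun i => ?_, by omega⟩, h⟩
    have := single_le_sum (f := p) (fun i _ => Nat.zero_le _) (mem_univ i)
    omega

lemma sum_zonal_mul {θ : ι → ℝ} (hθ : ∀ i, 0 < θ i) (u w : ι → ℝ) (k j : ℕ) :
    ∑ r ∈ piAntidiag univ k, ∑ s ∈ piAntidiag univ j,
      ∏ i, (u i ^ r i / ((r i).factorial * poch (θ i) (r i)) *
        (w i ^ s i / ((s i).factorial * poch (θ i) (s i))) * poch (θ i) (r i + s i)) =
      ∑ q ∈ range (j + 1), invFact k q * invFact j q * (∑ i, u i) ^ (k - q) * (∑ i, w i) ^ (j - q) *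
        zon θ q (fun i => u i * w i) := by
  have h1 : ∀ r ∈ piAntidiag (univ : Finset ι) k, ∀ s ∈ piAntidiag (univ : Finset ι) j,
      ∏ i, (u i ^ r i / ((r i).factorial * poch (θ i) (r i)) *
        (w i ^ s i / ((s i).factorial * poch (θ i) (s i))) * poch (θ i) (r i + s i)) =
      ∑ p ∈ Fintype.piFinset fun _ : ι => range (j + 1),
        (∏ i, (invFact (r i) (p i) * u i ^ (r i - p i))) *
          (∏ i, (invFact (s i) (p i) * w i ^ (s i - p i))) *
          ∏ i, (u i * w i) ^ p i / ((p i).factorial * poch (θ i) (p i)) := by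
    intro r hr s hs
    simp only [← prod_mul_distrib]
    rw [← prod_univ_sum (fun _ => range (j + 1)) fun i p =>
      invFact (r i) p * u i ^ (r i - p) * (invFact (s i) p * w i ^ (s i - p)) *
        ((u i * w i) ^ p / (p.factorial * poch (θ i) p))]
    refine prod_congr rfl fun i _ => ?_
    have hsi : s i ≤ j := by
      rw [← mem_piAntidiag_univ.1 hs]
      exact single_le_sum (f := s) (fun i _ => Nat.zero_le _) (mem_univ i)
    calc _ = u i ^ r i * w i ^ s i * (poch (θ i) (r i + s i) /
            ((r i).factorial * poch (θ i) (r i) * ((s i).factorial * poch (θ i) (s i)))) := by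
          have := (poch_pos (hθ i) (r i)).ne'
          have := (poch_pos (hθ i) (s i)).ne'
          field_simp
      _ = _ := by
          rw [poch_add_div (hθ i) hsi, mul_sum]
          refine sum_congr rfl fun p _ => ?_
          by_cases hpr : p ≤ r i
          · by_cases hps : p ≤ s i
            · rw [← Nat.sub_add_cancel hpr, ← Nat.sub_add_cancel hps, pow_add, pow_add,
                Nat.sub_add_cancel hpr, Nat.sub_add_cancel hps, mul_pow]
              ring
            · simp [invFact, hps]
          · simp [invFact, hpr]
  rw [sum_congr rfl fun r hr => sum_congr rfl fun s hs => h1 r hr s hs]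
  rw [sum_congr rfl fun r _ => sum_comm, sum_comm]
  have h2 : ∀ p ∈ Fintype.piFinset fun _ : ι => range (j + 1),
      ∑ r ∈ piAntidiag univ k, ∑ s ∈ piAntidiag univ j,
        (∏ i, (invFact (r i) (p i) * u i ^ (r i - p i))) *
          (∏ i, (invFact (s i) (p i) * w i ^ (s i - p i))) *
          ∏ i, (u i * w i) ^ p i / ((p i).factorial * poch (θ i) (p i)) =
      if ∑ i, p i ≤ j then (fun q (p : ι → ℕ) => invFact k q * invFact j q * (∑ i, u i) ^ (k - q) *
        (∑ i, w i) ^ (j - q) * ∏ i, (u i * w i) ^ p i / ((p i).factorial * poch (θ i) (p i)))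
          (∑ i, p i) p else 0 := by
    intro p _
    simp only [← sum_mul, ← mul_sum]
    rw [sum_piAntidiag_shift, sum_piAntidiag_shift]
    split_ifs with h
    · ring
    · simp [invFact, h]
  rw [sum_congr rfl h2, sum_piAntidiag_range fun q (p : ι → ℕ) => invFact k q * invFact j q *
    (∑ i, u i) ^ (k - q) * (∑ i, w i) ^ (j - q) *
      ∏ i, (u i * w i) ^ p i / ((p i).factorial * poch (θ i) (p i))]
  simp only [zon, mul_sum]
end Zonal

/-- The Pochhammer symbol as a polynomial in a shift of its base. -/
lemma poch_eq_eval (a : ℝ) (N : ℕ) (x : ℝ) :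
    poch (a + x) N = ((ascPochhammer ℝ N).comp (Polynomial.X + Polynomial.C a)).eval x := by
  rw [Polynomial.eval_comp, ascPochhammer_eval_eq_poch]
  simp [add_comm]

lemma sum_neg_one_pow_mul_poch (a : ℝ) {N M : ℕ} (h : N < M) :
    ∑ i ∈ range (M + 1), (-1 : ℝ) ^ (M - i) / ((M - i).factorial * i.factorial) * poch (a + i) N = 0 := by
  have hdeg : ((ascPochhammer ℝ N).comp (Polynomial.X + Polynomial.C a)).natDegree < M := by
    rw [Polynomial.natDegree_comp, Polynomial.natDegree_X_add_C, ascPochhammer_natDegree, mul_one]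
    exact h
  have h1 := congrFun (Polynomial.fwdDiff_iter_eq_zero_of_degree_lt hdeg) 0
  rw [fwdDiff_iter_eq_sum_shift] at h1
  simp only [Pi.zero_apply, zero_add, nsmul_one, ← poch_eq_eval] at h1
  have h2 : ∑ i ∈ range (M + 1), (-1 : ℝ) ^ (M - i) / ((M - i).factorial * i.factorial) *
      poch (a + i) N = (∑ i ∈ range (M + 1),
        ((-1 : ℤ) ^ (M - i) * (M.choose i : ℤ)) • poch (a + i) N) / M.factorial := by
    rw [sum_div]
    refine sum_congr rfl fun i hi => ?_
    have hi' : i ≤ M := by simpa [Nat.lt_succ_iff] using hi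
    rw [zsmul_eq_mul]
    push_cast
    rw [Nat.cast_choose ℝ hi']
    field_simp
  rw [h2, h1, zero_div]

lemma fwdDiff_iter_inv (M : ℕ) {x : ℝ} (hx : 0 < x) :
    (fwdDiff 1)^[M] (fun y : ℝ => 1 / y) x = (-1) ^ M * M.factorial / poch x (M + 1) := by
  induction M generalizing x with
  | zero => simp [poch]
  | succ M ih =>
    rw [Function.iterate_succ_apply', fwdDiff, ih hx, ih (by positivity)]
    have h1 : poch x (M + 1 + 1) = poch x (M + 1) * (x + (M + 1 : ℕ)) := poch_succ x (M + 1)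
    have h2 : poch x (M + 1 + 1) = x * poch (x + 1) (M + 1) := poch_succ' x (M + 1)
    have p0 := (poch_pos hx (M + 1 + 1)).ne'
    have p1 := (poch_pos hx (M + 1)).ne'
    have p2 := (poch_pos (show 0 < x + 1 by positivity) (M + 1)).ne'
    have e1 : 1 / poch x (M + 1) = (x + (M + 1 : ℕ)) / poch x (M + 1 + 1) := by
      rw [div_eq_div_iff p1 p0, h1]; ring
    have e2 : 1 / poch (x + 1) (M + 1) = x / poch x (M + 1 + 1) := by
      rw [div_eq_div_iff p2 p0, h2]; ring
    rw [div_eq_mul_one_div _ (poch (x + 1) (M + 1)), div_eq_mul_one_div _ (poch x (M + 1)), e1, e2,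
      Nat.factorial_succ]
    push_cast
    ring

lemma sum_neg_one_pow_div_add {x : ℝ} (hx : 0 < x) (M : ℕ) :
    ∑ i ∈ range (M + 1), (-1 : ℝ) ^ (M - i) / ((M - i).factorial * i.factorial) * (1 / (x + i)) =
      (-1) ^ M / poch x (M + 1) := by
  have h1 := fwdDiff_iter_inv M hx
  rw [fwdDiff_iter_eq_sum_shift] at h1
  simp only [nsmul_one] at h1
  have h2 : ∑ i ∈ range (M + 1), (-1 : ℝ) ^ (M - i) / ((M - i).factorial * i.factorial) *
      (1 / (x + i)) = (∑ i ∈ range (M + 1),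
        ((-1 : ℤ) ^ (M - i) * (M.choose i : ℤ)) • (1 / (x + i))) / M.factorial := by
    rw [sum_div]
    refine sum_congr rfl fun i hi => ?_
    have hi' : i ≤ M := by simpa [Nat.lt_succ_iff] using hi
    rw [zsmul_eq_mul]
    push_cast
    rw [Nat.cast_choose ℝ hi']
    field_simp
  rw [h2, h1]
  field_simp

/-- The coefficients of the radial Jacobi polynomial in the zonal expansion. -/
noncomputable def zonCoeff (l : ℝ) (m k : ℕ) : ℝ :=
  (-1) ^ (m - k) * poch l (m + k) / (m - k).factorial

lemma zonCoeff_inner {l : ℝ} (hl : 0 < l) {m k q : ℕ} (hqk : q ≤ k) (hkm : k ≤ m) :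
    ∑ j ∈ range (m + 1), zonCoeff l m j * invFact j q / poch (l + 1) (k + j) =
      if k = m then l * (-1) ^ (m - q) / poch (l + m + q) (m - q + 1) else 0 := by
  obtain ⟨k, rfl⟩ := Nat.exists_eq_add_of_le hqk
  obtain ⟨M, rfl⟩ : ∃ M, m = q + M := Nat.exists_eq_add_of_le (hqk.trans hkm)
  have hkM : k ≤ M := by omega
  have hsplit : ∑ j ∈ range (q + M + 1), zonCoeff l (q + M) j * invFact j q /
      poch (l + 1) (q + k + j) = ∑ i ∈ range (M + 1),
        (-1 : ℝ) ^ (M - i) / ((M - i).factorial * i.factorial) *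
          (poch l (q + M + (q + i)) / poch (l + 1) (q + k + (q + i))) := by
    rw [show q + M + 1 = q + (M + 1) by ring, sum_range_add, sum_eq_zero, zero_add]
    · refine sum_congr rfl fun i hi => ?_
      rw [zonCoeff, invFact, if_pos (Nat.le_add_right _ _), Nat.add_sub_cancel_left,
        Nat.add_sub_add_left]
      field_simp
    · intro j hj
      have : ¬ q ≤ j := by simpa using hj
      simp [invFact, this]
  rw [hsplit]
  have h1 : (0 : ℝ) < l + 1 := by linarith
  split_ifs with h
  · have hk : k = M := by omega
    subst hk
    rw [Nat.add_sub_cancel_left, mul_div_assoc,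
      ← sum_neg_one_pow_div_add (show 0 < l + ((q + k : ℕ) : ℝ) + q by positivity), mul_sum]
    refine sum_congr rfl fun i _ => ?_
    have e1 : poch l (q + k + (q + i)) * (l + (q + k + (q + i) : ℕ)) =
        l * poch (l + 1) (q + k + (q + i)) := by rw [← poch_succ, ← poch_succ']
    have p1 := (poch_pos h1 (q + k + (q + i))).ne'
    have e2 : poch l (q + k + (q + i)) / poch (l + 1) (q + k + (q + i)) =
        l * (1 / (l + ((q + k : ℕ) : ℝ) + q + i)) := by
      rw [mul_one_div, div_eq_div_iff p1 (by positivity), ← e1]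
      push_cast
      ring
    rw [e2]
    ring
  · have hk : k < M := by omega
    obtain ⟨N, rfl⟩ : ∃ N, M = k + N + 1 := ⟨M - k - 1, by omega⟩
    have e2 : ∀ i : ℕ, poch l (q + (k + N + 1) + (q + i)) / poch (l + 1) (q + k + (q + i)) =
        l * poch (l + 1 + (q + k + q : ℕ) + i) N := by
      intro i
      have p1 := (poch_pos h1 (q + k + (q + i))).ne'
      rw [div_eq_iff p1, show q + (k + N + 1) + (q + i) = (q + k + (q + i) + N) + 1 by ring, poch_succ',
        poch_add, show l + 1 + ((q + k + (q + i) : ℕ) : ℝ) = l + 1 + (q + k + q : ℕ) + i by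
          push_cast; ring]
      ring
    simp only [e2]
    have := sum_neg_one_pow_mul_poch (l + 1 + (q + k + q : ℕ)) (show N < k + N + 1 by omega)
    calc _ = l * ∑ i ∈ range (k + N + 1 + 1), (-1 : ℝ) ^ (k + N + 1 - i) /
          ((k + N + 1 - i).factorial * i.factorial) * poch (l + 1 + (q + k + q : ℕ) + i) N := by
          rw [mul_sum]; exact sum_congr rfl fun i _ => by ring
      _ = 0 := by rw [this, mul_zero]

/-- Orthogonality of the zonal coefficients. -/
lemma zonCoeff_convolution {l : ℝ} (hl : 0 < l) {m q : ℕ} (hq : q ≤ m) :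
    ∑ k ∈ range (m + 1), ∑ j ∈ range (m + 1),
      zonCoeff l m k * zonCoeff l m j * (invFact k q * invFact j q) / poch (l + 1) (k + j) =
      l / (l + 2 * m) * zonCoeff l m q := by
  have h1 : ∀ k ∈ range (m + 1), ∑ j ∈ range (m + 1),
      zonCoeff l m k * zonCoeff l m j * (invFact k q * invFact j q) / poch (l + 1) (k + j) =
      if k = m then zonCoeff l m m * invFact m q *
        (l * (-1) ^ (m - q) / poch (l + m + q) (m - q + 1)) else 0 := by
    intro k hk
    have hkm : k ≤ m := by simpa [Nat.lt_succ_iff] using hk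
    have h2 : ∑ j ∈ range (m + 1),
        zonCoeff l m k * zonCoeff l m j * (invFact k q * invFact j q) / poch (l + 1) (k + j) =
        zonCoeff l m k * invFact k q *
          ∑ j ∈ range (m + 1), zonCoeff l m j * invFact j q / poch (l + 1) (k + j) := by
      rw [mul_sum]; exact sum_congr rfl fun j _ => by ring
    rw [h2]
    by_cases hqk : q ≤ k
    · rw [zonCoeff_inner hl hqk hkm]
      split_ifs with h
      · rw [h]
      · ring
    · rw [if_neg (by omega)]
      simp [invFact, hqk]
  rw [sum_congr rfl h1, sum_ite_eq' (range (m + 1)) m, if_pos (by simp), zonCoeff, zonCoeff, invFact,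
    if_pos hq, Nat.sub_self]
  have e1 : poch l (m + m) * (l + (m + m : ℕ)) = poch l (m + q) * poch (l + m + q) (m - q + 1) := by
    rw [← poch_succ, show m + m + 1 = (m + q) + (m - q + 1) by omega, poch_add]
    push_cast
    rw [add_assoc]
  have p1 : poch (l + m + q) (m - q + 1) ≠ 0 := (poch_pos (by positivity) _).ne'
  have p2 : l + 2 * (m : ℝ) ≠ 0 := by positivity
  push_cast at e1
  generalize poch (l + m + q) (m - q + 1) = P at *
  simp only [pow_zero, Nat.factorial_zero, Nat.cast_one, div_one, one_mul]
  field_simp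
  linear_combination e1

lemma integral_pow_mul_jacobi_odd {q : ℝ} {a : ℕ} (ha : Odd a) :
    ∫ t in (-1 : ℝ)..1, t ^ a * (1 - t ^ 2) ^ (q - 1) = 0 := by
  have h := intervalIntegral.integral_comp_neg (a := -1) (b := 1)
    (fun t : ℝ => t ^ a * (1 - t ^ 2) ^ (q - 1))
  simp only [neg_neg, ha.neg_pow, neg_sq, neg_mul, intervalIntegral.integral_neg] at h
  linarith

lemma intervalIntegrable_pow_mul_jacobi {q : ℝ} (hq : 0 < q) (a : ℕ) :
    IntervalIntegrable (fun t : ℝ => t ^ a * (1 - t ^ 2) ^ (q - 1)) volume (-1) 1 :=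
  (intervalIntegrable_jacobi hq).continuousOn_mul (continuous_pow a).continuousOn

lemma integral_pow_mul_jacobi_succ {q : ℝ} (hq : 0 < q) (a : ℕ) :
    (2 * a + 1 + 2 * q) * ∫ t in (-1 : ℝ)..1, t ^ (2 * (a + 1)) * (1 - t ^ 2) ^ (q - 1) =
      (2 * a + 1) * ∫ t in (-1 : ℝ)..1, t ^ (2 * a) * (1 - t ^ 2) ^ (q - 1) := by
  have hi := ((intervalIntegrable_pow_mul_jacobi hq (2 * a)).const_mul (2 * (a : ℝ) + 1)).sub
    ((intervalIntegrable_pow_mul_jacobi hq (2 * (a + 1))).const_mul (2 * (a : ℝ) + 1 + 2 * q))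
  have h := intervalIntegral.integral_eq_sub_of_hasDerivAt_of_le (a := -1) (b := 1)
    (f := fun t : ℝ => t ^ (2 * a + 1) * (1 - t ^ 2) ^ q) (by norm_num)
    (ContinuousOn.mul (by fun_prop) (ContinuousOn.rpow_const (by fun_prop) fun t _ => Or.inr hq.le))
    (fun t ht => ?_) hi
  · rw [intervalIntegral.integral_sub
      ((intervalIntegrable_pow_mul_jacobi hq (2 * a)).const_mul _)
      ((intervalIntegrable_pow_mul_jacobi hq (2 * (a + 1))).const_mul _),
      intervalIntegral.integral_const_mul, intervalIntegral.integral_const_mul] at h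
    norm_num [zero_rpow hq.ne'] at h
    linarith
  · have hpos : 0 < 1 - t ^ 2 := by nlinarith [ht.1, ht.2]
    have h1 : HasDerivAt (fun t : ℝ => 1 - t ^ 2) (-(2 * t)) t := by
      simpa using ((hasDerivAt_id t).pow 2).const_sub 1
    have h2 := ((hasDerivAt_id' t).pow (2 * a + 1)).mul (h1.rpow_const (p := q) (Or.inl hpos.ne'))
    refine h2.congr_deriv ?_
    have h3 : (1 - t ^ 2) ^ q = (1 - t ^ 2) ^ (q - 1) * (1 - t ^ 2) := by
      rw [← rpow_add_one hpos.ne']; congr 1; ring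
    simp only [Pi.pow_apply, h3, Nat.add_sub_cancel]
    push_cast
    ring

/-- Moments of the one-dimensional Jacobi weight. -/
noncomputable def jacMoment (q : ℝ) (a : ℕ) : ℝ :=
  ∫ t in Set.Icc (-1 : ℝ) 1, t ^ a * (1 - t ^ 2) ^ (q - 1)

lemma jacMoment_eq (q : ℝ) (a : ℕ) :
    jacMoment q a = ∫ t in (-1 : ℝ)..1, t ^ a * (1 - t ^ 2) ^ (q - 1) := by
  rw [jacMoment, integral_Icc_eq_integral_Ioc, ← intervalIntegral.integral_of_le (by norm_num)]

lemma jacMoment_odd {q : ℝ} {a : ℕ} (ha : Odd a) : jacMoment q a = 0 := by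
  rw [jacMoment_eq, integral_pow_mul_jacobi_odd ha]

lemma jacMoment_even {q : ℝ} (hq : 0 < q) (r : ℕ) :
    jacMoment q (2 * r) = jacMoment q 0 * (poch (1 / 2) r / poch (q + 1 / 2) r) := by
  induction r with
  | zero => simp [poch]
  | succ r ih =>
    have h := integral_pow_mul_jacobi_succ hq r
    rw [← jacMoment_eq, ← jacMoment_eq, ih] at h
    have h1 : 2 * (r : ℝ) + 1 + 2 * q ≠ 0 := by positivity
    rw [poch_succ, poch_succ]
    have hp := (poch_pos (show 0 < q + 1 / 2 by positivity) r).ne'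
    generalize poch (q + 1 / 2) r = P at *
    have h2 : q + 1 / 2 + (r : ℝ) ≠ 0 := by positivity
    rw [← mul_right_inj' h1, h]
    field_simp
    ring

lemma jacMoment_zero_pos {q : ℝ} (hq : 0 < q) : 0 < jacMoment q 0 := by
  rw [jacMoment_eq]
  refine intervalIntegral.intervalIntegral_pos_of_pos_on (intervalIntegrable_pow_mul_jacobi hq 0)
    (fun t ht => ?_) (by norm_num)
  have : 0 < 1 - t ^ 2 := by nlinarith [ht.1, ht.2]
  positivity

section ZonalIntegral
variable {m : ℕ}

/-- The monomial part of a zonal integral on the cube. -/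
noncomputable def zonInt (κ : Fin m → ℝ) (n : ℕ) (l : ℝ) (s : Fin m → ℕ) (z : Fin m → ℝ) : ℝ :=
  ∫ t in cube m, gegenC n l (∑ i, z i * t i) * (∏ i, t i ^ s i) * jacW κ t

lemma integral_cube_monomial (κ : Fin m → ℝ) (a : Fin m → ℕ) :
    ∫ t in cube m, (∏ i, t i ^ a i) * jacW κ t = ∏ i, jacMoment (κ i) (a i) := by
  simp only [jacW, ← prod_mul_distrib]
  exact integral_cube_prod fun i s => s ^ a i * (1 - s ^ 2) ^ (κ i - 1)

lemma integral_cube_pow {κ : Fin m → ℝ} (hκ : ∀ i, 0 < κ i) (N : ℕ) (s : Fin m → ℕ)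
    (z : Fin m → ℝ) :
    ∫ t in cube m, (∑ i, z i * t i) ^ N * (∏ i, t i ^ s i) * jacW κ t =
      N.factorial * ∑ l ∈ piAntidiag univ N,
        ∏ i, (z i ^ l i / (l i).factorial * jacMoment (κ i) (l i + s i)) := by
  have h1 : ∀ t : Fin m → ℝ, (∑ i, z i * t i) ^ N * (∏ i, t i ^ s i) * jacW κ t =
      ∑ l ∈ piAntidiag univ N, (N.factorial * ∏ i, (z i ^ l i / (l i).factorial)) *
        ((∏ i, t i ^ (l i + s i)) * jacW κ t) := by
    intro t
    rw [sum_pow_eq_sum_piAntidiag, sum_mul, sum_mul]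
    refine sum_congr rfl fun l hl => ?_
    rw [multinomial_div, mem_piAntidiag_univ.1 hl]
    simp only [mul_pow, pow_add, prod_mul_distrib, prod_div_distrib]
    ring
  simp only [h1]
  rw [integral_finsetSum, mul_sum]
  · refine sum_congr rfl fun l _ => ?_
    rw [integral_const_mul, integral_cube_monomial, prod_mul_distrib]
    ring
  · intro l _
    exact (integrableOn_mul_jacW hκ (by fun_prop)).const_mul _

lemma two_pow_mul_poch_half {s : ℕ} (hs : s ≤ 1) (r : ℕ) :
    2 ^ (2 * r + s) * poch (1 / 2) (r + s) / ((2 * r + s).factorial : ℝ) = 1 / r.factorial := by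
  have key : ∀ r : ℕ, ((2 * r).factorial : ℝ) = 4 ^ r * r.factorial * poch (1 / 2) r := by
    intro r
    induction r with
    | zero => simp [poch]
    | succ r ih =>
      rw [show 2 * (r + 1) = 2 * r + 1 + 1 by ring, Nat.factorial_succ, Nat.factorial_succ,
        Nat.factorial_succ, poch_succ]
      push_cast
      rw [ih]
      ring
  have hp := (poch_pos (show (0 : ℝ) < 1 / 2 by norm_num) r).ne'
  interval_cases s
  · rw [add_zero, add_zero, key, pow_mul]
    norm_num
    field_simp
  · have h1 : (((2 * r + 1).factorial : ℕ) : ℝ) = (2 * r + 1) * (2 * r).factorial := by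
      rw [Nat.factorial_succ]; push_cast; ring
    rw [h1, key, poch_succ, pow_succ, pow_mul]
    norm_num
    field_simp
    ring

lemma integral_cube_pow_of_eq {κ : Fin m → ℝ} (hκ : ∀ i, 0 < κ i) {s : Fin m → ℕ}
    (hs : ∀ i, s i ≤ 1) (k : ℕ) (z : Fin m → ℝ) :
    2 ^ (2 * k + ∑ i, s i) * ∫ t in cube m,
      (∑ i, z i * t i) ^ (2 * k + ∑ i, s i) * (∏ i, t i ^ s i) * jacW κ t =
      (2 * k + ∑ i, s i).factorial * (∏ i, jacMoment (κ i) 0) *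
        ((∏ i, z i ^ s i / poch (κ i + 1 / 2) (s i)) *
          zon (fun i => κ i + 1 / 2 + s i) k (fun i => z i ^ 2)) := by
  rw [integral_cube_pow hκ, mul_left_comm, mul_assoc]
  congr 1
  rw [zon, mul_sum, mul_sum, mul_sum]
  symm
  refine sum_of_injOn (fun r i => 2 * r i + s i) ?_ ?_ ?_ ?_
  · intro r _ r' _ h
    funext i
    have := congrFun h i
    simp only at this
    omega
  · intro r hr
    simp only [mem_coe, mem_piAntidiag_univ, sum_add_distrib, ← mul_sum] at hr ⊢
    omega
  · intro l hl hl'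
    have : ∃ i, Odd (l i + s i) := by
      by_contra! h
      simp only [Nat.not_odd_iff_even] at h
      have h2 : ∀ i, l i = 2 * ((l i - s i) / 2) + s i := by
        intro i
        obtain ⟨c, hc⟩ := h i
        have := hs i
        omega
      refine hl' ⟨fun i => (l i - s i) / 2, ?_, funext fun i => (h2 i).symm⟩
      rw [mem_piAntidiag_univ, sum_congr rfl fun i _ => h2 i, sum_add_distrib, ← mul_sum] at hl
      simp only [mem_coe, mem_piAntidiag_univ]
      omega
    obtain ⟨i, hi⟩ := this
    rw [prod_eq_zero (mem_univ i) (by rw [jacMoment_odd hi, mul_zero]), mul_zero]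
  · intro r hr
    have hr' : 2 * k + ∑ i, s i = ∑ i, (2 * r i + s i) := by
      rw [sum_add_distrib, ← mul_sum, mem_piAntidiag_univ.1 hr]
    rw [hr', ← prod_pow_eq_pow_sum, ← prod_mul_distrib, ← prod_mul_distrib, ← prod_mul_distrib]
    refine prod_congr rfl fun i _ => ?_
    rw [show 2 * r i + s i + s i = 2 * (r i + s i) by ring, jacMoment_even (hκ i)]
    have h1 := two_pow_mul_poch_half (hs i) (r i)
    have h2 : poch (κ i + 1 / 2) (r i + s i) =
        poch (κ i + 1 / 2) (s i) * poch (κ i + 1 / 2 + s i) (r i) := by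
      rw [add_comm (r i), poch_add]
    rw [h2]
    have p1 := (poch_pos (show 0 < κ i + 1 / 2 by have := hκ i; positivity) (s i)).ne'
    have p2 := (poch_pos (show 0 < κ i + 1 / 2 + s i by have := hκ i; positivity) (r i)).ne'
    generalize poch (κ i + 1 / 2) (s i) = P at *
    generalize poch (κ i + 1 / 2 + s i) (r i) = Q at *
    calc _ = jacMoment (κ i) 0 * (z i ^ (2 * r i + s i) / (P * Q)) * (1 / (r i).factorial) := by
          rw [pow_add, pow_mul]; field_simp
      _ = _ := by rw [← h1]; field_simp

lemma integral_cube_pow_of_ne {κ : Fin m → ℝ} (hκ : ∀ i, 0 < κ i) {s : Fin m → ℕ}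
    (hs : ∀ i, s i ≤ 1) {N : ℕ} (hN : ∀ k, N ≠ 2 * k + ∑ i, s i) (z : Fin m → ℝ) :
    ∫ t in cube m, (∑ i, z i * t i) ^ N * (∏ i, t i ^ s i) * jacW κ t = 0 := by
  rw [integral_cube_pow hκ]
  refine mul_eq_zero_of_right _ (sum_eq_zero fun l hl => ?_)
  have : ∃ i, Odd (l i + s i) := by
    by_contra! h
    simp only [Nat.not_odd_iff_even] at h
    have h2 : ∀ i, l i = 2 * ((l i - s i) / 2) + s i := by
      intro i
      obtain ⟨c, hc⟩ := h i
      have := hs i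
      omega
    rw [mem_piAntidiag_univ, sum_congr rfl fun i _ => h2 i, sum_add_distrib, ← mul_sum] at hl
    exact hN _ hl.symm
  obtain ⟨i, hi⟩ := this
  exact prod_eq_zero (mem_univ i) (by rw [jacMoment_odd hi, mul_zero])

/-- The radial Jacobi polynomial of degree `k` in zonal form. -/
noncomputable def zonR {ι : Type*} [Fintype ι] [DecidableEq ι] (θ : ι → ℝ) (l : ℝ) (k : ℕ)
    (w : ι → ℝ) : ℝ := ∑ j ∈ range (k + 1), zonCoeff l k j * zon θ j w

lemma zonInt_eq_sum {κ : Fin m → ℝ} (hκ : ∀ i, 0 < κ i) {l : ℝ} (hl : 0 < l) (n : ℕ) (s : Fin m → ℕ)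
    (z : Fin m → ℝ) : zonInt κ n l s z = ∑ p ∈ range (n / 2 + 1),
      (-1) ^ p * poch l (n - p) / (p.factorial * (n - 2 * p).factorial) *
        (2 ^ (n - 2 * p) *
          ∫ t in cube m, (∑ i, z i * t i) ^ (n - 2 * p) * (∏ i, t i ^ s i) * jacW κ t) := by
  simp only [← integral_const_mul]
  rw [← integral_finsetSum]
  · rw [zonInt]
    congr 1
    ext t
    rw [gegenC_eq_sum hl, sum_mul, sum_mul]
    exact sum_congr rfl fun p _ => by ring
  · intro p _
    exact ((integrableOn_mul_jacW hκ (by fun_prop)).const_mul _).const_mul _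

lemma zonInt_eq {κ : Fin m → ℝ} (hκ : ∀ i, 0 < κ i) {l : ℝ} (hl : 0 < l) {s : Fin m → ℕ}
    (hs : ∀ i, s i ≤ 1) (k : ℕ) (z : Fin m → ℝ) :
    zonInt κ (2 * k + ∑ i, s i) l s z = (∏ i, jacMoment (κ i) 0) * poch l (∑ i, s i) *
      (∏ i, z i ^ s i / poch (κ i + 1 / 2) (s i)) *
        zonR (fun i => κ i + 1 / 2 + s i) (l + ∑ i, s i) k (fun i => z i ^ 2) := by
  rw [zonInt_eq_sum hκ hl, zonR]
  set b := ∑ i, s i with hb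
  rw [← sum_range_reflect (fun j => zonCoeff (l + b) k j *
    zon (fun i => κ i + 1 / 2 + s i) j fun i => z i ^ 2) (k + 1), mul_sum]
  have hsub : range (k + 1) ⊆ range ((2 * k + b) / 2 + 1) := range_subset_range.2 (by omega)
  rw [← sum_subset hsub]
  · refine sum_congr rfl fun p hp => ?_
    have hp' : p ≤ k := by simpa [Nat.lt_succ_iff] using hp
    rw [show 2 * k + b - 2 * p = 2 * (k - p) + b by omega, hb, integral_cube_pow_of_eq hκ hs, ← hb,
      zonCoeff, show k + 1 - 1 - p = k - p by omega, show k - (k - p) = p by omega,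
      show 2 * k + b - p = b + (k + (k - p)) by omega, poch_add]
    generalize zon (fun i => κ i + 1 / 2 + s i) (k - p) (fun i => z i ^ 2) = Z
    generalize ∏ i, z i ^ s i / poch (κ i + 1 / 2) (s i) = V
    field_simp
  · intro p hp hp'
    have h1 : ¬ p ≤ k := by simpa [Nat.lt_succ_iff] using hp'
    have h2 : p ≤ (2 * k + b) / 2 := by simpa [Nat.lt_succ_iff] using hp
    rw [integral_cube_pow_of_ne hκ hs (fun j => by omega), mul_zero, mul_zero]

lemma zonInt_eq_zero {κ : Fin m → ℝ} (hκ : ∀ i, 0 < κ i) {l : ℝ} (hl : 0 < l) {s : Fin m → ℕ}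
    (hs : ∀ i, s i ≤ 1) {n : ℕ} (hn : ∀ k, n ≠ 2 * k + ∑ i, s i) (z : Fin m → ℝ) :
    zonInt κ n l s z = 0 := by
  rw [zonInt_eq_sum hκ hl]
  refine sum_eq_zero fun p hp => ?_
  have h2 : p ≤ n / 2 := by simpa [Nat.lt_succ_iff] using hp
  rw [integral_cube_pow_of_ne hκ hs, mul_zero, mul_zero]
  intro k hk
  exact hn (k + p) (by omega)
end ZonalIntegral

section Reproducing
variable {α ι : Type*} [MeasurableSpace α] [Fintype ι] [DecidableEq ι] {μ : Measure α}
  {g : α → ℝ} {V : α → ι → ℝ} {θ : ι → ℝ} {l A : ℝ}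

lemma mul_zon_mul_zon (θ u v w : ι → ℝ) (c : ℝ) (k j : ℕ) :
    c * (zon θ k (fun i => u i * v i) * zon θ j (fun i => v i * w i)) =
      ∑ r ∈ piAntidiag univ k, ∑ s ∈ piAntidiag univ j,
        (∏ i, (u i ^ r i / ((r i).factorial * poch (θ i) (r i))) *
          (w i ^ s i / ((s i).factorial * poch (θ i) (s i)))) * (c * ∏ i, v i ^ (r i + s i)) := by
  rw [zon, zon, sum_mul_sum, mul_sum]
  refine sum_congr rfl fun r _ => ?_
  rw [mul_sum]
  refine sum_congr rfl fun s _ => ?_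
  rw [← prod_mul_distrib, mul_left_comm, ← prod_mul_distrib]
  congr 1
  refine prod_congr rfl fun i _ => ?_
  rw [mul_pow, mul_pow, pow_add]
  ring

lemma integrable_zon_mul_zon (hint : ∀ a : ι → ℕ, Integrable (fun x => g x * ∏ i, V x i ^ a i) μ)
    (u w : ι → ℝ) (k j : ℕ) :
    Integrable (fun x => g x * (zon θ k (fun i => u i * V x i) *
      zon θ j (fun i => V x i * w i))) μ := by
  simp only [mul_zon_mul_zon]
  exact integrable_finsetSum _ fun r _ => integrable_finsetSum _ fun s _ =>
    (hint fun i => r i + s i).const_mul _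

lemma integral_zon_mul_zon (hθ : ∀ i, 0 < θ i)
    (hint : ∀ a : ι → ℕ, Integrable (fun x => g x * ∏ i, V x i ^ a i) μ)
    (hmom : ∀ a : ι → ℕ, ∫ x, g x * ∏ i, V x i ^ a i ∂μ =
      A * (∏ i, poch (θ i) (a i)) / poch (l + 1) (∑ i, a i))
    {u w : ι → ℝ} (hu : ∑ i, u i = 1) (hw : ∑ i, w i = 1) (k j : ℕ) :
    ∫ x, g x * (zon θ k (fun i => u i * V x i) * zon θ j (fun i => V x i * w i)) ∂μ =
      A / poch (l + 1) (k + j) *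
        ∑ q ∈ range (j + 1), invFact k q * invFact j q * zon θ q (fun i => u i * w i) := by
  simp only [mul_zon_mul_zon]
  rw [integral_finsetSum _ fun r _ => integrable_finsetSum _ fun s _ =>
    (hint fun i => r i + s i).const_mul _]
  have h := sum_zonal_mul hθ u w k j
  simp only [hu, hw, one_pow, mul_one] at h
  rw [← h, mul_sum]
  refine sum_congr rfl fun r hr => ?_
  rw [integral_finsetSum _ fun s _ => (hint fun i => r i + s i).const_mul _, mul_sum]
  refine sum_congr rfl fun s hs => ?_
  rw [integral_const_mul, hmom, sum_add_distrib, mem_piAntidiag_univ.1 hr,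
    mem_piAntidiag_univ.1 hs, prod_mul_distrib (g := fun i => poch (θ i) (r i + s i))]
  ring

/-- The reproducing property of the zonal Jacobi polynomials for a Dirichlet measure. -/
lemma integral_zonR_mul_zonR (hθ : ∀ i, 0 < θ i) (hl : 0 < l)
    (hint : ∀ a : ι → ℕ, Integrable (fun x => g x * ∏ i, V x i ^ a i) μ)
    (hmom : ∀ a : ι → ℕ, ∫ x, g x * ∏ i, V x i ^ a i ∂μ =
      A * (∏ i, poch (θ i) (a i)) / poch (l + 1) (∑ i, a i))
    {u w : ι → ℝ} (hu : ∑ i, u i = 1) (hw : ∑ i, w i = 1) (m : ℕ) :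
    ∫ x, g x * (zonR θ l m (fun i => u i * V x i) * zonR θ l m (fun i => V x i * w i)) ∂μ =
      A * (l / (l + 2 * m)) * zonR θ l m (fun i => u i * w i) := by
  have h1 : ∀ x, g x * (zonR θ l m (fun i => u i * V x i) * zonR θ l m (fun i => V x i * w i)) =
      ∑ k ∈ range (m + 1), ∑ j ∈ range (m + 1), zonCoeff l m k * zonCoeff l m j *
        (g x * (zon θ k (fun i => u i * V x i) * zon θ j (fun i => V x i * w i))) := by
    intro x
    rw [zonR, zonR, sum_mul_sum, mul_sum]
    refine sum_congr rfl fun k _ => ?_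
    rw [mul_sum]
    exact sum_congr rfl fun j _ => by ring
  have hI := integrable_zon_mul_zon (θ := θ) hint u w
  simp only [h1]
  rw [integral_finsetSum _ fun k _ => integrable_finsetSum _ fun j _ => (hI k j).const_mul _]
  have h2 : ∀ k ∈ range (m + 1), ∫ x, ∑ j ∈ range (m + 1), zonCoeff l m k * zonCoeff l m j *
      (g x * (zon θ k (fun i => u i * V x i) * zon θ j (fun i => V x i * w i))) ∂μ =
      ∑ j ∈ range (m + 1), ∑ q ∈ range (m + 1), A * zon θ q (fun i => u i * w i) *
        (zonCoeff l m k * zonCoeff l m j * (invFact k q * invFact j q) / poch (l + 1) (k + j)) := by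
    intro k _
    rw [integral_finsetSum _ fun j _ => (hI k j).const_mul _]
    refine sum_congr rfl fun j hj => ?_
    have hj' : j ≤ m := by simpa [Nat.lt_succ_iff] using hj
    rw [integral_const_mul, integral_zon_mul_zon hθ hint hmom hu hw, ← mul_assoc, mul_sum]
    rw [← sum_subset (range_subset_range.2 (show j + 1 ≤ m + 1 by omega))]
    · exact sum_congr rfl fun q _ => by ring
    · intro q _ hq
      have : ¬ q ≤ j := by simpa [Nat.lt_succ_iff] using hq
      simp [invFact, this]
  rw [sum_congr rfl h2]
  have h3 : ∀ k ∈ range (m + 1), ∑ j ∈ range (m + 1), ∑ q ∈ range (m + 1),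
      A * zon θ q (fun i => u i * w i) *
        (zonCoeff l m k * zonCoeff l m j * (invFact k q * invFact j q) / poch (l + 1) (k + j)) =
      ∑ q ∈ range (m + 1), ∑ j ∈ range (m + 1), A * zon θ q (fun i => u i * w i) *
        (zonCoeff l m k * zonCoeff l m j * (invFact k q * invFact j q) / poch (l + 1) (k + j)) :=
    fun k _ => sum_comm
  rw [sum_congr rfl h3, sum_comm, zonR, mul_sum]
  refine sum_congr rfl fun q hq => ?_
  simp only [← mul_sum]
  rw [zonCoeff_convolution hl (by simpa [Nat.lt_succ_iff] using hq)]
  ring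
end Reproducing

lemma integral_zonInt_sq {α : Type*} [MeasurableSpace α] {μ : Measure α} {m : ℕ} {κ : Fin m → ℝ}
    (hκ : ∀ i, 0 < κ i) {l A : ℝ} (hl : 0 < l) {g : α → ℝ} {Y : α → Fin m → ℝ}
    (hint : ∀ a : Fin m → ℕ, Integrable (fun x => g x * ∏ i, (Y x i ^ 2) ^ a i) μ)
    (hmom : ∀ a : Fin m → ℕ, ∫ x, g x * ∏ i, (Y x i ^ 2) ^ a i ∂μ =
      A * (∏ i, poch (κ i + 1 / 2) (a i)) / poch (l + 1) (∑ i, a i))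
    {s : Fin m → ℕ} (hs : ∀ i, s i ≤ 1) {X : Fin m → ℝ} (hX : ∑ i, X i ^ 2 = 1) (n : ℕ) :
    ∫ x, g x * zonInt κ n l s (fun i => X i * Y x i) ^ 2 ∂μ =
      A * (∏ i, jacMoment (κ i) 0) * (l / (l + n)) * zonInt κ n l s (fun i => X i ^ 2) := by
  by_cases hn : ∀ k, n ≠ 2 * k + ∑ i, s i
  · simp only [zonInt_eq_zero hκ hl hs hn]
    simp
  push Not at hn
  obtain ⟨k, rfl⟩ := hn
  have hθ : ∀ i, 0 < κ i + 1 / 2 := fun i => by have := hκ i; positivity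
  set b := ∑ i, s i with hb
  have hm' : ∀ a : Fin m → ℕ, ∫ x, g x * (∏ i, (Y x i ^ 2) ^ s i) * ∏ i, (Y x i ^ 2) ^ a i ∂μ =
      A * (∏ i, poch (κ i + 1 / 2) (s i)) / poch (l + 1) b *
        (∏ i, poch (κ i + 1 / 2 + s i) (a i)) / poch (l + b + 1) (∑ i, a i) := by
    intro a
    have h := hmom fun i => s i + a i
    simp only [pow_add, prod_mul_distrib, poch_add, sum_add_distrib] at h
    simp only [mul_assoc] at h ⊢
    rw [h, ← hb, add_right_comm l]
    ring
  have hi' : ∀ a : Fin m → ℕ, Integrable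
      (fun x => g x * (∏ i, (Y x i ^ 2) ^ s i) * ∏ i, (Y x i ^ 2) ^ a i) μ := by
    intro a
    have h := hint fun i => s i + a i
    simp only [pow_add, prod_mul_distrib] at h
    simpa only [mul_assoc] using h
  have key := integral_zonR_mul_zonR (fun i => add_pos_of_pos_of_nonneg (hθ i) (Nat.cast_nonneg _))
    (add_pos_of_pos_of_nonneg hl (Nat.cast_nonneg b)) hi' hm' hX hX k
  have h1 : ∀ x, g x * zonInt κ (2 * k + b) l s (fun i => X i * Y x i) ^ 2 =
      ((∏ i, jacMoment (κ i) 0) * poch l b) ^ 2 *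
        ((∏ i, (X i ^ 2) ^ s i) / (∏ i, poch (κ i + 1 / 2) (s i)) ^ 2) *
      (g x * (∏ i, (Y x i ^ 2) ^ s i) *
        (zonR (fun i => κ i + 1 / 2 + s i) (l + b) k (fun i => X i ^ 2 * Y x i ^ 2) *
          zonR (fun i => κ i + 1 / 2 + s i) (l + b) k (fun i => Y x i ^ 2 * X i ^ 2))) := by
    intro x
    rw [zonInt_eq hκ hl hs]
    simp only [mul_comm (Y x _ ^ 2), mul_pow, prod_div_distrib, prod_mul_distrib, ← hb,
      ← pow_mul, mul_comm 2]
    simp only [pow_mul, prod_pow, div_pow]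
    ring
  simp only [h1]
  rw [integral_const_mul, key, zonInt_eq hκ hl hs, ← hb]
  simp only [prod_div_distrib]
  simp only [← pow_two]
  have hP : (∏ i, poch (κ i + 1 / 2) (s i)) ≠ 0 :=
    prod_ne_zero_iff.2 fun i _ => (poch_pos (hθ i) _).ne'
  have hQ := (poch_pos (show 0 < l + 1 by positivity) b).ne'
  have hr : poch l b * (l + b) = l * poch (l + 1) b := by rw [← poch_succ, poch_succ']
  have h2 : (l + b + 2 * k : ℝ) ≠ 0 := by positivity
  have h3 : (l + (2 * k + b : ℕ) : ℝ) = l + b + 2 * k := by push_cast; ring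
  rw [h3]
  generalize zonR (fun i => κ i + 1 / 2 + (s i : ℝ)) (l + b) k (fun i => (X i ^ 2) ^ 2) = Z
  generalize (∏ i, poch (κ i + 1 / 2) (s i)) = P at *
  generalize (∏ i, (X i ^ 2) ^ s i) = R
  generalize poch (l + 1) b = Q at *
  generalize poch l b = p at *
  generalize (∏ i, jacMoment (κ i) 0) = E
  generalize l + (b : ℝ) + 2 * k = c at *
  field_simp
  linear_combination Z * E ^ 2 * p * R * A * hr

lemma integrable_comp_abs_of_integrableOn {f : ℝ → ℝ} (hf : IntegrableOn f (Set.Ioi 0)) :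
    Integrable fun x => f |x| := by
  have h1 : IntegrableOn (fun x => f |x|) (Set.Ioi 0) :=
    hf.congr_fun (fun x hx => by simp [abs_of_pos (Set.mem_Ioi.1 hx)]) measurableSet_Ioi
  have h2 : IntegrableOn (fun x => f |x|) (Set.Iio 0) := by
    have h3 := h1.comp_neg
    simpa using h3
  rw [← integrableOn_univ, ← Set.Iic_union_Ioi (a := (0 : ℝ))]
  exact ((integrableOn_Iic_iff_integrableOn_Iio (by simp)).2 h2).union h1

lemma integrable_abs_rpow_mul_exp {a : ℝ} (ha : 0 < a) :
    Integrable fun x : ℝ => |x| ^ (2 * a - 1) * exp (-x ^ 2) := by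
  have h := integrableOn_rpow_mul_exp_neg_rpow (p := 2) (s := 2 * a - 1) (by linarith) (by norm_num)
  refine (integrable_comp_abs_of_integrableOn h).congr (Filter.Eventually.of_forall fun x => ?_)
  simp

lemma integral_abs_rpow_mul_exp {a : ℝ} (ha : 0 < a) :
    ∫ x : ℝ, |x| ^ (2 * a - 1) * exp (-x ^ 2) = Gamma a := by
  have h := integral_rpow_mul_exp_neg_rpow (p := 2) (q := 2 * a - 1) (by norm_num) (by linarith)
  have h2 := integral_comp_abs (f := fun x : ℝ => x ^ (2 * a - 1) * exp (-x ^ (2 : ℝ)))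
  rw [h] at h2
  simp only [rpow_two, sq_abs] at h2
  rw [h2, show (2 * a - 1 + 1) / 2 = a by ring]
  ring

section Dirichlet
variable {d : ℕ}

/-- The homogeneous part of the Dirichlet weight. -/
noncomputable def dirW (a : Fin d → ℝ) (y : Fin d → ℝ) : ℝ := ∏ i, |y i| ^ (2 * a i - 1)

lemma dirW_nonneg (a y : Fin d → ℝ) : 0 ≤ dirW a y :=
  prod_nonneg fun _ _ => rpow_nonneg (abs_nonneg _) _

lemma measurable_dirW (a : Fin d → ℝ) : Measurable (dirW a) := by
  unfold dirW
  fun_prop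

lemma dirW_smul (a : Fin d → ℝ) {r : ℝ} (hr : 0 < r) (y : Fin d → ℝ) :
    dirW a (r • y) = r ^ (2 * ∑ i, a i - d) * dirW a y := by
  have h1 : r ^ (2 * ∑ i, a i - d) = ∏ i, r ^ (2 * a i - 1) := by
    rw [← rpow_sum_of_pos hr, sum_sub_distrib, ← mul_sum]
    simp
  rw [h1, dirW, dirW, ← prod_mul_distrib]
  refine prod_congr rfl fun i _ => ?_
  rw [Pi.smul_apply, smul_eq_mul, abs_mul, abs_of_pos hr, mul_rpow hr.le (abs_nonneg _)]

lemma lintegral_dirW_mul_exp {a : Fin d → ℝ} (ha : ∀ i, 0 < a i) :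
    ∫⁻ y : Fin d → ℝ, ENNReal.ofReal (dirW a y * exp (-∑ i, y i ^ 2)) =
      ENNReal.ofReal (∏ i, Gamma (a i)) := by
  have h1 : ∀ y : Fin d → ℝ, dirW a y * exp (-∑ i, y i ^ 2) =
      ∏ i, |y i| ^ (2 * a i - 1) * exp (-y i ^ 2) := by
    intro y
    rw [prod_mul_distrib, ← exp_sum, sum_neg_distrib, dirW]
  simp only [h1]
  rw [volume_pi, ← ofReal_integral_eq_lintegral_ofReal
    (Integrable.fintype_prod (f := fun i x => |x| ^ (2 * a i - 1) * exp (-x ^ 2))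
      fun i => integrable_abs_rpow_mul_exp (ha i))
    (Filter.Eventually.of_forall fun y => prod_nonneg fun i _ => by positivity),
    integral_fintype_prod_eq_prod (f := fun i x => |x| ^ (2 * a i - 1) * exp (-x ^ 2))]
  congr 1
  exact prod_congr rfl fun i _ => integral_abs_rpow_mul_exp (ha i)

lemma lintegral_Gamma {q : ℝ} (hq : 0 < q) :
    ∫⁻ R in Set.Ioi (0 : ℝ), ENNReal.ofReal (exp (-R) * R ^ (q - 1)) =
      ENNReal.ofReal (Gamma q) := by
  rw [Gamma_eq_integral hq, ofReal_integral_eq_lintegral_ofReal (GammaIntegral_convergent hq)]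
  refine (ae_restrict_mem measurableSet_Ioi).mono fun R hR => ?_
  have : 0 < R := hR
  positivity

/-- The Dirichlet integral over the unit ball. -/
lemma lintegral_dirichlet {a : Fin d → ℝ} (ha : ∀ i, 0 < a i) {q : ℝ} (hq : 0 < q) :
    ∫⁻ y in {y : Fin d → ℝ | ∑ i, y i ^ 2 < 1},
      ENNReal.ofReal (dirW a y * (1 - ∑ i, y i ^ 2) ^ (q - 1)) =
      ENNReal.ofReal ((∏ i, Gamma (a i)) * Gamma q / Gamma (∑ i, a i + q)) := by
  set F : ℝ → (Fin d → ℝ) → ENNReal := fun R y => {p : ℝ × (Fin d → ℝ) | ∑ i, p.2 i ^ 2 < p.1}.indicator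
    (fun p => ENNReal.ofReal
      (dirW a p.2 * (exp (-p.1) * (p.1 - ∑ i, p.2 i ^ 2) ^ (q - 1)))) (R, y) with hF
  have hmeas : MeasurableSet {p : ℝ × (Fin d → ℝ) | ∑ i, p.2 i ^ 2 < p.1} :=
    measurableSet_lt (by fun_prop) (by fun_prop)
  have hFm : Measurable (Function.uncurry F) := by
    have h2 : Measurable fun p : ℝ × (Fin d → ℝ) => dirW a p.2 :=
      (measurable_dirW a).comp measurable_snd
    refine Measurable.indicator (Measurable.ennreal_ofReal ?_) hmeas
    fun_prop
  set D := ∫⁻ y in {y : Fin d → ℝ | ∑ i, y i ^ 2 < 1},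
      ENNReal.ofReal (dirW a y * (1 - ∑ i, y i ^ 2) ^ (q - 1)) with hD
  have hm1 : MeasurableSet {y : Fin d → ℝ | ∑ i, y i ^ 2 < 1} :=
    measurableSet_lt (by fun_prop) (by fun_prop)
  have hswap := lintegral_lintegral_swap (μ := volume) (ν := volume) hFm.aemeasurable
  have h1 : ∀ y, ∫⁻ R, F R y = ENNReal.ofReal (dirW a y * exp (-∑ i, y i ^ 2)) *
      ENNReal.ofReal (Gamma q) := by
    intro y
    rw [← lintegral_add_right_eq_self _ (∑ i, y i ^ 2), ← lintegral_Gamma hq,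
      ← lintegral_const_mul' _ _ ENNReal.ofReal_ne_top, ← lintegral_indicator measurableSet_Ioi]
    congr 1
    ext R
    simp only [hF, Set.indicator_apply, Set.mem_ofPred_eq, Set.mem_Ioi, lt_add_iff_pos_left]
    refine if_congr Iff.rfl ?_ rfl
    rw [← ENNReal.ofReal_mul (mul_nonneg (dirW_nonneg _ _) (exp_pos _).le), add_sub_cancel_right,
      neg_add, exp_add]
    congr 1
    ring
  have h2 : ∀ R : ℝ, ∫⁻ y, F R y = (Set.Ioi (0 : ℝ)).indicator
      (fun R => ENNReal.ofReal (exp (-R) * R ^ (∑ i, a i + q - 1)) * D) R := by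
    intro R
    by_cases hR : 0 < R
    · rw [Set.indicator_of_mem (Set.mem_Ioi.2 hR)]
      have hr : 0 < √R := sqrt_pos.2 hR
      have hFr : Measurable (F R) := hFm.comp (measurable_const.prodMk measurable_id)
      have h3 := Measure.map_addHaar_smul (volume : Measure (Fin d → ℝ)) hr.ne'
      have h4 : ∫⁻ y, F R y = ENNReal.ofReal (√R ^ d) * ∫⁻ y, F R (√R • y) := by
        rw [← lintegral_map hFr (measurable_const_smul _), h3, lintegral_smul_measure,
          smul_eq_mul, ← mul_assoc, ← ENNReal.ofReal_mul (by positivity),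
          Module.finrank_fin_fun, abs_of_pos (by positivity), mul_inv_cancel₀ (by positivity)]
        simp
      rw [h4, hD, ← lintegral_indicator hm1, ← lintegral_const_mul' _ _ ENNReal.ofReal_ne_top,
        ← lintegral_const_mul' _ _ ENNReal.ofReal_ne_top]
      congr 1
      ext y
      have h5 : ∑ i, (√R • y) i ^ 2 = R * ∑ i, y i ^ 2 := by
        simp [mul_pow, sq_sqrt hR.le, mul_sum]
      simp only [hF, Set.indicator_apply, Set.mem_ofPred_eq, h5]
      have h6 : R * ∑ i, y i ^ 2 < R ↔ ∑ i, y i ^ 2 < 1 := by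
        constructor <;> intro h <;> nlinarith
      rw [if_congr h6 rfl rfl]
      split_ifs with h
      · rw [← ENNReal.ofReal_mul (by positivity), ← ENNReal.ofReal_mul (by positivity),
          dirW_smul a hr]
        congr 1
        rw [show R - R * ∑ i, y i ^ 2 = R * (1 - ∑ i, y i ^ 2) by ring,
          mul_rpow hR.le (by linarith)]
        have h7 : R ^ (∑ i, a i + q - 1) = √R ^ d * √R ^ (2 * ∑ i, a i - d) * R ^ (q - 1) := by
          rw [← rpow_natCast, ← rpow_add hr, sqrt_eq_rpow, ← rpow_mul hR.le, ← rpow_add hR]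
          congr 1
          ring
        rw [h7]
        ring
      · simp
    · rw [Set.indicator_of_notMem (by simpa using hR)]
      have : ∀ y, F R y = 0 := by
        intro y
        refine Set.indicator_of_notMem ?_ _
        have : 0 ≤ ∑ i, y i ^ 2 := sum_nonneg fun i _ => sq_nonneg _
        simp only [Set.mem_ofPred_eq, not_lt]
        linarith
      simp [this]
  simp only [h1, h2] at hswap
  have hs : 0 < ∑ i, a i + q := add_pos_of_nonneg_of_pos (sum_nonneg fun i _ => (ha i).le) hq
  rw [lintegral_indicator measurableSet_Ioi, lintegral_mul_const, lintegral_Gamma hs,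
    lintegral_mul_const, lintegral_dirW_mul_exp ha] at hswap
  · have hG := Gamma_pos_of_pos hs
    have hp : 0 ≤ ∏ i, Gamma (a i) := prod_nonneg fun i _ => (Gamma_pos_of_pos (ha i)).le
    rw [ENNReal.ofReal_div_of_pos hG, ENNReal.ofReal_mul hp, ← hswap,
      mul_comm, ENNReal.mul_div_cancel_right (by simpa using hG) ENNReal.ofReal_ne_top]
  · have := measurable_dirW a
    fun_prop
  · fun_prop
end Dirichlet

lemma Gamma_add_natCast {x : ℝ} (hx : 0 < x) (n : ℕ) : Gamma (x + n) = Gamma x * poch x n := by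
  induction n with
  | zero => simp [poch]
  | succ n ih =>
    rw [Nat.cast_succ, ← add_assoc, Gamma_add_one (by positivity), ih, poch_succ]
    ring

section Ball
variable {d : ℕ} {κ : Fin (d + 1) → ℝ}

@[simp] lemma liftB_castSucc (x : EuclideanSpace ℝ (Fin d)) (s : ℝ) (i : Fin d) :
    liftB d x s i.castSucc = x i := by
  simp [liftB]

@[simp] lemma liftB_last (x : EuclideanSpace ℝ (Fin d)) (s : ℝ) :
    liftB d x s (Fin.last d) = s := by
  simp [liftB]

/-- The coordinates of the lift of a point of the ball to the upper hemisphere. -/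
noncomputable def upper (y : EuclideanSpace ℝ (Fin d)) (i : Fin (d + 1)) : ℝ :=
  liftB d y (√(1 - ‖y‖ ^ 2)) i

lemma measurable_upper (i : Fin (d + 1)) :
    Measurable fun y : EuclideanSpace ℝ (Fin d) => upper y i := by
  unfold upper
  induction i using Fin.lastCases with
  | last => simp only [liftB_last]; fun_prop
  | cast i => simp only [liftB_castSucc]; fun_prop

lemma norm_sq_le_one {y : EuclideanSpace ℝ (Fin d)} (hy : y ∈ Metric.closedBall 0 1) :
    ‖y‖ ^ 2 ≤ 1 := by
  have : ‖y‖ ≤ 1 := by simpa using hy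
  nlinarith [norm_nonneg y]

lemma sum_upper_sq {y : EuclideanSpace ℝ (Fin d)} (hy : y ∈ Metric.closedBall 0 1) :
    ∑ i, upper y i ^ 2 = 1 := by
  have := norm_sq_le_one hy
  rw [Fin.sum_univ_castSucc]
  simp only [upper, liftB_castSucc, liftB_last]
  rw [sq_sqrt (by linarith), EuclideanSpace.norm_sq_eq]
  simp

lemma WB_nonneg {y : EuclideanSpace ℝ (Fin d)} (hy : y ∈ Metric.closedBall 0 1) :
    0 ≤ WB d κ y := by
  have := norm_sq_le_one hy
  exact mul_nonneg (prod_nonneg fun i _ => by positivity) (rpow_nonneg (by linarith) _)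

lemma measurable_WB : Measurable (WB d κ) := by
  unfold WB
  fun_prop

lemma closedBall_ae_eq_ball :
    (Metric.closedBall (0 : EuclideanSpace ℝ (Fin d)) 1 : Set _) =ᵐ[volume] Metric.ball 0 1 := by
  rw [← Metric.ball_union_sphere]
  exact union_ae_eq_left_of_ae_eq_empty
    (ae_eq_empty.2 (Measure.addHaar_sphere_of_ne_zero _ _ one_ne_zero))

lemma lamK_add_one : ∑ i, (κ i + 1 / 2) = lamK d κ + 1 := by
  rw [sum_add_distrib, lamK]
  simp
  ring

/-- Moments of the weight on the ball, as an instance of the Dirichlet integral. -/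
lemma lintegral_ball_moment (hκ : ∀ i, 0 < κ i) (a : Fin (d + 1) → ℕ) :
    ∫⁻ y in Metric.closedBall (0 : EuclideanSpace ℝ (Fin d)) 1,
      ENNReal.ofReal (WB d κ y * ∏ i, (upper y i ^ 2) ^ a i) =
      ENNReal.ofReal ((∏ i, Gamma (κ i + 1 / 2 + a i)) / Gamma (∑ i, (κ i + 1 / 2 + a i))) := by
  have h := lintegral_dirichlet (a := fun i : Fin d => κ i.castSucc + 1 / 2 + a i.castSucc)
    (fun i => by have := hκ i.castSucc; positivity) (q := κ (Fin.last d) + 1 / 2 + a (Fin.last d))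
    (by have := hκ (Fin.last d); positivity)
  rw [Fin.prod_univ_castSucc, Fin.sum_univ_castSucc, ← h, setLIntegral_congr closedBall_ae_eq_ball]
  have hm1 : MeasurableSet {y : Fin d → ℝ | ∑ i, y i ^ 2 < 1} :=
    measurableSet_lt (by fun_prop) (by fun_prop)
  have hpre : Metric.ball (0 : EuclideanSpace ℝ (Fin d)) 1 =
      WithLp.ofLp ⁻¹' {y : Fin d → ℝ | ∑ i, y i ^ 2 < 1} := by
    rw [EuclideanSpace.ball_zero_eq _ zero_le_one]
    simp
  rw [← (PiLp.volume_preserving_ofLp (Fin d)).setLIntegral_comp_preimage hm1, ← hpre]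
  · refine setLIntegral_congr_fun Metric.isOpen_ball.measurableSet fun y hy => ?_
    have hy1 : ‖y‖ ^ 2 < 1 := by
      have : ‖y‖ < 1 := by simpa using hy
      nlinarith [norm_nonneg y]
    have hn : ∑ i, y i ^ 2 = ‖y‖ ^ 2 := by
      rw [EuclideanSpace.norm_sq_eq]
      simp
    simp only [hn]
    congr 1
    rw [Fin.prod_univ_castSucc]
    simp only [upper, liftB_castSucc, liftB_last, WB, dirW]
    rw [sq_sqrt (by linarith), mul_mul_mul_comm, ← prod_mul_distrib]
    congr 1
    · refine prod_congr rfl fun i _ => ?_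
      have := hκ i.castSucc
      rw [← sq_abs, ← pow_mul, ← rpow_add_natCast' (abs_nonneg _) (by positivity)]
      congr 1
      push_cast
      ring
    · rw [← rpow_add_natCast (by linarith)]
      congr 1
      ring
  · have := measurable_dirW fun i : Fin d => κ i.castSucc + 1 / 2 + a i.castSucc
    fun_prop

lemma ball_moment_nonneg (a : Fin (d + 1) → ℕ) :
    0 ≤ᵐ[volume.restrict (Metric.closedBall (0 : EuclideanSpace ℝ (Fin d)) 1)]
      fun y => WB d κ y * ∏ i, (upper y i ^ 2) ^ a i :=
  (ae_restrict_mem measurableSet_closedBall).mono fun y hy =>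
    mul_nonneg (WB_nonneg hy) (prod_nonneg fun i _ => by positivity)

lemma measurable_ball_moment (a : Fin (d + 1) → ℕ) :
    Measurable fun y : EuclideanSpace ℝ (Fin d) => WB d κ y * ∏ i, (upper y i ^ 2) ^ a i := by
  have h1 := measurable_WB (d := d) (κ := κ)
  have h2 := measurable_upper (d := d)
  fun_prop

lemma integrableOn_ball_moment (hκ : ∀ i, 0 < κ i) (a : Fin (d + 1) → ℕ) :
    IntegrableOn (fun y : EuclideanSpace ℝ (Fin d) => WB d κ y * ∏ i, (upper y i ^ 2) ^ a i)
      (Metric.closedBall 0 1) := by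
  rw [IntegrableOn, ← lintegral_ofReal_ne_top_iff_integrable
    (measurable_ball_moment a).aestronglyMeasurable (ball_moment_nonneg a),
    lintegral_ball_moment hκ]
  exact ENNReal.ofReal_ne_top

lemma integral_ball_moment' (hκ : ∀ i, 0 < κ i) (a : Fin (d + 1) → ℕ) :
    ∫ y in Metric.closedBall (0 : EuclideanSpace ℝ (Fin d)) 1,
      WB d κ y * ∏ i, (upper y i ^ 2) ^ a i =
      (∏ i, Gamma (κ i + 1 / 2 + a i)) / Gamma (∑ i, (κ i + 1 / 2 + a i)) := by
  rw [integral_eq_lintegral_of_nonneg_ae (ball_moment_nonneg a)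
    (measurable_ball_moment a).aestronglyMeasurable, lintegral_ball_moment hκ,
    ENNReal.toReal_ofReal]
  have h : ∀ i, 0 < κ i + 1 / 2 + a i := fun i => by have := hκ i; positivity
  exact div_nonneg (prod_nonneg fun i _ => (Gamma_pos_of_pos (h i)).le)
    (Gamma_pos_of_pos (sum_pos (fun i _ => h i) univ_nonempty)).le

lemma integral_WB (hκ : ∀ i, 0 < κ i) :
    ∫ y in Metric.closedBall (0 : EuclideanSpace ℝ (Fin d)) 1, WB d κ y =
      (∏ i, Gamma (κ i + 1 / 2)) / Gamma (lamK d κ + 1) := by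
  have h := integral_ball_moment' hκ 0
  simpa only [Pi.zero_apply, pow_zero, prod_const_one, mul_one, Nat.cast_zero, add_zero,
    lamK_add_one] using h

lemma integrableOn_WB (hκ : ∀ i, 0 < κ i) :
    IntegrableOn (WB d κ) (Metric.closedBall (0 : EuclideanSpace ℝ (Fin d)) 1) := by
  simpa using integrableOn_ball_moment hκ 0

lemma lamK_add_one_pos (hκ : ∀ i, 0 < κ i) : 0 < lamK d κ + 1 := by
  rw [← lamK_add_one]
  exact sum_pos (fun i _ => by have := hκ i; positivity) univ_nonempty

lemma integral_WB_pos (hκ : ∀ i, 0 < κ i) :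
    0 < ∫ y in Metric.closedBall (0 : EuclideanSpace ℝ (Fin d)) 1, WB d κ y := by
  rw [integral_WB hκ]
  exact div_pos (prod_pos fun i _ => Gamma_pos_of_pos (by have := hκ i; positivity))
    (Gamma_pos_of_pos (lamK_add_one_pos hκ))

lemma integral_ball_moment (hκ : ∀ i, 0 < κ i) (a : Fin (d + 1) → ℕ) :
    ∫ y in Metric.closedBall (0 : EuclideanSpace ℝ (Fin d)) 1,
      WB d κ y * ∏ i, (upper y i ^ 2) ^ a i =
      (∫ y in Metric.closedBall (0 : EuclideanSpace ℝ (Fin d)) 1, WB d κ y) *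
        (∏ i, poch (κ i + 1 / 2) (a i)) / poch (lamK d κ + 1) (∑ i, a i) := by
  rw [integral_ball_moment' hκ, integral_WB hκ, sum_add_distrib, lamK_add_one, ← Nat.cast_sum,
    Gamma_add_natCast (lamK_add_one_pos hκ)]
  rw [prod_congr rfl fun i _ => Gamma_add_natCast
    (show 0 < κ i + 1 / 2 by have := hκ i; positivity) (a i), prod_mul_distrib, div_mul_eq_mul_div,
    div_div]

lemma ball_integral_zonInt_sq (hκ : ∀ i, 0 < κ i) (hd : 0 < lamK d κ)
    {s : Fin (d + 1) → ℕ} (hs : ∀ i, s i ≤ 1) {x : EuclideanSpace ℝ (Fin d)}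
    (hx : x ∈ Metric.closedBall 0 1) (n : ℕ) :
    ∫ y in Metric.closedBall (0 : EuclideanSpace ℝ (Fin d)) 1,
      WB d κ y * zonInt κ n (lamK d κ) s (fun i => upper x i * upper y i) ^ 2 =
      (∫ y in Metric.closedBall (0 : EuclideanSpace ℝ (Fin d)) 1, WB d κ y) *
        (∏ i, jacMoment (κ i) 0) * (lamK d κ / (lamK d κ + n)) *
        zonInt κ n (lamK d κ) s (fun i => upper x i ^ 2) :=
  integral_zonInt_sq hκ hd (integrableOn_ball_moment hκ) (integral_ball_moment hκ) hs
    (sum_upper_sq hx) n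
end Ball

/-- The exponent vector of the square-free monomial indexed by `S`. -/
def indVec {m : ℕ} (S : Finset (Fin m)) (i : Fin m) : ℕ := if i ∈ S then 1 else 0

lemma indVec_le_one {m : ℕ} (S : Finset (Fin m)) (i : Fin m) : indVec S i ≤ 1 := by
  unfold indVec
  split_ifs <;> simp

lemma prod_pow_indVec {m : ℕ} (S : Finset (Fin m)) (t : Fin m → ℝ) :
    ∏ i, t i ^ indVec S i = ∏ i ∈ S, t i := by
  simp [indVec, pow_ite, prod_ite_mem]

lemma wprod_eq {m : ℕ} (κ t : Fin m → ℝ) :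
    wprod κ t = ∑ S ∈ (univ : Finset (Fin m)).powerset, (∏ i, t i ^ indVec S i) * jacW κ t := by
  simp only [prod_pow_indVec]
  rw [← sum_mul, ← prod_one_add, wprod, jacW, prod_mul_distrib]

lemma lamK_pos {d : ℕ} (hd : 1 ≤ d) {κ : Fin (d + 1) → ℝ} (hκ : ∀ i, 0 < κ i) : 0 < lamK d κ := by
  have h1 : (1 : ℝ) ≤ d := by exact_mod_cast hd
  have h2 : 0 < ∑ i, κ i := sum_pos (fun i _ => hκ i) univ_nonempty
  rw [lamK]
  linarith

section KernelSplit
variable {m : ℕ} {κ : Fin m → ℝ}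

lemma integral_wprod (hκ : ∀ i, 0 < κ i) :
    ∫ t in cube m, wprod κ t = ∏ i, jacMoment (κ i) 0 := by
  have h := integral_cube_prod fun (i : Fin m) s => (1 + s) * (1 - s ^ 2) ^ (κ i - 1)
  unfold wprod
  rw [h]
  refine prod_congr rfl fun i _ => ?_
  have h1 : IntegrableOn (fun s : ℝ => s ^ 0 * (1 - s ^ 2) ^ (κ i - 1)) (Set.Icc (-1) 1) := by
    simpa using integrableOn_jacobi (hκ i)
  have h2 : IntegrableOn (fun s : ℝ => s ^ 1 * (1 - s ^ 2) ^ (κ i - 1)) (Set.Icc (-1) 1) :=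
    (integrableOn_jacobi (hκ i)).continuousOn_mul (by fun_prop) isCompact_Icc
  have h3 : ∀ s : ℝ, (1 + s) * (1 - s ^ 2) ^ (κ i - 1) =
      s ^ 0 * (1 - s ^ 2) ^ (κ i - 1) + s ^ 1 * (1 - s ^ 2) ^ (κ i - 1) := fun s => by ring
  simp only [h3]
  rw [integral_add h1 h2]
  have h4 := jacMoment_odd (q := κ i) (a := 1) (by decide)
  rw [jacMoment] at h4
  rw [h4, add_zero, jacMoment]

lemma integral_gegenC_mul_wprod (hκ : ∀ i, 0 < κ i) {l : ℝ} (hl : 0 < l) (n : ℕ) (z : Fin m → ℝ) :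
    ∫ t in cube m, gegenC n l (∑ i, z i * t i) * wprod κ t =
      ∑ S ∈ (univ : Finset (Fin m)).powerset, zonInt κ n l (indVec S) z := by
  unfold zonInt
  rw [← integral_finsetSum]
  · congr 1
    ext t
    rw [wprod_eq, mul_sum]
    exact sum_congr rfl fun S _ => by ring
  · intro S _
    have := continuous_gegenC hl n
    exact integrableOn_mul_jacW hκ (by fun_prop)

lemma abs_zonInt_congr (hκ : ∀ i, 0 < κ i) {l : ℝ} (hl : 0 < l) {s : Fin m → ℕ}
    (hs : ∀ i, s i ≤ 1) (n : ℕ) {z w : Fin m → ℝ} (h : ∀ i, |z i| = |w i|) :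
    |zonInt κ n l s z| = |zonInt κ n l s w| := by
  by_cases hn : ∀ k, n ≠ 2 * k + ∑ i, s i
  · rw [zonInt_eq_zero hκ hl hs hn, zonInt_eq_zero hκ hl hs hn]
  push Not at hn
  obtain ⟨k, rfl⟩ := hn
  rw [zonInt_eq hκ hl hs, zonInt_eq hκ hl hs]
  simp only [abs_mul, abs_prod, abs_div, abs_pow, h]
  simp only [fun i => (sq_eq_sq_iff_abs_eq_abs (z i) (w i)).2 (h i)]

lemma continuous_zonInt (hκ : ∀ i, 0 < κ i) {l : ℝ} (hl : 0 < l) {s : Fin m → ℕ}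
    (hs : ∀ i, s i ≤ 1) (n : ℕ) : Continuous (zonInt κ n l s) := by
  by_cases hn : ∀ k, n ≠ 2 * k + ∑ i, s i
  · rw [funext fun z => zonInt_eq_zero hκ hl hs hn z]
    exact continuous_const
  push Not at hn
  obtain ⟨k, rfl⟩ := hn
  rw [funext fun z => zonInt_eq hκ hl hs k z]
  unfold zonR zon
  fun_prop
end KernelSplit

section Upper
variable {d : ℕ} {κ : Fin (d + 1) → ℝ}

lemma continuous_upper (i : Fin (d + 1)) :
    Continuous fun y : EuclideanSpace ℝ (Fin d) => upper y i := by
  unfold upper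
  induction i using Fin.lastCases with
  | last => simp only [liftB_last]; fun_prop
  | cast i => simp only [liftB_castSucc]; fun_prop

lemma hP_eq_sum (hκ : ∀ i, 0 < κ i) (hl : 0 < lamK d κ) (n : ℕ)
    (x y : EuclideanSpace ℝ (Fin (d + 1))) :
    hP d κ n x y = (∏ i, jacMoment (κ i) 0)⁻¹ * ((n + lamK d κ) / lamK d κ) *
      ∑ S ∈ (univ : Finset (Fin (d + 1))).powerset,
        zonInt κ n (lamK d κ) (indVec S) (fun i => x i * y i) := by
  rw [hP, integral_wprod hκ, integral_gegenC_mul_wprod hκ hl]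

lemma abs_lift_neg (y : EuclideanSpace ℝ (Fin d)) (s : ℝ) (i : Fin (d + 1)) :
    |liftB d y (-s) i| = |liftB d y s i| := by
  induction i using Fin.lastCases with
  | last => simp
  | cast i => simp

lemma jacMoment_prod_pos (hκ : ∀ i, 0 < κ i) : 0 < ∏ i, jacMoment (κ i) 0 :=
  prod_pos fun i _ => jacMoment_zero_pos (hκ i)

lemma abs_ballP_le (hκ : ∀ i, 0 < κ i) (hl : 0 < lamK d κ) (n : ℕ)
    (x y : EuclideanSpace ℝ (Fin d)) :
    |ballP d κ n x y| ≤ (∏ i, jacMoment (κ i) 0)⁻¹ * ((n + lamK d κ) / lamK d κ) *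
      ∑ S ∈ (univ : Finset (Fin (d + 1))).powerset,
        |zonInt κ n (lamK d κ) (indVec S) (fun i => upper x i * upper y i)| := by
  have hE := jacMoment_prod_pos hκ
  set c := (∏ i, jacMoment (κ i) 0)⁻¹ * ((n + lamK d κ) / lamK d κ) with hc
  have hc0 : 0 ≤ c := by positivity
  have key : ∀ s : ℝ, (∀ i, |liftB d y s i| = |upper y i|) →
      |hP d κ n (liftB d x (√(1 - ‖x‖ ^ 2))) (liftB d y s)| ≤
      c * ∑ S ∈ (univ : Finset (Fin (d + 1))).powerset,
        |zonInt κ n (lamK d κ) (indVec S) (fun i => upper x i * upper y i)| := by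
    intro s hs
    rw [hP_eq_sum hκ hl, ← hc, abs_mul, abs_of_nonneg hc0]
    refine mul_le_mul_of_nonneg_left ((abs_sum_le_sum_abs _ _).trans (sum_le_sum fun S _ => ?_)) hc0
    refine (abs_zonInt_congr hκ hl (indVec_le_one S) n fun i => ?_).le
    rw [abs_mul, abs_mul, hs]
    rfl
  have h1 := key (√(1 - ‖y‖ ^ 2)) fun i => rfl
  have h2 := key (-√(1 - ‖y‖ ^ 2)) fun i => abs_lift_neg _ _ _
  rw [ballP, abs_div, abs_two]
  have h3 := abs_add_le (hP d κ n (liftB d x (√(1 - ‖x‖ ^ 2))) (liftB d y (√(1 - ‖y‖ ^ 2))))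
    (hP d κ n (liftB d x (√(1 - ‖x‖ ^ 2))) (liftB d y (-√(1 - ‖y‖ ^ 2))))
  linarith

lemma integral_abs_zonInt_le (hd : 1 ≤ d) (hκ : ∀ i, 0 < κ i) : ∃ C : ℝ, 0 < C ∧ ∀ n : ℕ, 1 ≤ n →
    ∀ x ∈ Metric.closedBall (0 : EuclideanSpace ℝ (Fin d)) 1, ∀ S : Finset (Fin (d + 1)),
      ∫ y in Metric.closedBall (0 : EuclideanSpace ℝ (Fin d)) 1,
        |zonInt κ n (lamK d κ) (indVec S) (fun i => upper x i * upper y i)| * WB d κ y ≤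
      C * (n : ℝ) ^ (sigmaK d κ - 1) := by
  have hl := lamK_pos hd hκ
  obtain ⟨C, hC, hdiag⟩ := diagonal_bound hd hκ
  have hE := jacMoment_prod_pos hκ
  have hM := integral_WB_pos hκ
  set M := ∫ y in Metric.closedBall (0 : EuclideanSpace ℝ (Fin d)) 1, WB d κ y with hMdef
  refine ⟨(M * (∏ i, jacMoment (κ i) 0) * lamK d κ * C + M) / 2, by positivity,
    fun n hn x hx S => ?_⟩
  have hn' : (0 : ℝ) < n := by exact_mod_cast hn
  set T := (n : ℝ) ^ (sigmaK d κ - 1) with hT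
  have hTpos : 0 < T := rpow_pos_of_pos hn' _
  set f : EuclideanSpace ℝ (Fin d) → ℝ := fun y =>
    zonInt κ n (lamK d κ) (indVec S) (fun i => upper x i * upper y i) with hf
  have hfc : Continuous f := (continuous_zonInt hκ hl (indVec_le_one S) n).comp
    (continuous_pi fun i => continuous_const.mul (continuous_upper i))
  have hi1 : IntegrableOn (fun y => WB d κ y * f y ^ 2) (Metric.closedBall 0 1) :=
    (integrableOn_WB hκ).mul_continuousOn (by fun_prop) (isCompact_closedBall _ _)
  have hle : ∫ y in Metric.closedBall (0 : EuclideanSpace ℝ (Fin d)) 1, |f y| * WB d κ y ≤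
      ∫ y in Metric.closedBall (0 : EuclideanSpace ℝ (Fin d)) 1,
        (1 / (2 * T) * (WB d κ y * f y ^ 2) + T / 2 * WB d κ y) := by
    refine integral_mono_of_nonneg
      ((ae_restrict_mem measurableSet_closedBall).mono fun y hy =>
        mul_nonneg (abs_nonneg _) (WB_nonneg hy))
      ((hi1.const_mul _).add ((integrableOn_WB hκ).const_mul _))
      ((ae_restrict_mem measurableSet_closedBall).mono fun y hy => ?_)
    have h1 : |f y| ≤ 1 / (2 * T) * f y ^ 2 + T / 2 := by
      have : 1 / (2 * T) * f y ^ 2 + T / 2 - |f y| = (|f y| - T) ^ 2 / (2 * T) := by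
        rw [← sq_abs (f y)]
        field_simp
        ring
      have h2 : 0 ≤ (|f y| - T) ^ 2 / (2 * T) := by positivity
      linarith
    have h3 := mul_le_mul_of_nonneg_right h1 (WB_nonneg (κ := κ) hy)
    simp only
    linarith
  rw [integral_add (hi1.const_mul _) ((integrableOn_WB hκ).const_mul _), integral_const_mul,
    integral_const_mul, ball_integral_zonInt_sq hκ hl (indVec_le_one S) hx n, ← hMdef] at hle
  have hz : zonInt κ n (lamK d κ) (indVec S) (fun i => upper x i ^ 2) ≤
      C * (n : ℝ) ^ (2 * sigmaK d κ - 1) := by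
    have h := hdiag n hn (fun i => upper x i ^ 2) (fun i => sq_nonneg _) (sum_upper_sq hx) S
    rw [zonInt]
    simp only [prod_pow_indVec]
    exact (le_abs_self _).trans h
  have hTT : (n : ℝ) ^ (2 * sigmaK d κ - 1) = n * T ^ 2 := by
    rw [hT, ← rpow_natCast, ← rpow_mul hn'.le]
    nth_rewrite 2 [← rpow_one (n : ℝ)]
    rw [← rpow_add hn']
    congr 1
    push_cast
    ring
  rw [hTT] at hz
  refine hle.trans ?_
  have h5 : lamK d κ / (lamK d κ + n) ≤ lamK d κ / n :=
    div_le_div_of_nonneg_left hl.le hn' (by linarith)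
  have h6 : lamK d κ / (lamK d κ + n) * zonInt κ n (lamK d κ) (indVec S) (fun i => upper x i ^ 2) ≤
      lamK d κ / n * (C * (n * T ^ 2)) :=
    (mul_le_mul_of_nonneg_left hz (by positivity)).trans
      (mul_le_mul_of_nonneg_right h5 (by positivity))
  have h7 : lamK d κ / n * (C * (n * T ^ 2)) = lamK d κ * C * T ^ 2 := by field_simp
  have h8 := mul_le_mul_of_nonneg_left (h7 ▸ h6)
    (show 0 ≤ 1 / (2 * T) * (M * ∏ i, jacMoment (κ i) 0) by positivity)
  have h9 : 1 / (2 * T) * (M * ∏ i, jacMoment (κ i) 0) * (lamK d κ * C * T ^ 2) =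
      M * (∏ i, jacMoment (κ i) 0) * lamK d κ * C / 2 * T := by
    field_simp
  linarith

/-- The uniform upper bound for the `L¹` norms of the projection kernels. -/
lemma ball_kernel_bound (hd : 1 ≤ d) (hκ : ∀ i, 0 < κ i) : ∃ C : ℝ, 0 < C ∧ ∀ n : ℕ, 1 ≤ n →
    ∀ x ∈ Metric.closedBall (0 : EuclideanSpace ℝ (Fin d)) 1,
      (∫ y in Metric.closedBall (0 : EuclideanSpace ℝ (Fin d)) 1, WB d κ y)⁻¹ *
        ∫ y in Metric.closedBall (0 : EuclideanSpace ℝ (Fin d)) 1, |ballP d κ n x y| * WB d κ y ≤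
      C * (n : ℝ) ^ sigmaK d κ := by
  have hl := lamK_pos hd hκ
  obtain ⟨C, hC, hz⟩ := integral_abs_zonInt_le hd hκ
  have hE := jacMoment_prod_pos hκ
  have hM := integral_WB_pos hκ
  set M := ∫ y in Metric.closedBall (0 : EuclideanSpace ℝ (Fin d)) 1, WB d κ y with hMdef
  set E := ∏ i, jacMoment (κ i) 0
  refine ⟨M⁻¹ * (E⁻¹ * ((1 + lamK d κ) / lamK d κ) * (2 ^ (d + 1) * C)), by positivity,
    fun n hn x hx => ?_⟩
  have hn1 : (1 : ℝ) ≤ n := by exact_mod_cast hn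
  have hn' : (0 : ℝ) < n := by linarith
  rw [mul_assoc]
  refine mul_le_mul_of_nonneg_left ?_ (by positivity)
  set c := E⁻¹ * ((n + lamK d κ) / lamK d κ) with hc
  have hfi : ∀ S : Finset (Fin (d + 1)), IntegrableOn (fun y =>
      |zonInt κ n (lamK d κ) (indVec S) (fun i => upper x i * upper y i)| * WB d κ y)
      (Metric.closedBall 0 1) := fun S => by
    have hfc := (continuous_zonInt hκ hl (indVec_le_one S) n).comp
      (continuous_pi fun i => (continuous_const (y := upper x i)).mul (continuous_upper i))
    exact (integrableOn_WB hκ).continuousOn_mul hfc.abs.continuousOn (isCompact_closedBall _ _)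
  have h1 : ∫ y in Metric.closedBall (0 : EuclideanSpace ℝ (Fin d)) 1,
      |ballP d κ n x y| * WB d κ y ≤ ∫ y in Metric.closedBall (0 : EuclideanSpace ℝ (Fin d)) 1,
        c * ∑ S ∈ (univ : Finset (Fin (d + 1))).powerset,
        |zonInt κ n (lamK d κ) (indVec S) (fun i => upper x i * upper y i)| * WB d κ y := by
    refine integral_mono_of_nonneg
      ((ae_restrict_mem measurableSet_closedBall).mono fun y hy =>
        mul_nonneg (abs_nonneg _) (WB_nonneg hy))
      ((integrable_finsetSum _ fun S _ => hfi S).const_mul _)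
      ((ae_restrict_mem measurableSet_closedBall).mono fun y hy => ?_)
    have h2 := mul_le_mul_of_nonneg_right (abs_ballP_le hκ hl n x y) (WB_nonneg (κ := κ) hy)
    rw [← hc, mul_assoc, sum_mul] at h2
    exact h2
  rw [integral_const_mul, integral_finsetSum _ fun S _ => hfi S] at h1
  have h2 : ∑ S ∈ (univ : Finset (Fin (d + 1))).powerset,
      ∫ y in Metric.closedBall (0 : EuclideanSpace ℝ (Fin d)) 1,
        |zonInt κ n (lamK d κ) (indVec S) (fun i => upper x i * upper y i)| * WB d κ y ≤
      2 ^ (d + 1) * (C * (n : ℝ) ^ (sigmaK d κ - 1)) := by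
    refine (sum_le_sum fun S _ => hz n hn x hx S).trans ?_
    rw [sum_const, card_powerset, card_univ, Fintype.card_fin, nsmul_eq_mul]
    push_cast
    exact le_rfl
  have h3 : c ≤ E⁻¹ * ((1 + lamK d κ) / lamK d κ) * n := by
    rw [hc, mul_assoc, div_mul_eq_mul_div]
    gcongr
    nlinarith
  have h4 : (n : ℝ) ^ sigmaK d κ = n * (n : ℝ) ^ (sigmaK d κ - 1) := by
    rw [rpow_sub_one hn'.ne']
    field_simp
  refine h1.trans ((mul_le_mul h3 h2 (sum_nonneg fun S _ => ?_) (by positivity)).trans_eq ?_)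
  · exact setIntegral_nonneg measurableSet_closedBall fun y hy =>
      mul_nonneg (abs_nonneg _) (WB_nonneg hy)
  · rw [h4]
    ring
end Upper

lemma integral_abs_ge_of_energy {a b N S : ℝ} {u v Q : ℝ → ℝ} (hab : a < b) (hN : 0 < N)
    (hS : 0 ≤ S) (hu : ∀ x ∈ Set.Icc a b, HasDerivAt u (v x) x)
    (hv : ∀ x ∈ Set.Icc a b, HasDerivAt v (-(Q x * u x)) x)
    (hQc : ContinuousOn Q (Set.Icc a b))
    (hQ1 : ∀ x ∈ Set.Icc a b, N ^ 2 / 2 ≤ Q x) (hQ2 : ∀ x ∈ Set.Icc a b, Q x ≤ 3 * N ^ 2 / 2)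
    (hE1 : ∀ x ∈ Set.Icc a b, S ^ 2 / 2 ≤ v x ^ 2 + Q x * u x ^ 2)
    (hE2 : ∀ x ∈ Set.Icc a b, v x ^ 2 + Q x * u x ^ 2 ≤ 2 * S ^ 2)
    (hNab : 24 ≤ N * (b - a)) : (b - a) * S ≤ 24 * N * ∫ x in a..b, |u x| := by
  have hIcc : Set.uIcc a b = Set.Icc a b := Set.uIcc_of_le hab.le
  have huc : ContinuousOn u (Set.Icc a b) := fun x hx => (hu x hx).continuousAt.continuousWithinAt
  have hvc : ContinuousOn v (Set.Icc a b) := fun x hx => (hv x hx).continuousAt.continuousWithinAt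
  have hua : ∀ x ∈ Set.Icc a b, N * |u x| ≤ 2 * S := fun x hx => by
    refine abs_le_of_sq_le_sq' ?_ (by positivity) |>.2
    rw [mul_pow, sq_abs]
    nlinarith [hE2 x hx, sq_nonneg (v x),
      mul_le_mul_of_nonneg_right (hQ1 x hx) (sq_nonneg (u x))]
  have hva : ∀ x ∈ Set.Icc a b, |v x| ≤ 3 / 2 * S := fun x hx => by
    refine abs_le_of_sq_le_sq' ?_ (by positivity) |>.2
    rw [sq_abs]
    nlinarith [hE2 x hx, sq_nonneg S,
      mul_le_mul_of_nonneg_right (hQ1 x hx) (sq_nonneg (u x)), mul_nonneg (sq_nonneg N) (sq_nonneg (u x))]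
  have huv : ∀ x ∈ Set.Icc a b, N * |u x * v x| ≤ 3 * S ^ 2 := fun x hx => by
    rw [abs_mul]
    have := mul_le_mul (hua x hx) (hva x hx) (abs_nonneg _) (by positivity)
    nlinarith
  have hi1 : IntervalIntegrable (fun x => v x ^ 2) volume a b :=
    (ContinuousOn.pow (by rwa [hIcc]) 2).intervalIntegrable
  have hi2 : IntervalIntegrable (fun x => Q x * u x ^ 2) volume a b :=
    (ContinuousOn.mul (by rwa [hIcc]) (ContinuousOn.pow (by rwa [hIcc]) 2)).intervalIntegrable
  have hi3 : IntervalIntegrable (fun x => |u x|) volume a b :=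
    (ContinuousOn.abs (by rwa [hIcc])).intervalIntegrable
  have h1 : ∫ x in a..b, (v x ^ 2 - Q x * u x ^ 2) = u b * v b - u a * v a :=
    intervalIntegral.integral_eq_sub_of_hasDerivAt (f := fun x => u x * v x) (fun x hx => by
      rw [hIcc] at hx
      refine ((hu x hx).mul (hv x hx)).congr_deriv ?_
      ring) (hi1.sub hi2)
  have h2 : ∫ _ in a..b, S ^ 2 / 2 ≤ ∫ x in a..b, (v x ^ 2 + Q x * u x ^ 2) :=
    intervalIntegral.integral_mono_on hab.le intervalIntegrable_const (hi1.add hi2) hE1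
  have h3 : ∫ x in a..b, Q x * u x ^ 2 ≤ ∫ x in a..b, 3 * N * S * |u x| :=
    intervalIntegral.integral_mono_on hab.le hi2 (hi3.const_mul _) fun x hx => by
      have e1 := mul_le_mul_of_nonneg_right (hQ2 x hx) (sq_nonneg (u x))
      have e2 := mul_le_mul_of_nonneg_right (hua x hx) (abs_nonneg (u x))
      have e3 := mul_le_mul_of_nonneg_left e2 hN.le
      rw [← sq_abs] at e1 ⊢
      nlinarith
  rw [intervalIntegral.integral_sub hi1 hi2] at h1
  rw [intervalIntegral.integral_add hi1 hi2, intervalIntegral.integral_const, smul_eq_mul] at h2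
  rw [intervalIntegral.integral_const_mul] at h3
  have h4 := huv a ⟨le_rfl, hab.le⟩
  have h5 := huv b ⟨hab.le, le_rfl⟩
  have h6 : N * (u b * v b - u a * v a) ≤ 6 * S ^ 2 := by
    have e1 := mul_le_mul_of_nonneg_left (le_abs_self (u b * v b)) hN.le
    have e2 := mul_le_mul_of_nonneg_left (neg_abs_le (u a * v a)) hN.le
    linarith
  rcases hS.eq_or_lt with h0 | h0
  · rw [← h0, mul_zero]
    have := intervalIntegral.integral_nonneg hab.le (f := fun x => |u x|) (μ := volume)
      fun x _ => abs_nonneg _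
    positivity
  · set I := ∫ x in a..b, |u x|
    set A := ∫ x in a..b, v x ^ 2
    set B := ∫ x in a..b, Q x * u x ^ 2
    have h7 : N * ((b - a) * (S ^ 2 / 2)) ≤ N * (6 * N * S * I) + 6 * S ^ 2 := by
      have : N * ((b - a) * (S ^ 2 / 2)) ≤ N * (A + B) := by gcongr
      have e2 : N * B ≤ N * (3 * N * S * I) := by gcongr
      have e3 : N * (A - B) ≤ 6 * S ^ 2 := by rw [h1]; exact h6
      linarith
    have h8 : 24 * (S ^ 2 / 4) ≤ N * (b - a) * (S ^ 2 / 4) := by gcongr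
    have h9 : (N * S) * ((b - a) * S) ≤ (N * S) * (24 * N * I) := by nlinarith
    exact le_of_mul_le_mul_left h9 (by positivity)

section Oscillation
variable {κ σ N : ℝ} {R R1 R2 : ℝ → ℝ}

lemma hasDerivAt_comp_sin (hR : ∀ y, HasDerivAt R (R1 y) y) (φ : ℝ) :
    HasDerivAt (fun φ => R (sin φ)) (cos φ * R1 (sin φ)) φ := by
  refine ((hR (sin φ)).comp φ (hasDerivAt_sin φ)).congr_deriv ?_
  ring

lemma hasDerivAt_cos_mul_comp_sin (hR1 : ∀ y, HasDerivAt R1 (R2 y) y)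
    (hode : ∀ y, y * (1 - y ^ 2) * R2 y + (2 * κ - (2 * (κ + σ) + 1) * y ^ 2) * R1 y +
      N ^ 2 * y * R y = 0) {φ : ℝ} (h0 : 0 < φ) (h1 : φ < π / 2) :
    HasDerivAt (fun φ => cos φ * R1 (sin φ))
      (-2 * (κ * cos φ / sin φ - σ * sin φ / cos φ) * (cos φ * R1 (sin φ)) -
        N ^ 2 * R (sin φ)) φ := by
  have hs : 0 < sin φ := sin_pos_of_pos_of_lt_pi h0 (by linarith [pi_pos])
  have hc : 0 < cos φ := cos_pos_of_mem_Ioo ⟨by linarith [pi_pos], h1⟩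
  refine ((hasDerivAt_cos φ).mul ((hR1 (sin φ)).comp φ (hasDerivAt_sin φ))).congr_deriv ?_
  simp only [Function.comp]
  have h2 := hode (sin φ)
  have h3 : cos φ ^ 2 = 1 - sin φ ^ 2 := by rw [← cos_sq']
  generalize R2 (sin φ) = r2 at *
  generalize R1 (sin φ) = r1 at *
  generalize R (sin φ) = r at *
  generalize sin φ = s at *
  generalize cos φ = c at *
  field_simp
  linear_combination h2 + (s * r2 + 2 * r1 * κ) * h3

/-- The derivative of the energy of a solution. -/
lemma hasDerivAt_sin_energy (hR : ∀ y, HasDerivAt R (R1 y) y)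
    (hR1 : ∀ y, HasDerivAt R1 (R2 y) y)
    (hode : ∀ y, y * (1 - y ^ 2) * R2 y + (2 * κ - (2 * (κ + σ) + 1) * y ^ 2) * R1 y +
      N ^ 2 * y * R y = 0) {φ : ℝ} (h0 : 0 < φ) (h1 : φ < π / 2) :
    HasDerivAt (fun φ => (cos φ * R1 (sin φ)) ^ 2 + N ^ 2 * R (sin φ) ^ 2)
      (-4 * (κ * cos φ / sin φ - σ * sin φ / cos φ) * (cos φ * R1 (sin φ)) ^ 2) φ := by
  refine (((hasDerivAt_cos_mul_comp_sin hR1 hode h0 h1).pow 2).add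
    (((hasDerivAt_comp_sin hR φ).pow 2).const_mul (N ^ 2))).congr_deriv ?_
  norm_num
  ring

/-- Near the origin the solution stays comparable to its initial value. -/
lemma half_abs_le_of_ode (hκ : 0 < κ) (hσ : 0 < σ) (hN : 1 ≤ N) (hN2 : κ + σ ≤ 4 * κ * N ^ 2)
    (hR : ∀ y, HasDerivAt R (R1 y) y) (hR1 : ∀ y, HasDerivAt R1 (R2 y) y)
    (hode : ∀ y, y * (1 - y ^ 2) * R2 y + (2 * κ - (2 * (κ + σ) + 1) * y ^ 2) * R1 y +
      N ^ 2 * y * R y = 0) (hR10 : R1 0 = 0) :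
    |R 0| / 2 ≤ |R (sin (1 / (2 * N)))| := by
  have hN0 : 0 < N := by linarith
  set a := 1 / (2 * N) with ha
  have ha0 : 0 < a := by positivity
  have ha1 : a ≤ 1 / 2 := by
    rw [ha]
    gcongr
    linarith
  have hpi := pi_gt_three
  have hanti : AntitoneOn (fun φ => (cos φ * R1 (sin φ)) ^ 2 + N ^ 2 * R (sin φ) ^ 2)
      (Set.Icc 0 a) := by
    have hRc : Continuous R := continuous_iff_continuousAt.2 fun y => (hR y).continuousAt
    have hR1c : Continuous R1 := continuous_iff_continuousAt.2 fun y => (hR1 y).continuousAt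
    refine antitoneOn_of_hasDerivWithinAt_nonpos (convex_Icc 0 a) (by fun_prop)
      (f' := fun φ => -4 * (κ * cos φ / sin φ - σ * sin φ / cos φ) * (cos φ * R1 (sin φ)) ^ 2)
      (fun φ hφ => ?_) fun φ hφ => ?_
    · rw [interior_Icc] at hφ
      exact (hasDerivAt_sin_energy hR hR1 hode hφ.1 (by linarith [hφ.2])).hasDerivWithinAt
    · rw [interior_Icc] at hφ
      have hs : 0 < sin φ := sin_pos_of_pos_of_lt_pi hφ.1 (by linarith [hφ.2])
      have hc : 0 < cos φ := cos_pos_of_mem_Ioo ⟨by linarith [hφ.1], by linarith [hφ.2]⟩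
      have h3 : cos φ ^ 2 = 1 - sin φ ^ 2 := by rw [← cos_sq']
      have h4 : sin φ ≤ a := (sin_le hφ.1.le).trans hφ.2.le
      have h5 : (κ + σ) * sin φ ^ 2 ≤ κ := by
        have : sin φ ^ 2 ≤ a ^ 2 := by gcongr
        have h6 : (κ + σ) * a ^ 2 ≤ κ := by
          rw [ha, div_pow, one_pow, mul_one_div, div_le_iff₀ (by positivity)]
          linarith
        exact (mul_le_mul_of_nonneg_left this (by positivity)).trans h6
      have h6 : 0 ≤ κ * cos φ / sin φ - σ * sin φ / cos φ := by
        rw [sub_nonneg, div_le_div_iff₀ hc hs, mul_assoc κ, ← sq, h3]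
        linarith
      have h7 := mul_nonneg h6 (sq_nonneg (cos φ * R1 (sin φ)))
      linarith
  have hbd : ∀ φ ∈ Set.Icc 0 a, |cos φ * R1 (sin φ)| ≤ N * |R 0| := fun φ hφ => by
    have := hanti ⟨le_rfl, ha0.le⟩ hφ hφ.1
    simp only [cos_zero, sin_zero, hR10, mul_zero] at this
    refine abs_le_of_sq_le_sq' ?_ (by positivity) |>.2
    rw [mul_pow, sq_abs, sq_abs]
    nlinarith [mul_nonneg (sq_nonneg N) (sq_nonneg (R (sin φ)))]
  have := norm_image_sub_le_of_norm_deriv_le_segment' (a := 0) (b := a)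
    (f := fun φ => R (sin φ)) (C := N * |R 0|)
    (fun φ _ => (hasDerivAt_comp_sin hR φ).hasDerivWithinAt)
    (fun φ hφ => hbd φ ⟨hφ.1, hφ.2.le⟩) a ⟨ha0.le, le_rfl⟩
  simp only [sin_zero, sub_zero, norm_eq_abs] at this
  have h8 : N * |R 0| * a = |R 0| / 2 := by
    rw [ha]
    field_simp
  have h9 := abs_sub_abs_le_abs_sub (R 0) (R (sin a))
  rw [abs_sub_comm] at h9
  linarith

lemma monotoneOn_sin_energy (hκ : 0 < κ) (hσ : 0 < σ)
    (hR : ∀ y, HasDerivAt R (R1 y) y) (hR1 : ∀ y, HasDerivAt R1 (R2 y) y)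
    (hode : ∀ y, y * (1 - y ^ 2) * R2 y + (2 * κ - (2 * (κ + σ) + 1) * y ^ 2) * R1 y +
      N ^ 2 * y * R y = 0) :
    MonotoneOn (fun φ => sin φ ^ (4 * κ) *
      ((cos φ * R1 (sin φ)) ^ 2 + N ^ 2 * R (sin φ) ^ 2)) (Set.Ioo 0 (π / 2)) := by
  have hd : ∀ φ ∈ Set.Ioo 0 (π / 2), HasDerivAt (fun φ => sin φ ^ (4 * κ) *
      ((cos φ * R1 (sin φ)) ^ 2 + N ^ 2 * R (sin φ) ^ 2))
      (4 * sin φ ^ (4 * κ) * (κ * (cos φ / sin φ) * (N ^ 2 * R (sin φ) ^ 2) +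
        σ * (sin φ / cos φ) * (cos φ * R1 (sin φ)) ^ 2)) φ := fun φ hφ => by
    have hs : 0 < sin φ := sin_pos_of_pos_of_lt_pi hφ.1 (by linarith [hφ.2, pi_pos])
    refine (((hasDerivAt_sin φ).rpow_const (p := 4 * κ) (Or.inl hs.ne')).mul
      (hasDerivAt_sin_energy hR hR1 hode hφ.1 hφ.2)).congr_deriv ?_
    rw [rpow_sub_one hs.ne']
    ring
  refine monotoneOn_of_hasDerivWithinAt_nonneg (convex_Ioo 0 (π / 2))
    (f' := fun φ => 4 * sin φ ^ (4 * κ) * (κ * (cos φ / sin φ) * (N ^ 2 * R (sin φ) ^ 2) +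
        σ * (sin φ / cos φ) * (cos φ * R1 (sin φ)) ^ 2))
    (fun φ hφ => (hd φ hφ).continuousAt.continuousWithinAt) (fun φ hφ => ?_) fun φ hφ => ?_
  · rw [interior_Ioo] at hφ
    exact (hd φ hφ).hasDerivWithinAt
  · rw [interior_Ioo] at hφ
    have hs : 0 < sin φ := sin_pos_of_pos_of_lt_pi hφ.1 (by linarith [hφ.2, pi_pos])
    have hc : 0 < cos φ := cos_pos_of_mem_Ioo ⟨by linarith [hφ.1, pi_pos], hφ.2⟩
    positivity

/-- The energy at distance `K / N` from the origin. -/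
lemma sin_energy_ge (hκ : 0 < κ) (hσ : 0 < σ) (hN : 1 ≤ N) (hN2 : κ + σ ≤ 4 * κ * N ^ 2)
    (hR : ∀ y, HasDerivAt R (R1 y) y) (hR1 : ∀ y, HasDerivAt R1 (R2 y) y)
    (hode : ∀ y, y * (1 - y ^ 2) * R2 y + (2 * κ - (2 * (κ + σ) + 1) * y ^ 2) * R1 y +
      N ^ 2 * y * R y = 0) (hR10 : R1 0 = 0) {K : ℝ} (hK : 1 ≤ K) (hKN : K / N < π / 2) :
    (1 / (π * K)) ^ (4 * κ) * (N ^ 2 * R 0 ^ 2 / 4) ≤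
      (cos (K / N) * R1 (sin (K / N))) ^ 2 + N ^ 2 * R (sin (K / N)) ^ 2 := by
  have hN0 : 0 < N := by linarith
  have hpi := pi_gt_three
  have hab : 1 / (2 * N) ≤ K / N := by
    rw [div_le_div_iff₀ (by positivity) hN0]
    nlinarith
  have ha0 : 0 < 1 / (2 * N) := by positivity
  have hb0 : 0 < K / N := by positivity
  have h1 := half_abs_le_of_ode hκ hσ hN hN2 hR hR1 hode hR10
  have h2 := monotoneOn_sin_energy hκ hσ hR hR1 hode ⟨ha0, by linarith⟩ ⟨hb0, hKN⟩ hab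
  simp only at h2
  have h3 : R 0 ^ 2 / 4 ≤ R (sin (1 / (2 * N))) ^ 2 := by
    rw [← sq_abs (R 0), ← sq_abs (R (sin _))]
    have : (|R 0| / 2) ^ 2 ≤ |R (sin (1 / (2 * N)))| ^ 2 := by gcongr
    linarith
  have hsb : 0 < sin (K / N) := sin_pos_of_pos_of_lt_pi hb0 (by linarith)
  have h4 : 1 / (π * K) * sin (K / N) ≤ sin (1 / (2 * N)) := by
    have e1 := mul_le_sin ha0.le (by linarith)
    have e2 := sin_le hb0.le
    refine le_trans ?_ e1
    refine (mul_le_mul_of_nonneg_left e2 (by positivity)).trans_eq ?_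
    field_simp
  have h5 : (1 / (π * K)) ^ (4 * κ) * sin (K / N) ^ (4 * κ) ≤ sin (1 / (2 * N)) ^ (4 * κ) := by
    rw [← mul_rpow (by positivity) hsb.le]
    exact rpow_le_rpow (by positivity) h4 (by positivity)
  have h6 : 0 < sin (K / N) ^ (4 * κ) := rpow_pos_of_pos hsb _
  refine le_of_mul_le_mul_left ?_ h6
  refine le_trans ?_ h2
  have h7 : N ^ 2 * R 0 ^ 2 / 4 ≤ (cos (1 / (2 * N)) * R1 (sin (1 / (2 * N)))) ^ 2 +
      N ^ 2 * R (sin (1 / (2 * N))) ^ 2 := by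
    have := mul_le_mul_of_nonneg_left h3 (sq_nonneg N)
    nlinarith [sq_nonneg (cos (1 / (2 * N)) * R1 (sin (1 / (2 * N))))]
  refine le_trans (le_of_eq ?_) (mul_le_mul h5 h7 (by positivity) ((by positivity : (0 : ℝ) ≤
    (1 / (π * K)) ^ (4 * κ) * sin (K / N) ^ (4 * κ)).trans h5))
  ring
end Oscillation

section Liouville
variable {κ σ N : ℝ} {R R1 R2 : ℝ → ℝ}

/-- The logarithmic derivative of `sin ^ κ * cos ^ σ`. -/
noncomputable def trigLog (κ σ φ : ℝ) : ℝ := κ * cos φ / sin φ - σ * sin φ / cos φ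

/-- The potential of the Liouville normal form. -/
noncomputable def trigPot (κ σ N φ : ℝ) : ℝ :=
  N ^ 2 + (κ + σ) ^ 2 - κ * (κ - 1) / sin φ ^ 2 - σ * (σ - 1) / cos φ ^ 2

/-- The derivative of `trigPot`. -/
noncomputable def trigPotDeriv (κ σ φ : ℝ) : ℝ :=
  2 * (κ * (κ - 1)) * cos φ / sin φ ^ 3 - 2 * (σ * (σ - 1)) * sin φ / cos φ ^ 3

lemma hasDerivAt_trigWeight {φ : ℝ} (hs : 0 < sin φ) (hc : 0 < cos φ) :
    HasDerivAt (fun φ => sin φ ^ κ * cos φ ^ σ) (sin φ ^ κ * cos φ ^ σ * trigLog κ σ φ) φ := by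
  refine (((hasDerivAt_sin φ).rpow_const (p := κ) (Or.inl hs.ne')).mul
    ((hasDerivAt_cos φ).rpow_const (p := σ) (Or.inl hc.ne'))).congr_deriv ?_
  rw [rpow_sub_one hs.ne', rpow_sub_one hc.ne', trigLog]
  ring

lemma hasDerivAt_trigLog {φ : ℝ} (hs : 0 < sin φ) (hc : 0 < cos φ) :
    HasDerivAt (trigLog κ σ) (-κ / sin φ ^ 2 - σ / cos φ ^ 2) φ := by
  have h1 := ((hasDerivAt_cos φ).const_mul κ).div (hasDerivAt_sin φ) hs.ne'
  have h2 := ((hasDerivAt_sin φ).const_mul σ).div (hasDerivAt_cos φ) hc.ne'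
  refine (h1.sub h2).congr_deriv ?_
  have h3 : sin φ ^ 2 = 1 - cos φ ^ 2 := sin_sq φ
  have h4 : κ * -sin φ * sin φ - κ * cos φ * cos φ = -κ := by linear_combination (-κ) * h3
  have h5 : σ * cos φ * cos φ - σ * sin φ * -sin φ = σ := by linear_combination σ * h3
  rw [h4, h5]

lemma hasDerivAt_trigPot {φ : ℝ} (hs : 0 < sin φ) (hc : 0 < cos φ) :
    HasDerivAt (trigPot κ σ N) (trigPotDeriv κ σ φ) φ := by
  have h1 := (hasDerivAt_const φ (κ * (κ - 1))).div ((hasDerivAt_sin φ).pow 2) (pow_pos hs 2).ne'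
  have h2 := (hasDerivAt_const φ (σ * (σ - 1))).div ((hasDerivAt_cos φ).pow 2) (pow_pos hc 2).ne'
  refine ((h1.const_sub (N ^ 2 + (κ + σ) ^ 2)).sub h2).congr_deriv ?_
  simp only [trigPotDeriv, Pi.pow_apply]
  field_simp
  norm_num
  ring

lemma hasDerivAt_liouville (hR : ∀ y, HasDerivAt R (R1 y) y) {φ : ℝ} (hs : 0 < sin φ)
    (hc : 0 < cos φ) : HasDerivAt (fun φ => sin φ ^ κ * cos φ ^ σ * R (sin φ))
      (sin φ ^ κ * cos φ ^ σ * (cos φ * R1 (sin φ) + trigLog κ σ φ * R (sin φ))) φ := by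
  refine ((hasDerivAt_trigWeight hs hc).mul (hasDerivAt_comp_sin hR φ)).congr_deriv ?_
  ring

lemma hasDerivAt_liouville_deriv (hR : ∀ y, HasDerivAt R (R1 y) y)
    (hR1 : ∀ y, HasDerivAt R1 (R2 y) y)
    (hode : ∀ y, y * (1 - y ^ 2) * R2 y + (2 * κ - (2 * (κ + σ) + 1) * y ^ 2) * R1 y +
      N ^ 2 * y * R y = 0) {φ : ℝ} (h0 : 0 < φ) (h1 : φ < π / 2) :
    HasDerivAt (fun φ => sin φ ^ κ * cos φ ^ σ *
        (cos φ * R1 (sin φ) + trigLog κ σ φ * R (sin φ)))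
      (-(trigPot κ σ N φ * (sin φ ^ κ * cos φ ^ σ * R (sin φ)))) φ := by
  have hs : 0 < sin φ := sin_pos_of_pos_of_lt_pi h0 (by linarith [pi_pos])
  have hc : 0 < cos φ := cos_pos_of_mem_Ioo ⟨by linarith [pi_pos], h1⟩
  have h5 := hasDerivAt_cos_mul_comp_sin hR1 hode h0 h1
  rw [← trigLog] at h5
  refine ((hasDerivAt_trigWeight hs hc).mul (h5.add
    ((hasDerivAt_trigLog hs hc).mul (hasDerivAt_comp_sin hR φ)))).congr_deriv ?_
  have h3 : trigLog κ σ φ ^ 2 =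
      κ ^ 2 / sin φ ^ 2 + σ ^ 2 / cos φ ^ 2 - (κ + σ) ^ 2 := by
    have h4 : cos φ ^ 2 = 1 - sin φ ^ 2 := cos_sq' φ
    rw [trigLog]
    generalize sin φ = s at *
    generalize cos φ = c at *
    field_simp
    linear_combination (κ ^ 2 * c ^ 2 + σ ^ 2 * s ^ 2) * h4
  simp only [Pi.add_apply, Pi.mul_apply, trigPot]
  linear_combination (sin φ ^ κ * cos φ ^ σ * R (sin φ)) * h3

lemma trigPot_bounds (hκ : 0 < κ) (hσ : 0 < σ) {φ₂ : ℝ} (h0 : 0 < φ₂) (h2 : φ₂ < π / 2) :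
    ∃ B : ℝ, 0 < B ∧ ∀ N φ : ℝ, 0 < φ → φ ≤ φ₂ →
      |trigPot κ σ N φ - N ^ 2| ≤ B / φ ^ 2 ∧ |trigPotDeriv κ σ φ| ≤ B / φ ^ 3 := by
  have hpi := pi_lt_d2
  have hc2 : 0 < cos φ₂ := cos_pos_of_mem_Ioo ⟨by linarith [pi_pos], h2⟩
  set A := |κ * (κ - 1)| with hA
  set D := |σ * (σ - 1)| with hD
  have hA0 : 0 ≤ A := abs_nonneg _
  have hD0 : 0 ≤ D := abs_nonneg _
  refine ⟨16 * ((κ + σ) ^ 2 + A + D / cos φ₂ ^ 3), by positivity, fun N φ hφ0 hφ2 => ?_⟩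
  have hcc : cos φ₂ ≤ cos φ := cos_le_cos_of_nonneg_of_le_pi hφ0.le (by linarith [pi_pos]) hφ2
  have hc : 0 < cos φ := hc2.trans_le hcc
  have hs : 0 < sin φ := sin_pos_of_pos_of_lt_pi hφ0 (by linarith [pi_pos])
  have hsφ : φ / 2 ≤ sin φ := by
    refine le_trans ?_ (mul_le_sin hφ0.le (by linarith))
    rw [div_mul_eq_mul_div, div_le_div_iff₀ (by positivity) pi_pos]
    nlinarith
  have hφ1 : φ ≤ 2 := by linarith
  have i1 : 1 / sin φ ^ 2 ≤ 4 / φ ^ 2 := by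
    rw [div_le_div_iff₀ (by positivity) (by positivity)]
    have : (φ / 2) ^ 2 ≤ sin φ ^ 2 := by gcongr
    linarith
  have i2 : 1 / sin φ ^ 3 ≤ 8 / φ ^ 3 := by
    rw [div_le_div_iff₀ (by positivity) (by positivity)]
    have : (φ / 2) ^ 3 ≤ sin φ ^ 3 := by gcongr
    linarith
  have i3 : 1 / cos φ ^ 3 ≤ 1 / cos φ₂ ^ 3 := by gcongr
  have i4 : 1 / cos φ ^ 2 ≤ 1 / cos φ₂ ^ 3 := by
    refine le_trans ?_ i3
    exact one_div_le_one_div_of_le (by positivity)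
      (pow_le_pow_of_le_one hc.le (cos_le_one φ) (by norm_num))
  have i5 : 1 ≤ 4 / φ ^ 2 := by
    rw [le_div_iff₀ (by positivity)]
    nlinarith
  have i6 : 1 ≤ 8 / φ ^ 3 := by
    rw [le_div_iff₀ (by positivity), one_mul]
    calc φ ^ 3 ≤ 2 ^ 3 := by gcongr
      _ = 8 := by norm_num
  have hT : 0 ≤ D / cos φ₂ ^ 3 := by positivity
  have hl : 0 ≤ (κ + σ) ^ 2 := sq_nonneg _
  constructor
  · have e : trigPot κ σ N φ - N ^ 2 = (κ + σ) ^ 2 - κ * (κ - 1) * (1 / sin φ ^ 2) -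
        σ * (σ - 1) * (1 / cos φ ^ 2) := by
      rw [trigPot]
      ring
    have e1 : |κ * (κ - 1) * (1 / sin φ ^ 2)| ≤ A * (4 / φ ^ 2) := by
      rw [abs_mul, ← hA, abs_of_pos (show 0 < 1 / sin φ ^ 2 by positivity)]
      gcongr
    have e2 : |σ * (σ - 1) * (1 / cos φ ^ 2)| ≤ D / cos φ₂ ^ 3 := by
      rw [abs_mul, ← hD, abs_of_pos (show 0 < 1 / cos φ ^ 2 by positivity),
        div_eq_mul_one_div D]
      exact mul_le_mul_of_nonneg_left i4 hD0
    rw [e]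
    have e3 := abs_sub ((κ + σ) ^ 2 - κ * (κ - 1) * (1 / sin φ ^ 2)) (σ * (σ - 1) * (1 / cos φ ^ 2))
    have e4 := abs_sub ((κ + σ) ^ 2) (κ * (κ - 1) * (1 / sin φ ^ 2))
    rw [abs_of_nonneg hl] at e4
    have e5 := mul_le_mul_of_nonneg_left i5 hT
    have e6 := mul_le_mul_of_nonneg_left i5 hl
    have e7 : 16 * ((κ + σ) ^ 2 + A + D / cos φ₂ ^ 3) / φ ^ 2 =
      4 * (((κ + σ) ^ 2 + A + D / cos φ₂ ^ 3) * (4 / φ ^ 2)) := by ring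
    rw [e7]
    have e8 : 0 ≤ ((κ + σ) ^ 2 + A + D / cos φ₂ ^ 3) * (4 / φ ^ 2) := by positivity
    linarith
  · have e : trigPotDeriv κ σ φ = 2 * (κ * (κ - 1) * (cos φ * (1 / sin φ ^ 3))) -
        2 * (σ * (σ - 1) * (sin φ * (1 / cos φ ^ 3))) := by
      rw [trigPotDeriv]
      ring
    have e1 : |κ * (κ - 1) * (cos φ * (1 / sin φ ^ 3))| ≤ A * (1 * (8 / φ ^ 3)) := by
      rw [abs_mul, ← hA, abs_of_pos (show 0 < cos φ * (1 / sin φ ^ 3) by positivity)]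
      gcongr
      exact cos_le_one φ
    have e2 : |σ * (σ - 1) * (sin φ * (1 / cos φ ^ 3))| ≤ D * (1 * (1 / cos φ₂ ^ 3)) := by
      rw [abs_mul, ← hD, abs_of_pos (show 0 < sin φ * (1 / cos φ ^ 3) by positivity)]
      gcongr
      exact sin_le_one φ
    rw [e]
    have e3 := abs_sub (2 * (κ * (κ - 1) * (cos φ * (1 / sin φ ^ 3))))
      (2 * (σ * (σ - 1) * (sin φ * (1 / cos φ ^ 3))))
    rw [abs_mul, abs_mul 2, abs_two] at e3
    rw [one_mul, ← div_eq_mul_one_div D] at e2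
    have e5 := mul_le_mul_of_nonneg_left i6 hT
    have e7 : 16 * ((κ + σ) ^ 2 + A + D / cos φ₂ ^ 3) / φ ^ 3 =
      2 * (((κ + σ) ^ 2 + A + D / cos φ₂ ^ 3) * (8 / φ ^ 3)) := by ring
    rw [e7]
    have e8 : 0 ≤ (κ + σ) ^ 2 * (8 / φ ^ 3) := by positivity
    linarith
end Liouville

section LowerOscillation
variable {κ σ : ℝ}

lemma exp_half_le_two {x : ℝ} (hx : x ≤ 1 / 2) : exp x ≤ 2 := by
  have h1 : exp (1 / 2) ^ 2 < 2 ^ 2 := by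
    rw [← exp_nat_mul]
    norm_num
    linarith [exp_one_lt_d9]
  exact (exp_le_exp.2 hx).trans (abs_lt_of_sq_lt_sq' h1 (by norm_num)).2.le

lemma trigPot_mem {B N K φ₂ φ : ℝ} (hN : 0 < N) (hK0 : 0 < K) (hK : 2 * B ≤ K ^ 2)
    (hB : ∀ N φ : ℝ, 0 < φ → φ ≤ φ₂ →
      |trigPot κ σ N φ - N ^ 2| ≤ B / φ ^ 2 ∧ |trigPotDeriv κ σ φ| ≤ B / φ ^ 3)
    (h1 : K / N ≤ φ) (h2 : φ ≤ φ₂) :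
    N ^ 2 / 2 ≤ trigPot κ σ N φ ∧ trigPot κ σ N φ ≤ 3 * N ^ 2 / 2 := by
  have hφ : 0 < φ := (div_pos hK0 hN).trans_le h1
  have h3 := abs_le.1 (hB N φ hφ h2).1
  have h4 : B / φ ^ 2 ≤ N ^ 2 / 2 := by
    rw [div_le_iff₀ (by positivity)]
    rw [div_le_iff₀ hN] at h1
    have : K ^ 2 ≤ (φ * N) ^ 2 := by gcongr
    nlinarith
  constructor <;> linarith [h3.1, h3.2]

/-- The energy of the Liouville normal form is essentially constant. -/
lemma liouville_energy {B N K φ₂ φ : ℝ} {u v : ℝ → ℝ} (hN : 0 < N) (hK0 : 0 < K)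
    (hB0 : 0 < B) (hK : 2 * B ≤ K ^ 2)
    (hB : ∀ N φ : ℝ, 0 < φ → φ ≤ φ₂ →
      |trigPot κ σ N φ - N ^ 2| ≤ B / φ ^ 2 ∧ |trigPotDeriv κ σ φ| ≤ B / φ ^ 3)
    (hφ₂ : φ₂ < π / 2)
    (hu : ∀ x, 0 < x → x < π / 2 → HasDerivAt u (v x) x)
    (hv : ∀ x, 0 < x → x < π / 2 → HasDerivAt v (-(trigPot κ σ N x * u x)) x)
    (h1 : K / N ≤ φ) (h2 : φ ≤ φ₂) :
    v φ ^ 2 + trigPot κ σ N φ * u φ ^ 2 ≤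
      2 * (v (K / N) ^ 2 + trigPot κ σ N (K / N) * u (K / N) ^ 2) ∧
    v (K / N) ^ 2 + trigPot κ σ N (K / N) * u (K / N) ^ 2 ≤
      2 * (v φ ^ 2 + trigPot κ σ N φ * u φ ^ 2) := by
  have ha : 0 < K / N := div_pos hK0 hN
  have hpos : ∀ x ∈ Set.Icc (K / N) φ, 0 < x := fun x hx => ha.trans_le hx.1
  have hlt : ∀ x ∈ Set.Icc (K / N) φ, x < π / 2 := fun x hx => by linarith [hx.2]
  have hmem : ∀ x ∈ Set.Icc (K / N) φ, N ^ 2 / 2 ≤ trigPot κ σ N x := fun x hx =>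
    (trigPot_mem hN hK0 hK hB hx.1 (hx.2.trans h2)).1
  have key := energy_comparison h1 (u := u) (v := v) (Q := trigPot κ σ N)
    (q := trigPotDeriv κ σ) (w := fun x => -(B / N ^ 2) * (x ^ 2)⁻¹)
    (w' := fun x => 2 * B / N ^ 2 / x ^ 3)
    (fun x hx => hu x (hpos x hx) (hlt x hx)) (fun x hx => hv x (hpos x hx) (hlt x hx))
    (fun x hx => hasDerivAt_trigPot
      (sin_pos_of_pos_of_lt_pi (hpos x hx) (by linarith [hlt x hx, hpos x hx]))
      (cos_pos_of_mem_Ioo ⟨by linarith [hpos x hx, pi_pos], hlt x hx⟩))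
    (fun x hx => by
      have hx0 := hpos x hx
      refine ((((hasDerivAt_id' x).pow 2).inv (pow_pos hx0 2).ne').const_mul _).congr_deriv ?_
      norm_num
      field_simp)
    (fun x hx => by have := hpos x hx; positivity)
    (fun x hx => by
      have hx0 := hpos x hx
      refine (hB N x hx0 (hx.2.trans h2)).2.trans ?_
      have h3 : 0 ≤ 2 * B / N ^ 2 / x ^ 3 := by positivity
      refine le_trans (le_of_eq ?_) (mul_le_mul_of_nonneg_right (hmem x hx) h3)
      field_simp)
  have hexp : exp (-(B / N ^ 2) * (φ ^ 2)⁻¹ - -(B / N ^ 2) * ((K / N) ^ 2)⁻¹) ≤ 2 := by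
    refine exp_half_le_two ?_
    have e1 : -(B / N ^ 2) * (φ ^ 2)⁻¹ ≤ 0 := by
      rw [neg_mul, neg_nonpos]
      positivity
    have e2 : (B / N ^ 2) * ((K / N) ^ 2)⁻¹ ≤ 1 / 2 := by
      have : (B / N ^ 2) * ((K / N) ^ 2)⁻¹ = B / K ^ 2 := by field_simp
      rw [this, div_le_div_iff₀ (by positivity) (by norm_num)]
      linarith
    linarith
  have p1 : 0 ≤ v φ ^ 2 + trigPot κ σ N φ * u φ ^ 2 := by
    have := (by positivity : 0 ≤ N ^ 2 / 2).trans (hmem φ ⟨h1, le_rfl⟩)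
    positivity
  have p2 : 0 ≤ v (K / N) ^ 2 + trigPot κ σ N (K / N) * u (K / N) ^ 2 := by
    have := (by positivity : 0 ≤ N ^ 2 / 2).trans (hmem (K / N) ⟨le_rfl, h1⟩)
    positivity
  exact ⟨key.1.trans (mul_le_mul_of_nonneg_right hexp p2),
    key.2.trans (mul_le_mul_of_nonneg_right hexp p1)⟩

lemma trigLog_sq_le (hκ : 0 < κ) (hσ : 0 < σ) {N K φ₂ : ℝ} (hN : 0 < N) (hK0 : 0 < K)
    (hK : 8 * κ ≤ K) (h2 : K / N ≤ φ₂) (hφ₂ : φ₂ < π / 2) (hσN : 4 * σ ≤ N * cos φ₂) :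
    trigLog κ σ (K / N) ^ 2 ≤ N ^ 2 / 4 := by
  have hpi := pi_pos
  have ha : 0 < K / N := div_pos hK0 hN
  have hs : 0 < sin (K / N) := sin_pos_of_pos_of_lt_pi ha (by linarith)
  have hc2 : 0 < cos φ₂ := cos_pos_of_mem_Ioo ⟨by linarith, hφ₂⟩
  have hcc : cos φ₂ ≤ cos (K / N) := cos_le_cos_of_nonneg_of_le_pi ha.le (by linarith) h2
  have hc : 0 < cos (K / N) := hc2.trans_le hcc
  have hsφ : K / N / 2 ≤ sin (K / N) := by
    refine le_trans ?_ (mul_le_sin ha.le (by linarith))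
    rw [div_mul_eq_mul_div, div_le_div_iff₀ (by positivity) pi_pos]
    nlinarith [pi_le_four]
  have h3 : κ * cos (K / N) / sin (K / N) ≤ N / 4 := by
    rw [div_le_iff₀ hs]
    have e1 : κ * cos (K / N) ≤ κ * 1 := by gcongr; exact cos_le_one _
    have e2 : N / 4 * (K / N / 2) ≤ N / 4 * sin (K / N) := by gcongr
    have e3 : N / 4 * (K / N / 2) = K / 8 := by field_simp; norm_num
    linarith
  have h4 : σ * sin (K / N) / cos (K / N) ≤ N / 4 := by
    rw [div_le_iff₀ hc]
    have e1 : σ * sin (K / N) ≤ σ * 1 := by gcongr; exact sin_le_one _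
    have e2 : N * cos φ₂ ≤ N * cos (K / N) := by gcongr
    linarith
  have h5 : 0 ≤ κ * cos (K / N) / sin (K / N) := by positivity
  have h6 : 0 ≤ σ * sin (K / N) / cos (K / N) := by positivity
  rw [trigLog, ← sq_abs]
  have : |κ * cos (K / N) / sin (K / N) - σ * sin (K / N) / cos (K / N)| ≤ N / 2 :=
    abs_le.2 ⟨by linarith, by linarith⟩
  calc _ ≤ (N / 2) ^ 2 := by gcongr
    _ = _ := by ring

lemma quarter_energy_le {X h r Q N : ℝ} (hh : h ^ 2 ≤ N ^ 2 / 4) (hQ : N ^ 2 / 2 ≤ Q) :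
    (X ^ 2 + N ^ 2 * r ^ 2) / 4 ≤ (X + h * r) ^ 2 + Q * r ^ 2 := by
  have f1 := mul_le_mul_of_nonneg_right hh (sq_nonneg r)
  have f2 := mul_le_mul_of_nonneg_right hQ (sq_nonneg r)
  linarith [sq_nonneg (X + 2 * (h * r)), sq_nonneg X]

set_option maxHeartbeats 1000000 in
/-- Solutions of the Gegenbauer-type equation are bounded below in mean. -/
lemma oscillation_lower (hκ : 0 < κ) (hσ : 0 < σ) {p q : ℝ} (hp : 0 < p) (hpq : p < q)
    (hq : q < 1) : ∃ c : ℝ, 0 < c ∧ ∃ N₀ : ℝ, ∀ N : ℝ, N₀ ≤ N → ∀ R R1 R2 : ℝ → ℝ,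
      (∀ y, HasDerivAt R (R1 y) y) → (∀ y, HasDerivAt R1 (R2 y) y) →
      (∀ y, y * (1 - y ^ 2) * R2 y + (2 * κ - (2 * (κ + σ) + 1) * y ^ 2) * R1 y +
        N ^ 2 * y * R y = 0) → R1 0 = 0 →
      c * N ^ (-κ) * |R 0| ≤ ∫ y in p..q, |R y| := by
  have hpi := pi_gt_three
  set φ₁ := arcsin p with hφ₁
  set φ₂ := arcsin q with hφ₂
  have h10 : 0 < φ₁ := arcsin_pos.2 hp
  have h12 : φ₁ < φ₂ := strictMonoOn_arcsin ⟨by linarith, by linarith⟩ ⟨by linarith, hq.le⟩ hpq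
  have h2 : φ₂ < π / 2 := arcsin_lt_pi_div_two.2 hq
  have hs1 : sin φ₁ = p := sin_arcsin (by linarith) (by linarith)
  have hs2 : sin φ₂ = q := sin_arcsin (by linarith) (by linarith)
  have hc2 : 0 < cos φ₂ := cos_pos_of_mem_Ioo ⟨by linarith, h2⟩
  obtain ⟨B, hB0, hB⟩ := trigPot_bounds hκ hσ (h10.trans h12) h2
  set K := 1 + 2 * B + 8 * κ with hKdef
  have hK1 : 1 ≤ K := by linarith
  have hK0 : 0 < K := by linarith
  have hKB : 2 * B ≤ K ^ 2 := by nlinarith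
  have hd : 0 < φ₂ - φ₁ := by linarith
  set T := (K / 2) ^ κ * cos φ₂ ^ σ * (1 / (π * K)) ^ (2 * κ) with hT
  have hT0 : 0 < T := by positivity
  refine ⟨cos φ₂ * (φ₂ - φ₁) / 96 * T, by positivity,
    1 + (κ + σ) / κ + K / φ₁ + 4 * σ / cos φ₂ + 24 / (φ₂ - φ₁), ?_⟩
  intro N hN0 R R1 R2 hR hR1 hode hR10
  have n1 : 0 < (κ + σ) / κ := by positivity
  have n2 : 0 < K / φ₁ := by positivity
  have n3 : 0 < 4 * σ / cos φ₂ := by positivity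
  have n4 : 0 < 24 / (φ₂ - φ₁) := by positivity
  have hN1 : 1 ≤ N := by linarith
  have hN : 0 < N := by linarith
  have m1 : κ + σ ≤ 4 * κ * N ^ 2 := by
    have e1 : (κ + σ) / κ ≤ N := by linarith
    rw [div_le_iff₀ hκ] at e1
    have e2 : N ≤ N ^ 2 := by nlinarith
    have e3 := mul_le_mul_of_nonneg_right e2 hκ.le
    have e4 : 0 ≤ N ^ 2 * κ := by positivity
    linarith
  have m2 : K / N ≤ φ₁ := by
    have e1 : K / φ₁ ≤ N := by linarith
    rw [div_le_iff₀ h10] at e1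
    rw [div_le_iff₀ hN]
    linarith
  have m3 : 4 * σ ≤ N * cos φ₂ := by
    have e1 : 4 * σ / cos φ₂ ≤ N := by linarith
    rwa [div_le_iff₀ hc2] at e1
  have m4 : 24 ≤ N * (φ₂ - φ₁) := by
    have e1 : 24 / (φ₂ - φ₁) ≤ N := by linarith
    rwa [div_le_iff₀ hd] at e1
  have ha : 0 < K / N := by positivity
  have hsp : ∀ x, 0 < x → x < π / 2 → 0 < sin x := fun x h h' =>
    sin_pos_of_pos_of_lt_pi h (by linarith)
  have hcp : ∀ x, 0 < x → x < π / 2 → 0 < cos x := fun x h h' =>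
    cos_pos_of_mem_Ioo ⟨by linarith, h'⟩
  set u : ℝ → ℝ := fun φ => sin φ ^ κ * cos φ ^ σ * R (sin φ) with hu
  set v : ℝ → ℝ := fun φ => sin φ ^ κ * cos φ ^ σ *
    (cos φ * R1 (sin φ) + trigLog κ σ φ * R (sin φ)) with hv
  have hud : ∀ x, 0 < x → x < π / 2 → HasDerivAt u (v x) x := fun x h h' =>
    hasDerivAt_liouville hR (hsp x h h') (hcp x h h')
  have hvd : ∀ x, 0 < x → x < π / 2 → HasDerivAt v (-(trigPot κ σ N x * u x)) x := fun x h h' =>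
    hasDerivAt_liouville_deriv hR hR1 hode h h'
  set E := v (K / N) ^ 2 + trigPot κ σ N (K / N) * u (K / N) ^ 2 with hE
  have hQa := (trigPot_mem hN hK0 hKB hB le_rfl (m2.trans h12.le)).1
  have hE0 : 0 ≤ E := by
    have := (by positivity : 0 ≤ N ^ 2 / 2).trans hQa
    positivity
  have hSE : √E ^ 2 = E := sq_sqrt hE0
  have hen : ∀ x ∈ Set.Icc φ₁ φ₂, v x ^ 2 + trigPot κ σ N x * u x ^ 2 ≤ 2 * E ∧
      E ≤ 2 * (v x ^ 2 + trigPot κ σ N x * u x ^ 2) := fun x hx =>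
    liouville_energy hN hK0 hB0 hKB hB h2 hud hvd (m2.trans hx.1) hx.2
  have hmem : ∀ x ∈ Set.Icc φ₁ φ₂, N ^ 2 / 2 ≤ trigPot κ σ N x ∧
      trigPot κ σ N x ≤ 3 * N ^ 2 / 2 := fun x hx =>
    trigPot_mem hN hK0 hKB hB (m2.trans hx.1) hx.2
  have hx0 : ∀ x ∈ Set.Icc φ₁ φ₂, 0 < x := fun x hx => h10.trans_le hx.1
  have hx1 : ∀ x ∈ Set.Icc φ₁ φ₂, x < π / 2 := fun x hx => hx.2.trans_lt h2
  have hmean := integral_abs_ge_of_energy h12 hN (sqrt_nonneg E)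
    (fun x hx => hud x (hx0 x hx) (hx1 x hx)) (fun x hx => hvd x (hx0 x hx) (hx1 x hx))
    (fun x hx => (hasDerivAt_trigPot (hsp x (hx0 x hx) (hx1 x hx))
      (hcp x (hx0 x hx) (hx1 x hx))).continuousAt.continuousWithinAt)
    (fun x hx => (hmem x hx).1) (fun x hx => (hmem x hx).2)
    (fun x hx => by rw [hSE]; linarith [(hen x hx).2])
    (fun x hx => by rw [hSE]; exact (hen x hx).1) m4
  have hstart : T * N ^ (-κ) * (N * |R 0| / 4) ≤ √E := by
    refine le_sqrt_of_sq_le ?_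
    have e1 := sin_energy_ge hκ hσ hN1 m1 hR hR1 hode hR10 hK1 (by linarith)
    have e2 := trigLog_sq_le hκ hσ hN hK0 (by linarith) (m2.trans h12.le) h2 m3
    have hsa := hsp _ ha (by linarith)
    have hca := hcp _ ha (by linarith)
    have e3 : K / N / 2 ≤ sin (K / N) := by
      refine le_trans ?_ (mul_le_sin ha.le (by linarith))
      rw [div_mul_eq_mul_div, div_le_div_iff₀ (by positivity) pi_pos]
      nlinarith [pi_le_four]
    have e4 : cos φ₂ ≤ cos (K / N) :=
      cos_le_cos_of_nonneg_of_le_pi ha.le (by linarith) (m2.trans h12.le)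
    have e5 : (K / 2) ^ κ * cos φ₂ ^ σ * N ^ (-κ) ≤ sin (K / N) ^ κ * cos (K / N) ^ σ := by
      have e6 : (K / 2) ^ κ * N ^ (-κ) = (K / N / 2) ^ κ := by
        rw [rpow_neg hN.le, ← inv_rpow hN.le, ← mul_rpow (by positivity) (by positivity)]
        congr 1
        ring
      calc _ = (K / N / 2) ^ κ * cos φ₂ ^ σ := by rw [← e6]; ring
        _ ≤ _ := by gcongr
    have e7 : (cos (K / N) * R1 (sin (K / N)) + trigLog κ σ (K / N) * R (sin (K / N))) ^ 2 +
        trigPot κ σ N (K / N) * R (sin (K / N)) ^ 2 ≥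
        ((cos (K / N) * R1 (sin (K / N))) ^ 2 + N ^ 2 * R (sin (K / N)) ^ 2) / 4 :=
      quarter_energy_le e2 hQa
    have e8 : E = (sin (K / N) ^ κ * cos (K / N) ^ σ) ^ 2 *
        ((cos (K / N) * R1 (sin (K / N)) + trigLog κ σ (K / N) * R (sin (K / N))) ^ 2 +
        trigPot κ σ N (K / N) * R (sin (K / N)) ^ 2) := by
      rw [hE, hu, hv]
      ring
    have e9 : ((1 / (π * K)) ^ (2 * κ)) ^ 2 = (1 / (π * K)) ^ (4 * κ) := by
      rw [← rpow_natCast, ← rpow_mul (by positivity)]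
      congr 1
      push_cast
      ring
    rw [e8]
    calc (T * N ^ (-κ) * (N * |R 0| / 4)) ^ 2
        = ((K / 2) ^ κ * cos φ₂ ^ σ * N ^ (-κ)) ^ 2 *
          ((1 / (π * K)) ^ (4 * κ) * (N ^ 2 * R 0 ^ 2 / 4) / 4) := by
          rw [hT, ← e9, ← sq_abs (R 0)]
          ring
      _ ≤ _ := by
          refine mul_le_mul (by gcongr) ?_ (by positivity) (by positivity)
          linarith
  have hRc : Continuous R := continuous_iff_continuousAt.2 fun y => (hR y).continuousAt
  have hsub : ∫ y in p..q, |R y| = ∫ φ in φ₁..φ₂, |R (sin φ)| * cos φ := by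
    rw [← hs1, ← hs2]
    exact (intervalIntegral.integral_comp_mul_deriv (f := sin) (f' := cos) (g := fun y => |R y|)
      (fun x _ => hasDerivAt_sin x) continuousOn_cos hRc.abs).symm
  have hcmp : ∫ φ in φ₁..φ₂, cos φ₂ * |u φ| ≤ ∫ φ in φ₁..φ₂, |R (sin φ)| * cos φ := by
    refine intervalIntegral.integral_mono_on h12.le ?_ ?_ fun x hx => ?_
    · refine ContinuousOn.intervalIntegrable ?_
      rw [Set.uIcc_of_le h12.le]
      exact continuousOn_const.mul (ContinuousOn.abs fun x hx =>
        (hud x (hx0 x hx) (hx1 x hx)).continuousAt.continuousWithinAt)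
    · exact Continuous.intervalIntegrable (by fun_prop) _ _
    · have hs := hsp x (hx0 x hx) (hx1 x hx)
      have hc := hcp x (hx0 x hx) (hx1 x hx)
      have f1 : sin x ^ κ ≤ 1 := rpow_le_one hs.le (sin_le_one x) hκ.le
      have f2 : cos x ^ σ ≤ 1 := rpow_le_one hc.le (cos_le_one x) hσ.le
      have f3 : |u x| ≤ |R (sin x)| := by
        rw [hu]
        simp only [abs_mul]
        rw [abs_of_pos (rpow_pos_of_pos hs κ), abs_of_pos (rpow_pos_of_pos hc σ)]
        refine mul_le_of_le_one_left (abs_nonneg _) (mul_le_one₀ f1 (by positivity) f2)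
      have f4 : cos φ₂ ≤ cos x :=
        cos_le_cos_of_nonneg_of_le_pi (hx0 x hx).le (by linarith) hx.2
      rw [mul_comm |R (sin x)|]
      gcongr
  rw [intervalIntegral.integral_const_mul] at hcmp
  rw [hsub]
  refine le_trans ?_ hcmp
  rw [mul_assoc, mul_div_assoc, mul_assoc, mul_assoc]
  refine mul_le_mul_of_nonneg_left ?_ hc2.le
  have g1 := mul_le_mul_of_nonneg_left hstart hd.le
  refine le_of_mul_le_mul_left ?_ (show 0 < 24 * N by positivity)
  calc 24 * N * ((φ₂ - φ₁) / 96 * (T * (N ^ (-κ) * |R 0|)))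
      = (φ₂ - φ₁) * (T * N ^ (-κ) * (N * |R 0| / 4)) := by ring
    _ ≤ _ := g1.trans hmean
end LowerOscillation

section JacobiAverage
open Polynomial

/-- The average of a Gegenbauer polynomial against a symmetric Jacobi weight. -/
noncomputable def jacAvg (κ l : ℝ) (n : ℕ) (y : ℝ) : ℝ :=
  ∫ s in Set.Icc (-1 : ℝ) 1, gegenC n l (y * s) * (1 - s ^ 2) ^ (κ - 1)

/-- The polynomial whose values are the averages `jacAvg`. -/
noncomputable def jacAvgPoly (κ l : ℝ) (n : ℕ) : ℝ[X] :=
  ∑ k ∈ range ((gegenPoly n l).natDegree + 1),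
    C ((gegenPoly n l).coeff k * jacMoment κ k) * X ^ k

lemma coeff_jacAvgPoly (κ l : ℝ) (n k : ℕ) :
    (jacAvgPoly κ l n).coeff k = (gegenPoly n l).coeff k * jacMoment κ k := by
  simp only [jacAvgPoly, finsetSum_coeff, coeff_C_mul_X_pow]
  rw [sum_ite_eq]
  split_ifs with h
  · rfl
  · rw [coeff_eq_zero_of_natDegree_lt (by simpa [Nat.lt_succ_iff] using h), zero_mul]

lemma integrableOn_pow_mul_jacobi {κ : ℝ} (hκ : 0 < κ) (a : ℕ) :
    IntegrableOn (fun t : ℝ => t ^ a * (1 - t ^ 2) ^ (κ - 1)) (Set.Icc (-1) 1) := by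
  rw [integrableOn_Icc_iff_integrableOn_Ioc, ← intervalIntegrable_iff_integrableOn_Ioc_of_le
    (by norm_num)]
  exact intervalIntegrable_pow_mul_jacobi hκ a

lemma eval_jacAvgPoly {κ l : ℝ} (hκ : 0 < κ) (hl : 0 < l) (n : ℕ) (y : ℝ) :
    (jacAvgPoly κ l n).eval y = jacAvg κ l n y := by
  have h : ∀ s, gegenC n l (y * s) * (1 - s ^ 2) ^ (κ - 1) =
      ∑ k ∈ range ((gegenPoly n l).natDegree + 1),
        ((gegenPoly n l).coeff k * y ^ k) * (s ^ k * (1 - s ^ 2) ^ (κ - 1)) := fun s => by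
    rw [← eval_gegenPoly hl, eval_eq_sum_range, sum_mul]
    refine sum_congr rfl fun k _ => ?_
    rw [mul_pow]
    ring
  simp only [jacAvg, h]
  rw [integral_finsetSum _ fun k _ => (integrableOn_pow_mul_jacobi hκ k).const_mul _,
    jacAvgPoly, eval_finsetSum]
  refine sum_congr rfl fun k _ => ?_
  rw [integral_const_mul, ← jacMoment]
  simp only [eval_mul, eval_C, eval_pow, eval_X]
  ring

lemma jacMoment_add_two {κ : ℝ} (hκ : 0 < κ) (k : ℕ) :
    (k + 1 + 2 * κ) * jacMoment κ (k + 2) = (k + 1) * jacMoment κ k := by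
  obtain ⟨a, rfl | rfl⟩ := Nat.even_or_odd' k
  · have := integral_pow_mul_jacobi_succ hκ a
    rw [← jacMoment_eq, ← jacMoment_eq, mul_add, mul_one] at this
    push_cast
    exact this
  · rw [jacMoment_odd ⟨a, rfl⟩, jacMoment_odd ⟨a + 1, by ring⟩, mul_zero, mul_zero]

lemma coeff_jacAvgPoly_add_two {κ l : ℝ} (hκ : 0 < κ) (hl : 0 < l) (n k : ℕ) :
    ((n : ℝ) - k) * (n + k + 2 * l) * (jacAvgPoly κ l n).coeff k =
      -((k + 2) * (k + 1 + 2 * κ) * (jacAvgPoly κ l n).coeff (k + 2)) := by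
  rw [coeff_jacAvgPoly, coeff_jacAvgPoly]
  have h1 := coeff_of_gegenbauer_ode (gegenPoly_ode hl n) k
  have h2 := jacMoment_add_two hκ k
  linear_combination (jacMoment κ k) * h1 + (k + 2) * (gegenPoly n l).coeff (k + 2) * h2

lemma jacAvgPoly_ode {κ l : ℝ} (hκ : 0 < κ) (hl : 0 < l) (n : ℕ) :
    X * derivative (derivative (jacAvgPoly κ l n)) -
      X ^ 3 * derivative (derivative (jacAvgPoly κ l n)) +
      C (2 * κ) * derivative (jacAvgPoly κ l n) -
      C (2 * l + 1) * (X ^ 2 * derivative (jacAvgPoly κ l n)) +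
      C ((n : ℝ) * (n + 2 * l)) * (X * jacAvgPoly κ l n) = 0 := by
  ext k
  simp only [coeff_add, coeff_sub, coeff_C_mul, coeff_derivative, coeff_zero]
  rcases k with _ | _ | _ | k
  · have : (jacAvgPoly κ l n).coeff 1 = 0 := by
      rw [coeff_jacAvgPoly, jacMoment_odd odd_one, mul_zero]
    simp [this]
  · have := coeff_jacAvgPoly_add_two hκ hl n 0
    simp [coeff_X_pow_mul', coeff_derivative, coeff_X_mul] at this ⊢
    linarith
  · have := coeff_jacAvgPoly_add_two hκ hl n 1
    simp [coeff_X_pow_mul', coeff_derivative, coeff_X_mul] at this ⊢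
    linarith
  · have := coeff_jacAvgPoly_add_two hκ hl n (k + 2)
    rw [show k + 1 + 1 + 1 = (k + 2) + 1 by ring] at *
    simp only [coeff_X_pow_mul', coeff_X_mul, coeff_derivative]
    rw [if_pos (by omega), if_pos (by omega), show k + 2 + 1 - 3 = k by omega,
      show k + 2 + 1 - 2 = k + 1 by omega]
    push_cast at this ⊢
    rw [show k + 1 + 1 = k + 2 by ring] at *
    rw [show k + 2 + 1 + 1 = k + 2 + 2 by ring] at *
    linear_combination this

end JacobiAverage

lemma exists_pos_const_mul_le {f g : ℕ → ℝ} (hf : ∀ m, 0 < f m) (hg : ∀ m, 0 < g m) {c : ℝ}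
    (hc : 0 < c) (M : ℕ) (h : ∀ m, M ≤ m → c * f m ≤ g m) :
    ∃ c' : ℝ, 0 < c' ∧ ∀ m, c' * f m ≤ g m := by
  induction M generalizing c with
  | zero => exact ⟨c, hc, fun m => h m (Nat.zero_le m)⟩
  | succ M ih =>
    refine ih (c := min c (g M / f M)) (lt_min hc (div_pos (hg M) (hf M))) fun m hm => ?_
    rcases hm.eq_or_lt with rfl | hm
    · refine (mul_le_mul_of_nonneg_right (min_le_right _ _) (hf _).le).trans_eq ?_
      exact div_mul_cancel₀ _ (hf _).ne'
    · exact (mul_le_mul_of_nonneg_right (min_le_left _ _) (hf m).le).trans (h m hm)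

section JacobiAverageLower
open Polynomial

lemma jacAvg_zero (κ l : ℝ) (n : ℕ) : jacAvg κ l n 0 = gegenC n l 0 * jacMoment κ 0 := by
  simp only [jacAvg, zero_mul, jacMoment, pow_zero, one_mul]
  rw [integral_const_mul]

lemma continuous_jacAvg {κ l : ℝ} (hκ : 0 < κ) (hl : 0 < l) (n : ℕ) :
    Continuous (jacAvg κ l n) := by
  simp only [← funext (eval_jacAvgPoly hκ hl n)]
  exact (jacAvgPoly κ l n).continuous

lemma integral_abs_jacAvg_pos {κ l p q : ℝ} (hκ : 0 < κ) (hl : 0 < l) (hpq : p < q) (m : ℕ) :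
    0 < ∫ y in p..q, |jacAvg κ l (2 * m) y| := by
  have h0 : jacAvgPoly κ l (2 * m) ≠ 0 := fun h => by
    have h1 := eval_jacAvgPoly hκ hl (2 * m) 0
    rw [h, eval_zero, jacAvg_zero, gegenC_two_mul_zero m hl] at h1
    have h2 := (jacMoment_zero_pos hκ).ne'
    have h3 : (0 : ℝ) < poch l m / m.factorial := div_pos (poch_pos hl m) (by positivity)
    have h4 : ((-1 : ℝ) ^ m) ≠ 0 := by positivity
    exact mul_ne_zero (mul_ne_zero h4 h3.ne') h2 h1.symm
  obtain ⟨y, hy, hy0⟩ : ∃ y ∈ Set.Icc p q, jacAvg κ l (2 * m) y ≠ 0 := by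
    by_contra! h
    refine h0 (eq_zero_of_infinite_isRoot _ ((Set.Icc_infinite hpq).mono fun y hy => ?_))
    change eval y _ = 0
    rw [eval_jacAvgPoly hκ hl, h y hy]
  exact intervalIntegral.integral_pos hpq (continuous_jacAvg hκ hl _).abs.continuousOn
    (fun x _ => abs_nonneg _) ⟨y, hy, abs_pos.2 hy0⟩

/-- The mean of an even-degree Jacobi average over a compact interval inside `(0, 1)`. -/
lemma integral_abs_jacAvg_ge {κ σ p q : ℝ} (hκ : 0 < κ) (hσ : 0 < σ) (hp : 0 < p) (hpq : p < q)
    (hq : q < 1) : ∃ c : ℝ, 0 < c ∧ ∀ m : ℕ,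
      c * ((m : ℝ) + 1) ^ (σ - 1) ≤ ∫ y in p..q, |jacAvg κ (κ + σ) (2 * m) y| := by
  have hl : 0 < κ + σ := by linarith
  obtain ⟨c, hc, N₀, h⟩ := oscillation_lower hκ hσ hp hpq hq
  obtain ⟨c', C', hc', -, hp'⟩ := poch_div_factorial_bounds hl
  have hJ := jacMoment_zero_pos hκ
  obtain ⟨M, hM⟩ := exists_nat_ge N₀
  refine exists_pos_const_mul_le (c := c * (2 + (κ + σ)) ^ (-κ) * (c' * jacMoment κ 0))
    (fun m => by positivity) (fun m => integral_abs_jacAvg_pos hκ hl hpq m) (by positivity) (M + 1)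
    fun m hm => ?_
  have hm' : (M : ℝ) + 1 ≤ m := by exact_mod_cast hm
  have hm0 : (1 : ℝ) ≤ m := by exact_mod_cast (Nat.le_add_left 1 M).trans hm
  set n : ℕ := 2 * m with hn
  have hn' : (n : ℝ) = 2 * m := by rw [hn]; push_cast; ring
  have hnn : (0 : ℝ) ≤ n * (n + 2 * (κ + σ)) := by positivity
  set N := √((n : ℝ) * (n + 2 * (κ + σ))) with hN
  have hN2 : N ^ 2 = n * (n + 2 * (κ + σ)) := sq_sqrt hnn
  have hNn : (n : ℝ) ≤ N := le_sqrt_of_sq_le (by nlinarith)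
  have hNu : N ≤ (2 + (κ + σ)) * (m + 1) := by
    refine sqrt_le_iff.2 ⟨by positivity, ?_⟩
    rw [hn']
    nlinarith [mul_nonneg (zero_le_one.trans hm0) hl.le]
  have key := h N (by linarith) (fun y => (jacAvgPoly κ (κ + σ) n).eval y)
    (fun y => (derivative (jacAvgPoly κ (κ + σ) n)).eval y)
    (fun y => (derivative (derivative (jacAvgPoly κ (κ + σ) n))).eval y)
    (fun y => (jacAvgPoly κ (κ + σ) n).hasDerivAt y)
    (fun y => (derivative (jacAvgPoly κ (κ + σ) n)).hasDerivAt y)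
    (fun y => by
      have h1 := congrArg (eval y) (jacAvgPoly_ode hκ hl n)
      simp only [eval_add, eval_sub, eval_mul, eval_C, eval_pow, eval_X, eval_zero] at h1
      rw [hN2]
      linear_combination h1)
    (by
      rw [← coeff_zero_eq_eval_zero, coeff_derivative, coeff_jacAvgPoly, zero_add,
        jacMoment_odd odd_one]
      simp)
  simp only [eval_jacAvgPoly hκ hl, jacAvg_zero] at key
  refine le_trans ?_ key
  rw [abs_mul, abs_of_pos hJ, hn, gegenC_two_mul_zero m hl, abs_mul, abs_pow, abs_neg, abs_one,
    one_pow, one_mul, abs_of_pos (div_pos (poch_pos hl m) (by positivity))]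
  have hN0 : 0 < N := by linarith
  have e1 : (2 + (κ + σ)) ^ (-κ) * ((m : ℝ) + 1) ^ (-κ) ≤ N ^ (-κ) := by
    rw [← mul_rpow (by positivity) (by positivity)]
    exact rpow_le_rpow_of_nonpos hN0 hNu (by linarith)
  have e2 := (hp' m).1
  have e3 : ((m : ℝ) + 1) ^ (σ - 1) = ((m : ℝ) + 1) ^ (-κ) * ((m : ℝ) + 1) ^ (κ + σ - 1) := by
    rw [← rpow_add (by positivity)]
    congr 1
    ring
  calc _ = c * ((2 + (κ + σ)) ^ (-κ) * ((m : ℝ) + 1) ^ (-κ)) *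
        (c' * ((m : ℝ) + 1) ^ (κ + σ - 1) * jacMoment κ 0) := by
        rw [e3]
        ring
    _ ≤ _ := by gcongr
end JacobiAverageLower

section EdgeAverage

lemma integral_Icc_of_odd {f : ℝ → ℝ} (hf : ∀ s, f (-s) = -f s) :
    ∫ s in Set.Icc (-1 : ℝ) 1, f s = 0 := by
  rw [integral_Icc_eq_integral_Ioc, ← intervalIntegral.integral_of_le (by norm_num)]
  have h := intervalIntegral.integral_comp_neg (a := -1) (b := 1) f
  simp only [neg_neg, hf, intervalIntegral.integral_neg] at h
  linarith

/-- The one-dimensional profile of a projection kernel with one argument at a vertex. -/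
noncomputable def edgeAvg (κ l : ℝ) (n : ℕ) (y : ℝ) : ℝ :=
  ∫ s in Set.Icc (-1 : ℝ) 1, gegenC n l (y * s) * ((1 + s) * (1 - s ^ 2) ^ (κ - 1))

variable {κ l : ℝ}

lemma edgeAvg_eq_add (hκ : 0 < κ) (hl : 0 < l) (n : ℕ) (y : ℝ) :
    edgeAvg κ l n y = jacAvg κ l n y +
      ∫ s in Set.Icc (-1 : ℝ) 1, gegenC n l (y * s) * s * (1 - s ^ 2) ^ (κ - 1) := by
  have hc := continuous_gegenC hl n
  rw [jacAvg, ← integral_add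
    ((integrableOn_jacobi hκ).continuousOn_mul (by fun_prop) isCompact_Icc)
    ((integrableOn_jacobi hκ).continuousOn_mul (by fun_prop) isCompact_Icc), edgeAvg]
  congr 1
  ext s
  ring

lemma edgeAvg_even (hκ : 0 < κ) (hl : 0 < l) (m : ℕ) (y : ℝ) :
    edgeAvg κ l (2 * m) y = jacAvg κ l (2 * m) y := by
  rw [edgeAvg_eq_add hκ hl, integral_Icc_of_odd, add_zero]
  intro s
  rw [mul_neg y s, gegenC_neg hl, neg_sq, (even_two_mul m).neg_one_pow]
  ring

lemma integral_gegenC_mul_jacobi (hκ : 0 < κ) (hl : 0 < l) (n : ℕ) (y : ℝ) :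
    ∫ s in Set.Icc (-1 : ℝ) 1, gegenC (n + 1) l (y * s) * s * (1 - s ^ 2) ^ (κ - 1) =
      l * y / κ * jacAvg (κ + 1) (l + 1) n y := by
  have hl1 : 0 < l + 1 := by linarith
  have hc := continuous_gegenC hl (n + 1)
  have hc1 := continuous_gegenC hl1 n
  have i1 : IntervalIntegrable (fun s : ℝ => gegenC n (l + 1) (y * s) * (1 - s ^ 2) ^ (κ + 1 - 1))
      volume (-1) 1 :=
    (intervalIntegrable_jacobi (by linarith)).continuousOn_mul (by fun_prop)
  have i2 : IntervalIntegrable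
      (fun s : ℝ => gegenC (n + 1) l (y * s) * s * (1 - s ^ 2) ^ (κ - 1)) volume (-1) 1 :=
    (intervalIntegrable_jacobi hκ).continuousOn_mul (by fun_prop)
  have h := intervalIntegral.integral_eq_sub_of_hasDerivAt_of_le (a := -1) (b := 1)
    (f := fun s : ℝ => gegenC (n + 1) l (y * s) * (1 - s ^ 2) ^ κ) (by norm_num)
    (ContinuousOn.mul (by fun_prop) (ContinuousOn.rpow_const (by fun_prop) fun t _ => Or.inr hκ.le))
    (fun s hs => ?_) ((i1.const_mul (2 * l * y)).sub (i2.const_mul (2 * κ)))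
  · rw [intervalIntegral.integral_sub (i1.const_mul _) (i2.const_mul _),
      intervalIntegral.integral_const_mul, intervalIntegral.integral_const_mul] at h
    norm_num [zero_rpow hκ.ne'] at h
    rw [jacAvg, integral_Icc_eq_integral_Ioc, integral_Icc_eq_integral_Ioc,
      ← intervalIntegral.integral_of_le (by norm_num),
      ← intervalIntegral.integral_of_le (by norm_num), div_mul_eq_mul_div, eq_div_iff hκ.ne']
    norm_num
    linarith
  · have hpos : 0 < 1 - s ^ 2 := by nlinarith [hs.1, hs.2]
    have h1 : HasDerivAt (fun t : ℝ => 1 - t ^ 2) (-(2 * s)) s := by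
      simpa using ((hasDerivAt_id s).pow 2).const_sub 1
    have h0 : HasDerivAt (fun t : ℝ => y * t) y s := by
      simpa using (hasDerivAt_id s).const_mul y
    have h2 := ((hasDerivAt_gegenC hl n (y * s)).comp s h0).mul
      (h1.rpow_const (p := κ) (Or.inl hpos.ne'))
    refine h2.congr_deriv ?_
    simp only [add_sub_cancel_right, Function.comp_apply]
    ring

lemma edgeAvg_odd (hκ : 0 < κ) (hl : 0 < l) (m : ℕ) (y : ℝ) :
    edgeAvg κ l (2 * m + 1) y = l * y / κ * jacAvg (κ + 1) (l + 1) (2 * m) y := by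
  rw [edgeAvg_eq_add hκ hl, integral_gegenC_mul_jacobi hκ hl, jacAvg, integral_Icc_of_odd, zero_add]
  intro s
  rw [mul_neg, gegenC_neg hl, neg_sq, (odd_two_mul_add_one m).neg_one_pow]
  ring

lemma continuous_edgeAvg (hκ : 0 < κ) (hl : 0 < l) (n : ℕ) : Continuous (edgeAvg κ l n) := by
  obtain ⟨m, rfl | rfl⟩ := n.even_or_odd'
  · exact (continuous_jacAvg hκ hl _).congr fun y => (edgeAvg_even hκ hl m y).symm
  · have := continuous_jacAvg (κ := κ + 1) (l := l + 1) (by linarith) (by linarith) (2 * m)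
    exact (show Continuous fun y => l * y / κ * jacAvg (κ + 1) (l + 1) (2 * m) y by
      fun_prop).congr fun y => (edgeAvg_odd hκ hl m y).symm

lemma integral_abs_edgeAvg_ge {κ σ p q : ℝ} (hκ : 0 < κ) (hσ : 0 < σ) (hp : 0 < p) (hpq : p < q)
    (hq : q < 1) : ∃ c : ℝ, 0 < c ∧ ∀ n : ℕ, 1 ≤ n →
      c * (n : ℝ) ^ (σ - 1) ≤ ∫ y in p..q, |edgeAvg κ (κ + σ) n y| := by
  have hl : 0 < κ + σ := by linarith
  obtain ⟨c₀, hc₀, h₀⟩ := integral_abs_jacAvg_ge hκ hσ hp hpq hq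
  obtain ⟨c₁, hc₁, h₁⟩ := integral_abs_jacAvg_ge (κ := κ + 1) (by linarith) hσ hp hpq hq
  obtain ⟨C, hC, h2⟩ := half_rpow_le (1 - σ)
  set c := min c₀ ((κ + σ) * p / κ * c₁) with hc
  have hcpos : 0 < c := by positivity
  have key : ∀ m n : ℕ, 1 ≤ n → n ≤ 2 * m + 1 → m + 1 ≤ 2 * n →
      c / C * (n : ℝ) ^ (σ - 1) ≤ c * ((m : ℝ) + 1) ^ (σ - 1) := fun m n hn ha hb => by
    have h3 := h2 m n hn ha hb
    have hn' : (0 : ℝ) < n := by exact_mod_cast hn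
    have hm' : (0 : ℝ) < (m : ℝ) + 1 := by positivity
    rw [show σ - 1 = -(1 - σ) by ring, rpow_neg hn'.le, rpow_neg hm'.le, div_mul_eq_mul_div,
      div_le_iff₀ hC, mul_assoc]
    refine mul_le_mul_of_nonneg_left ?_ hcpos.le
    have h4 := rpow_pos_of_pos hn' (1 - σ)
    have h5 := rpow_pos_of_pos hm' (1 - σ)
    rw [inv_mul_eq_div, inv_le_comm₀ h4 (by positivity), inv_div, div_le_iff₀ hC]
    linarith
  refine ⟨c / C, by positivity, fun n hn => ?_⟩
  obtain ⟨m, rfl | rfl⟩ := n.even_or_odd'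
  · refine (key m _ hn (by omega) (by omega)).trans ?_
    simp only [edgeAvg_even hκ hl]
    exact (mul_le_mul_of_nonneg_right (min_le_left _ _) (by positivity)).trans (h₀ m)
  · refine (key m _ hn (by omega) (by omega)).trans ?_
    simp only [edgeAvg_odd hκ hl]
    refine (mul_le_mul_of_nonneg_right (min_le_right _ _) (by positivity)).trans ?_
    rw [mul_assoc]
    refine (mul_le_mul_of_nonneg_left (h₁ m) (by positivity)).trans ?_
    rw [← intervalIntegral.integral_const_mul]
    have hcont := continuous_jacAvg (κ := κ + 1) (l := κ + σ + 1) (by linarith) (by linarith) (2 * m)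
    rw [show κ + 1 + σ = κ + σ + 1 by ring]
    refine intervalIntegral.integral_mono_on hpq.le
      (Continuous.intervalIntegrable (by fun_prop) _ _)
      (Continuous.intervalIntegrable (by fun_prop) _ _) fun y hy => ?_
    rw [abs_mul, abs_of_nonneg (show 0 ≤ (κ + σ) * y / κ by
      have := hp.le.trans hy.1; positivity)]
    have := hy.1
    gcongr
end EdgeAverage

section VertexKernel

lemma integral_one_add_mul_jacobi {q : ℝ} (hq : 0 < q) :
    ∫ s in Set.Icc (-1 : ℝ) 1, (1 + s) * (1 - s ^ 2) ^ (q - 1) = jacMoment q 0 := by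
  have h := integral_wprod (m := 1) (κ := fun _ => q) fun _ => hq
  have h2 := integral_cube_prod (m := 1) fun _ s => (1 + s) * (1 - s ^ 2) ^ (q - 1)
  unfold wprod at h
  rw [h2] at h
  simpa using h

lemma integral_cube_gegenC_single {m : ℕ} {κ : Fin m → ℝ} (hκ : ∀ i, 0 < κ i) (l : ℝ) (n : ℕ)
    (j : Fin m) (z : ℝ) :
    ∫ t in cube m, gegenC n l (z * t j) * wprod κ t =
      edgeAvg (κ j) l n z * ∏ i ∈ univ.erase j, jacMoment (κ i) 0 := by
  have h := integral_cube_prod fun (i : Fin m) s =>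
    (if i = j then gegenC n l (z * s) else 1) * ((1 + s) * (1 - s ^ 2) ^ (κ i - 1))
  simp only [prod_mul_distrib (f := fun i => if i = j then _ else _), prod_ite_eq', mem_univ,
    if_true] at h
  unfold wprod
  rw [h, ← mul_prod_erase _ _ (mem_univ j)]
  congr 1
  · simp only [if_true, edgeAvg]
  · refine prod_congr rfl fun i hi => ?_
    simp only [(mem_erase.1 hi).1, if_false, one_mul]
    exact integral_one_add_mul_jacobi (hκ i)

lemma hP_of_vertex {d : ℕ} {κ : Fin (d + 1) → ℝ} (hκ : ∀ i, 0 < κ i) (n : ℕ) (j : Fin (d + 1))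
    {x : EuclideanSpace ℝ (Fin (d + 1))} (hx : ∀ i, x i = if i = j then 1 else 0)
    (y : EuclideanSpace ℝ (Fin (d + 1))) :
    hP d κ n x y = (n + lamK d κ) / (lamK d κ * jacMoment (κ j) 0) *
      edgeAvg (κ j) (lamK d κ) n (y j) := by
  have hs : ∀ t : Fin (d + 1) → ℝ, ∑ i, x i * y i * t i = y j * t j := fun t => by
    simp [hx]
  have hprod := (prod_pos fun i (_ : i ∈ univ.erase j) => jacMoment_zero_pos (hκ i)).ne'
  simp only [hP, hs]
  rw [integral_wprod hκ, integral_cube_gegenC_single hκ, ← mul_prod_erase _ _ (mem_univ j)]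
  generalize ∏ i ∈ univ.erase j, jacMoment (κ i) 0 = E at *
  have hJ := (jacMoment_zero_pos (hκ j)).ne'
  generalize jacMoment (κ j) 0 = J at *
  rw [mul_inv, ← div_div]
  generalize (n + lamK d κ) / lamK d κ = K
  field_simp

variable {d : ℕ} {κ : Fin (d + 1) → ℝ}

lemma ballP_of_basis (hκ : ∀ i, 0 < κ i) (n : ℕ) (j : Fin d) (y : EuclideanSpace ℝ (Fin d)) :
    ballP d κ n (EuclideanSpace.single j 1) y =
      (n + lamK d κ) / (lamK d κ * jacMoment (κ j.castSucc) 0) *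
        edgeAvg (κ j.castSucc) (lamK d κ) n (y j) := by
  have hx : ∀ i, liftB d (EuclideanSpace.single j 1)
      (√(1 - ‖(EuclideanSpace.single j 1 : EuclideanSpace ℝ (Fin d))‖ ^ 2)) i =
      if i = j.castSucc then 1 else 0 := fun i => by
    induction i using Fin.lastCases with
    | last => simp [(Fin.castSucc_lt_last j).ne']
    | cast i => simp
  rw [ballP, hP_of_vertex hκ n _ hx, hP_of_vertex hκ n _ hx]
  simp

lemma ballP_zero (hd : 1 ≤ d) (hκ : ∀ i, 0 < κ i) (m : ℕ) (y : EuclideanSpace ℝ (Fin d)) :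
    ballP d κ (2 * m) 0 y =
      ((2 * m : ℕ) + lamK d κ) / (lamK d κ * jacMoment (κ (Fin.last d)) 0) *
        edgeAvg (κ (Fin.last d)) (lamK d κ) (2 * m) (√(1 - ‖y‖ ^ 2)) := by
  have hl := lamK_pos hd hκ
  have hx : ∀ i, liftB d 0 (√(1 - ‖(0 : EuclideanSpace ℝ (Fin d))‖ ^ 2)) i =
      if i = Fin.last d then 1 else 0 := fun i => by
    induction i using Fin.lastCases with
    | last => simp
    | cast i => simp [(Fin.castSucc_lt_last i).ne]
  rw [ballP, hP_of_vertex hκ _ _ hx, hP_of_vertex hκ _ _ hx, liftB_last, liftB_last,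
    edgeAvg_even (hκ _) hl, edgeAvg_even (hκ _) hl, jacAvg, jacAvg]
  simp only [neg_mul, gegenC_neg hl, (even_two_mul m).neg_one_pow, one_mul]
  ring
end VertexKernel

section Slab
variable {k : ℕ}

/-- A box with one distinguished coordinate in `[p, q]` and all other coordinates in `[δ, 2δ]`. -/
def slab (i₀ : Fin (k + 1)) (p q δ : ℝ) : Set (EuclideanSpace ℝ (Fin (k + 1))) :=
  {y | y i₀ ∈ Set.Icc p q ∧ ∀ i, y (i₀.succAbove i) ∈ Set.Icc δ (2 * δ)}

variable {i₀ : Fin (k + 1)} {p q δ : ℝ}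

lemma norm_sq_eq_insertNth (i₀ : Fin (k + 1)) (y : EuclideanSpace ℝ (Fin (k + 1))) :
    ‖y‖ ^ 2 = y i₀ ^ 2 + ∑ i, y (i₀.succAbove i) ^ 2 := by
  rw [EuclideanSpace.norm_sq_eq, Fin.sum_univ_succAbove _ i₀]
  simp

lemma sum_sq_le_of_mem_Icc (hδ : 0 < δ) {z : Fin k → ℝ} (hz : ∀ i, z i ∈ Set.Icc δ (2 * δ)) :
    ∑ i, z i ^ 2 ≤ k * (4 * δ ^ 2) := by
  refine (sum_le_card_nsmul _ _ (4 * δ ^ 2) fun i _ => ?_).trans_eq (by simp)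
  nlinarith [(hz i).1, (hz i).2]

lemma norm_sq_le_of_mem_slab (hp : 0 < p) (hδ : 0 < δ) {y : EuclideanSpace ℝ (Fin (k + 1))}
    (hy : y ∈ slab i₀ p q δ) : ‖y‖ ^ 2 ≤ q ^ 2 + k * (4 * δ ^ 2) := by
  rw [norm_sq_eq_insertNth i₀]
  have h1 := hy.1.1
  have h2 := hy.1.2
  have h3 : 0 ≤ y i₀ := hp.le.trans h1
  exact add_le_add (by gcongr) (sum_sq_le_of_mem_Icc hδ hy.2)

lemma isClosed_slab : IsClosed (slab i₀ p q δ) := by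
  have : slab i₀ p q δ = {y | y i₀ ∈ Set.Icc p q} ∩
      ⋂ i, {y | y (i₀.succAbove i) ∈ Set.Icc δ (2 * δ)} := by
    ext y
    simp [slab]
  rw [this]
  exact (isClosed_Icc.preimage (by fun_prop)).inter
    (isClosed_iInter fun i => isClosed_Icc.preimage (by fun_prop))

lemma slab_subset_closedBall (hp : 0 < p) (hδ : 0 < δ) (h : q ^ 2 + k * (4 * δ ^ 2) ≤ 1) :
    slab i₀ p q δ ⊆ Metric.closedBall 0 1 := fun y hy => by
  have := (norm_sq_le_of_mem_slab hp hδ hy).trans h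
  rw [mem_closedBall_zero_iff]
  nlinarith [norm_nonneg y]

lemma isCompact_slab (hp : 0 < p) (hδ : 0 < δ) (h : q ^ 2 + k * (4 * δ ^ 2) ≤ 1) :
    IsCompact (slab i₀ p q δ) :=
  (isCompact_closedBall _ _).of_isClosed_subset isClosed_slab (slab_subset_closedBall hp hδ h)

lemma exists_le_WB_of_mem_slab (κ : Fin (k + 1 + 1) → ℝ) (hκ : ∀ i, 0 < κ i) (hp : 0 < p)
    (hδ : 0 < δ) (h : q ^ 2 + k * (4 * δ ^ 2) < 1) :
    ∃ w : ℝ, 0 < w ∧ ∀ y ∈ slab i₀ p q δ, w ≤ WB (k + 1) κ y := by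
  refine (isCompact_slab hp hδ h.le).exists_forall_le' (a := 0) ?_ ?_
  · refine ContinuousOn.mul (continuousOn_finsetProd _ fun i _ => ?_) ?_
    · exact ContinuousOn.rpow_const (by fun_prop) fun y _ => Or.inr (by have := hκ i.castSucc; linarith)
    · refine ContinuousOn.rpow_const (by fun_prop) fun y hy => Or.inl ?_
      have := norm_sq_le_of_mem_slab hp hδ hy
      linarith
  · intro y hy
    have h1 := norm_sq_le_of_mem_slab hp hδ hy
    have h2 : ∀ i, 0 < y i := i₀.forall_iff_succAbove.2
      ⟨hp.trans_le hy.1.1, fun i => hδ.trans_le (hy.2 i).1⟩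
    refine mul_pos (prod_pos fun i _ => rpow_pos_of_pos (abs_pos.2 (h2 i).ne') _) ?_
    exact rpow_pos_of_pos (by linarith) _

/-- Fubini's theorem on a slab. -/
lemma slab_integral_ge (hpq : p ≤ q) (hδ : 0 < δ) {G : EuclideanSpace ℝ (Fin (k + 1)) → ℝ}
    (hG : Continuous G) {A : ℝ} (hA : ∀ z : Fin k → ℝ, (∀ i, z i ∈ Set.Icc δ (2 * δ)) →
      A ≤ ∫ a in p..q, G (WithLp.toLp 2 (i₀.insertNth a z))) :
    δ ^ k * A ≤ ∫ y in slab i₀ p q δ, G y := by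
  set e := (MeasurableEquiv.toLp 2 (Fin (k + 1) → ℝ)).symm.trans
    (MeasurableEquiv.piFinSuccAbove (fun _ => ℝ) i₀) with he
  have hmp : MeasurePreserving e volume volume :=
    (volume_preserving_piFinSuccAbove (fun _ => ℝ) i₀).comp
      (EuclideanSpace.volume_preserving_symm_measurableEquiv_toLp _)
  set g : ℝ × (Fin k → ℝ) → ℝ := fun w => G (WithLp.toLp 2 (i₀.insertNth w.1 w.2)) with hg
  have hgc : Continuous g := by
    have : Continuous fun w : ℝ × (Fin k → ℝ) =>
        (i₀.insertNth w.1 w.2 : Fin (k + 1) → ℝ) :=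
      Continuous.finInsertNth (A := fun _ : Fin (k + 1) => ℝ) i₀ continuous_fst continuous_snd
    exact hG.comp ((PiLp.continuous_toLp 2 _).comp this)
  have hge : ∀ y, g (e y) = G y := fun y => by
    rw [← e.symm_apply_apply y]
    generalize e y = w
    simp only [e.apply_symm_apply]
    rfl
  set Z : Set (Fin k → ℝ) := Set.univ.pi fun _ => Set.Icc δ (2 * δ) with hZ
  have hZm : MeasurableSet Z := MeasurableSet.univ_pi fun _ => measurableSet_Icc
  have hZc : IsCompact Z := isCompact_univ_pi fun _ => isCompact_Icc
  have hs : slab i₀ p q δ = e ⁻¹' (Set.Icc p q ×ˢ Z) := by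
    ext y
    simp only [slab, Set.mem_ofPred_eq, Set.mem_preimage, Set.mem_prod, hZ, Set.mem_univ_pi]
    rfl
  have hint : IntegrableOn g (Set.Icc p q ×ˢ Z) (volume.prod volume) := by
    rw [← Measure.volume_eq_prod]
    exact hgc.continuousOn.integrableOn_compact (isCompact_Icc.prod hZc)
  have h1 : ∫ y in slab i₀ p q δ, G y = ∫ z in Z, ∫ a in Set.Icc p q, g (a, z) := by
    rw [hs, ← funext hge, hmp.setIntegral_preimage_emb e.measurableEmbedding,
      Measure.volume_eq_prod, ← Measure.prod_restrict]
    rw [IntegrableOn, ← Measure.prod_restrict] at hint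
    exact integral_prod_symm g hint
  have h2 : IntegrableOn (fun z => ∫ a in Set.Icc p q, g (a, z)) Z := by
    rw [IntegrableOn, ← Measure.prod_restrict] at hint
    exact hint.integral_prod_right
  have hvol : volume.real Z = δ ^ k := by
    rw [hZ, measureReal_def, volume_pi_pi]
    simp [two_mul, ENNReal.toReal_ofReal hδ.le]
  have h3 := setIntegral_mono_on (μ := volume) (f := fun _ : Fin k → ℝ => A)
    (integrableOn_const hZc.measure_lt_top.ne) h2 hZm fun z hz => by
      rw [integral_Icc_eq_integral_Ioc, ← intervalIntegral.integral_of_le hpq]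
      exact hA z fun i => hz i (Set.mem_univ i)
  rw [h1]
  refine le_trans (le_of_eq ?_) h3
  rw [setIntegral_const, hvol, smul_eq_mul]

end Slab

/-- Restriction of an integral over the arc `a ↦ √(c - a²)`. -/
lemma integral_comp_sqrt_sub_sq_ge {f : ℝ → ℝ} (hf : Continuous f) (h0 : ∀ s, 0 ≤ f s) {c : ℝ}
    (hc : 15 / 16 ≤ c) (hc1 : c ≤ 1) :
    (∫ s in (7 / 10 : ℝ)..(9 / 10), f s) ≤ 2 * ∫ a in (1 / 4 : ℝ)..(3 / 4), f (√(c - a ^ 2)) := by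
  have hI : Set.uIcc (1 / 4 : ℝ) (3 / 4) = Set.Icc (1 / 4) (3 / 4) := Set.uIcc_of_le (by norm_num)
  have hpos : ∀ a ∈ Set.Icc (1 / 4 : ℝ) (3 / 4), (3 / 8 : ℝ) ≤ c - a ^ 2 := fun a ha => by
    nlinarith [ha.1, ha.2]
  have hsq : ∀ a ∈ Set.Icc (1 / 4 : ℝ) (3 / 4), (3 / 8 : ℝ) ≤ √(c - a ^ 2) := fun a ha =>
    le_sqrt_of_sq_le (by linarith [hpos a ha])
  have hd : ∀ a ∈ Set.Icc (1 / 4 : ℝ) (3 / 4),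
      HasDerivAt (fun a => √(c - a ^ 2)) (-(a / √(c - a ^ 2))) a := fun a ha => by
    have h1 : HasDerivAt (fun a : ℝ => c - a ^ 2) (-(2 * a)) a := by
      simpa using ((hasDerivAt_id a).pow 2).const_sub c
    refine (h1.sqrt (by linarith [hpos a ha])).congr_deriv ?_
    have := hsq a ha
    field_simp
  have hd' : ContinuousOn (fun a => -(a / √(c - a ^ 2))) (Set.Icc (1 / 4 : ℝ) (3 / 4)) := by
    refine (ContinuousOn.div (by fun_prop) (by fun_prop) fun a ha => ?_).neg
    linarith [hsq a ha]
  have h := intervalIntegral.integral_comp_mul_deriv' (g := f) (hI ▸ hd) (hI ▸ hd') hf.continuousOn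
  have hlo : √(c - (3 / 4) ^ 2) ≤ 7 / 10 := sqrt_le_iff.2 ⟨by norm_num, by linarith⟩
  have hhi : 9 / 10 ≤ √(c - (1 / 4) ^ 2) := le_sqrt_of_sq_le (by linarith)
  have h1 : ∫ s in (7 / 10 : ℝ)..(9 / 10), f s ≤ ∫ s in √(c - (3 / 4) ^ 2)..√(c - (1 / 4) ^ 2), f s :=
    intervalIntegral.integral_mono_interval hlo (by norm_num) hhi
      (Filter.Eventually.of_forall h0) (hf.intervalIntegrable _ _)
  rw [intervalIntegral.integral_symm (√(c - (1 / 4) ^ 2)), ← h, ← intervalIntegral.integral_neg] at h1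
  refine h1.trans ?_
  rw [← intervalIntegral.integral_const_mul]
  refine intervalIntegral.integral_mono_on (by norm_num) ?_
    (Continuous.intervalIntegrable (by fun_prop) _ _) fun a ha => ?_
  · refine ContinuousOn.intervalIntegrable ?_
    rw [hI]
    exact ((hf.comp (by fun_prop)).continuousOn.mul hd').neg
  · have h2 := hsq a ha
    have h3 : a / √(c - a ^ 2) ≤ 2 := by
      rw [div_le_iff₀ (by linarith)]
      linarith [ha.2]
    have h4 := mul_le_mul_of_nonneg_left h3 (h0 (√(c - a ^ 2)))
    simp only [Function.comp_apply]
    linarith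

lemma sigmaK_eq {d : ℕ} {κ : Fin (d + 1) → ℝ} {j : Fin (d + 1)} (hj : ∀ i, κ j ≤ κ i) :
    sigmaK d κ = lamK d κ - κ j := by
  have h : univ.inf' univ_nonempty κ = κ j :=
    le_antisymm (inf'_le _ (mem_univ j)) (le_inf' _ _ fun i _ => hj i)
  rw [sigmaK, lamK, h]
  ring

lemma sigmaK_pos {d : ℕ} (hd : 1 ≤ d) {κ : Fin (d + 1) → ℝ} (hκ : ∀ i, 0 < κ i) :
    0 < sigmaK d κ := by
  obtain ⟨j, -, hj⟩ := exists_min_image univ κ univ_nonempty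
  rw [sigmaK_eq fun i => hj i (mem_univ i), lamK, ← add_sum_erase _ _ (mem_univ j)]
  have h1 : (1 : ℝ) ≤ d := by exact_mod_cast hd
  obtain ⟨i, hi⟩ : (univ.erase j).Nonempty := by
    rw [← card_pos, card_erase_of_mem (mem_univ j), card_univ, Fintype.card_fin]
    omega
  have h2 : 0 < ∑ i ∈ univ.erase j, κ i := sum_pos (fun i _ => hκ i) ⟨i, hi⟩
  linarith

section ProjNorm
variable {d : ℕ} {κ : Fin (d + 1) → ℝ}

lemma exists_projNormB_le (hd : 1 ≤ d) (hκ : ∀ i, 0 < κ i) :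
    ∃ C : ℝ, 0 < C ∧ ∀ n : ℕ, 1 ≤ n → projNormB d κ n ≤ C * (n : ℝ) ^ sigmaK d κ := by
  obtain ⟨C, hC, h⟩ := ball_kernel_bound hd hκ
  have : Nonempty (Metric.closedBall (0 : EuclideanSpace ℝ (Fin d)) 1) := ⟨⟨0, by simp⟩⟩
  exact ⟨C, hC, fun n hn => ciSup_le fun x => h n hn x x.2⟩

lemma le_projNormB (hd : 1 ≤ d) (hκ : ∀ i, 0 < κ i) {n : ℕ} (hn : 1 ≤ n)
    {x : EuclideanSpace ℝ (Fin d)} (hx : x ∈ Metric.closedBall 0 1) :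
    (∫ y in Metric.closedBall (0 : EuclideanSpace ℝ (Fin d)) 1, WB d κ y)⁻¹ *
      ∫ y in Metric.closedBall (0 : EuclideanSpace ℝ (Fin d)) 1, |ballP d κ n x y| * WB d κ y ≤
      projNormB d κ n := by
  obtain ⟨C, -, h⟩ := ball_kernel_bound hd hκ
  exact le_ciSup (f := fun x : Metric.closedBall (0 : EuclideanSpace ℝ (Fin d)) 1 =>
    (∫ y in Metric.closedBall (0 : EuclideanSpace ℝ (Fin d)) 1, WB d κ y)⁻¹ *
      ∫ y in Metric.closedBall (0 : EuclideanSpace ℝ (Fin d)) 1, |ballP d κ n x y| * WB d κ y)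
    ⟨_, Set.forall_mem_range.2 fun x => h n hn x x.2⟩ ⟨x, hx⟩
end ProjNorm

section LowerBound
variable {k : ℕ} {κ : Fin (k + 1 + 1) → ℝ}

/-- A kernel section depending on one variable is bounded below through its mean on a slab. -/
lemma projNormB_ge_of_profile (hκ : ∀ i, 0 < κ i) (j : Fin (k + 1 + 1)) (i₀ : Fin (k + 1))
    {x : EuclideanSpace ℝ (Fin (k + 1))} (hx : x ∈ Metric.closedBall 0 1)
    {φ : EuclideanSpace ℝ (Fin (k + 1)) → ℝ} (hφ : Continuous φ) {p q δ c : ℝ} (hp : 0 < p)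
    (hpq : p ≤ q) (hδ : 0 < δ) (hq : q ^ 2 + k * (4 * δ ^ 2) < 1) (hc : 0 < c) :
    ∃ c' : ℝ, 0 < c' ∧ ∀ n : ℕ, 1 ≤ n →
      (∀ y, ballP (k + 1) κ n x y =
        (n + lamK (k + 1) κ) / (lamK (k + 1) κ * jacMoment (κ j) 0) *
          edgeAvg (κ j) (lamK (k + 1) κ) n (φ y)) →
      (∀ z : Fin k → ℝ, (∀ i, z i ∈ Set.Icc δ (2 * δ)) →
        c * (n : ℝ) ^ (sigmaK (k + 1) κ - 1) ≤ ∫ a in p..q,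
          |edgeAvg (κ j) (lamK (k + 1) κ) n (φ (WithLp.toLp 2 (i₀.insertNth a z)))|) →
      c' * (n : ℝ) ^ sigmaK (k + 1) κ ≤ projNormB (k + 1) κ n := by
  have hd : 1 ≤ k + 1 := Nat.le_add_left 1 k
  have hl := lamK_pos hd hκ
  have hJ := jacMoment_zero_pos (hκ j)
  have hM := integral_WB_pos hκ
  obtain ⟨w, hw, hWB⟩ := exists_le_WB_of_mem_slab (i₀ := i₀) κ hκ hp hδ hq
  have hsub := slab_subset_closedBall (i₀ := i₀) hp hδ hq.le
  set M := ∫ y in Metric.closedBall (0 : EuclideanSpace ℝ (Fin (k + 1))) 1, WB (k + 1) κ y with hMd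
  set l := lamK (k + 1) κ with hld
  set J := jacMoment (κ j) 0 with hJd
  refine ⟨M⁻¹ * (w * (1 / (l * J)) * (δ ^ k * c)), by positivity, fun n hn hker hz => ?_⟩
  have hn' : (0 : ℝ) < n := by exact_mod_cast hn
  refine le_trans ?_ (le_projNormB hd hκ hn hx)
  rw [← hMd, mul_assoc]
  refine mul_le_mul_of_nonneg_left ?_ (by positivity)
  set K := (n + l) / (l * J) with hK
  have hK0 : 0 ≤ K := by positivity
  have hcont : Continuous fun y => |edgeAvg (κ j) l n (φ y)| :=
    ((continuous_edgeAvg (hκ j) hl n).comp hφ).abs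
  have h1 := slab_integral_ge (i₀ := i₀) hpq hδ hcont hz
  have hP : ∀ y, |ballP (k + 1) κ n x y| = K * |edgeAvg (κ j) l n (φ y)| := fun y => by
    rw [hker, abs_mul, abs_of_nonneg hK0]
  have hint : IntegrableOn (fun y => |ballP (k + 1) κ n x y| * WB (k + 1) κ y)
      (Metric.closedBall 0 1) := by
    simp only [hP]
    exact (integrableOn_WB hκ).continuousOn_mul (hcont.const_mul K).continuousOn (isCompact_closedBall _ _)
  have h2 := setIntegral_mono_set (s := slab i₀ p q δ) hint
    ((ae_restrict_mem measurableSet_closedBall).mono fun y hy =>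
      mul_nonneg (abs_nonneg _) (WB_nonneg hy)) hsub.eventuallyLE
  refine le_trans ?_ h2
  have h3 : w * K * ∫ y in slab i₀ p q δ, |edgeAvg (κ j) l n (φ y)| ≤
      ∫ y in slab i₀ p q δ, |ballP (k + 1) κ n x y| * WB (k + 1) κ y := by
    rw [← integral_const_mul]
    refine setIntegral_mono_on
      ((hcont.continuousOn.integrableOn_compact (isCompact_slab hp hδ hq.le)).const_mul _)
      (hint.mono_set hsub) isClosed_slab.measurableSet fun y hy => ?_
    rw [hP]
    have := mul_le_mul_of_nonneg_left (hWB y hy) (mul_nonneg hK0 (abs_nonneg (edgeAvg (κ j) l n (φ y))))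
    linarith
  refine le_trans ?_ h3
  have h4 : (n : ℝ) * (1 / (l * J)) ≤ K := by
    rw [hK, mul_one_div]
    gcongr
    linarith
  have h5 : (n : ℝ) ^ sigmaK (k + 1) κ = n * (n : ℝ) ^ (sigmaK (k + 1) κ - 1) := by
    rw [rpow_sub_one hn'.ne']
    field_simp
  calc w * (1 / (l * J)) * (δ ^ k * c) * (n : ℝ) ^ sigmaK (k + 1) κ
      = w * ((n : ℝ) * (1 / (l * J))) * (δ ^ k * (c * (n : ℝ) ^ (sigmaK (k + 1) κ - 1))) := by
        rw [h5]
        ring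
    _ ≤ _ := by gcongr

lemma exists_slab_width (k : ℕ) : ∃ δ : ℝ, 0 < δ ∧ k * (4 * δ ^ 2) ≤ 1 / 16 := by
  refine ⟨1 / (8 * (k + 1)), by positivity, ?_⟩
  rw [div_pow, one_pow, mul_one_div, mul_div_assoc', div_le_iff₀ (by positivity)]
  nlinarith [(Nat.cast_nonneg k : (0 : ℝ) ≤ k)]

lemma projNormB_ge_of_min_castSucc (hκ : ∀ i, 0 < κ i) {j : Fin (k + 1)}
    (hj : ∀ i, κ j.castSucc ≤ κ i) : ∃ c : ℝ, 0 < c ∧ ∀ n : ℕ, 1 ≤ n →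
      c * (n : ℝ) ^ sigmaK (k + 1) κ ≤ projNormB (k + 1) κ n := by
  have hd : 1 ≤ k + 1 := Nat.le_add_left 1 k
  have hσ := sigmaK_pos hd hκ
  have hl : lamK (k + 1) κ = κ j.castSucc + sigmaK (k + 1) κ := by rw [sigmaK_eq hj]; ring
  obtain ⟨δ, hδ, hδ'⟩ := exists_slab_width k
  obtain ⟨c, hc, h⟩ := integral_abs_edgeAvg_ge (hκ j.castSucc) hσ
    (show (0 : ℝ) < 7 / 10 by norm_num) (show (7 / 10 : ℝ) < 9 / 10 by norm_num) (by norm_num)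
  obtain ⟨c', hc', h'⟩ := projNormB_ge_of_profile hκ j.castSucc j
    (x := EuclideanSpace.single j 1) (by simp) (φ := fun y => y j) (by fun_prop)
    (show (0 : ℝ) < 7 / 10 by norm_num) (show (7 / 10 : ℝ) ≤ 9 / 10 by norm_num) hδ
    (by linarith) hc
  refine ⟨c', hc', fun n hn => h' n hn (fun y => ballP_of_basis hκ n j y) fun z _ => ?_⟩
  simp only [Fin.insertNth_apply_same, hl]
  exact h n hn

lemma projNormB_ge_of_min_last (hκ : ∀ i, 0 < κ i) (hj : ∀ i, κ (Fin.last (k + 1)) ≤ κ i) :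
    ∃ c : ℝ, 0 < c ∧ ∀ n : ℕ, 1 ≤ n → Even n →
      c * (n : ℝ) ^ sigmaK (k + 1) κ ≤ projNormB (k + 1) κ n := by
  have hd : 1 ≤ k + 1 := Nat.le_add_left 1 k
  have hσ := sigmaK_pos hd hκ
  have hl : lamK (k + 1) κ = κ (Fin.last (k + 1)) + sigmaK (k + 1) κ := by rw [sigmaK_eq hj]; ring
  obtain ⟨δ, hδ, hδ'⟩ := exists_slab_width k
  obtain ⟨c, hc, h⟩ := integral_abs_edgeAvg_ge (hκ (Fin.last (k + 1))) hσ
    (show (0 : ℝ) < 7 / 10 by norm_num) (show (7 / 10 : ℝ) < 9 / 10 by norm_num) (by norm_num)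
  obtain ⟨c', hc', h'⟩ := projNormB_ge_of_profile hκ (Fin.last (k + 1)) 0 (x := 0) (by simp)
    (φ := fun y => √(1 - ‖y‖ ^ 2)) (by fun_prop)
    (show (0 : ℝ) < 1 / 4 by norm_num) (show (1 / 4 : ℝ) ≤ 3 / 4 by norm_num) hδ
    (by linarith) (half_pos hc)
  refine ⟨c', hc', fun n hn hev => ?_⟩
  obtain ⟨m, rfl⟩ := hev.two_dvd
  refine h' _ hn (fun y => ballP_zero hd hκ m y) fun z hz => ?_
  have hz1 := sum_sq_le_of_mem_Icc hδ hz
  have hz0 : 0 ≤ ∑ i, z i ^ 2 := sum_nonneg fun i _ => sq_nonneg _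
  have hnorm : ∀ a : ℝ, 1 - ‖(WithLp.toLp 2 (Fin.insertNth 0 a z : Fin (k + 1) → ℝ) :
      EuclideanSpace ℝ (Fin (k + 1)))‖ ^ 2 = 1 - ∑ i, z i ^ 2 - a ^ 2 := fun a => by
    rw [norm_sq_eq_insertNth 0]
    simp only [Fin.insertNth_apply_same, Fin.insertNth_apply_succAbove]
    ring
  simp only [hnorm, hl]
  have h1 := integral_comp_sqrt_sub_sq_ge (c := 1 - ∑ i, z i ^ 2)
    (continuous_edgeAvg (hκ (Fin.last (k + 1))) (l := κ (Fin.last (k + 1)) + sigmaK (k + 1) κ)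
      (add_pos (hκ _) hσ) (2 * m)).abs
    (fun s => abs_nonneg _) (by linarith) (by linarith)
  have h2 := h _ hn
  linarith
end LowerBound

/-- projection norm on the ball: `Π_n^B ≤ c₂ n^{σ_κ}` for all `n ≥ 1`,
and `Π_n^B ≥ c₁ n^{σ_κ}` for all `n ≥ 1` such that `n` is even or
`min_{1≤i≤d} κ_i = min_{1≤i≤d+1} κ_i` (i.e. the overall minimum of `κ` is attained at
an index `< d`). -/
theorem projection_norm_ball (d : ℕ) (hd : 1 ≤ d) (κ : Fin (d + 1) → ℝ)
    (hκ : ∀ i, 0 < κ i) :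
    (∃ c₂ : ℝ, 0 < c₂ ∧ ∀ n : ℕ, 1 ≤ n → projNormB d κ n ≤ c₂ * (n : ℝ) ^ sigmaK d κ) ∧
    (∃ c₁ : ℝ, 0 < c₁ ∧ ∀ n : ℕ, 1 ≤ n →
      (Even n ∨ ∃ j : Fin (d + 1), (j : ℕ) < d ∧ ∀ i, κ j ≤ κ i) →
      c₁ * (n : ℝ) ^ sigmaK d κ ≤ projNormB d κ n) := by
  refine ⟨exists_projNormB_le hd hκ, ?_⟩
  obtain ⟨k, rfl⟩ : ∃ k, d = k + 1 := ⟨d - 1, by omega⟩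
  by_cases h : ∃ j : Fin (k + 1 + 1), (j : ℕ) < k + 1 ∧ ∀ i, κ j ≤ κ i
  · obtain ⟨j, hjd, hj⟩ := h
    obtain ⟨c, hc, hc'⟩ := projNormB_ge_of_min_castSucc hκ (j := ⟨j, hjd⟩) hj
    exact ⟨c, hc, fun n hn _ => hc' n hn⟩
  · obtain ⟨j, -, hj⟩ := exists_min_image univ κ univ_nonempty
    have hjl : j = Fin.last (k + 1) := by
      by_contra hne
      exact h ⟨j, Fin.val_lt_last hne, fun i => hj i (mem_univ i)⟩
    obtain ⟨c, hc, hc'⟩ := projNormB_ge_of_min_last hκ fun i => hjl ▸ hj i (mem_univ i)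
    exact ⟨c, hc, fun n hn hor => hc' n hn (hor.resolve_right h)⟩
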